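/- arXiv:math/0206293 — 5 statements merged into one kernel-verified Lean document; each statement's English description precedes it below -/
import Mathlib

section
/- Consequently (from Lemma 2.2), the function f(y) = ∫_1^y (ε(u) − B/2) du satisfies f(y) = O(y^{1/2+ε}) for every ε > 0. -/
open Real MeasureTheory

/-- The singular series of the twin prime / Goldbach type problems. -/
noncomputable def singularSeries (d : ℕ) : ℝ :=
  if Even d then
    2 * (∏' p : Nat.Primes, if 2 < (p : ℕ) then (1 - 1 / ((p : ℝ) - 1) ^ 2) else 1) *
      ∏ p ∈ d.primeFactors.filter (fun p => 2 < p), ((p : ℝ) - 1) / ((p : ℝ) - 2)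
  else 0

/-- The constant `B = -C₀ - log 2π`. -/
noncomputable def Bconst : ℝ := -Real.eulerMascheroniConstant - Real.log (2 * Real.pi)

/-- `ε(y) = Σ_{h ≤ y} 𝔖(h) - y + (1/2) log y`. -/
noncomputable def epsErr (y : ℝ) : ℝ :=
  (∑ h ∈ Finset.Icc 1 ⌊y⌋₊, singularSeries h) - y + Real.log y / 2

/-- `f(y) = ∫_1^y (ε(u) - B/2) du`. -/
noncomputable def fErr (y : ℝ) : ℝ := ∫ u in (1 : ℝ)..y, (epsErr u - Bconst / 2)

/-- The function `{x}(1 - {x}) / 2`. -/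
noncomputable def fractHump (x : ℝ) : ℝ := Int.fract x * (1 - Int.fract x) / 2

lemma fractHump_nonneg (x : ℝ) : 0 ≤ fractHump x := by
  have h1 := Int.fract_nonneg x
  have h2 := (Int.fract_lt_one x).le
  unfold fractHump
  have := mul_nonneg h1 (sub_nonneg.2 h2)
  linarith

lemma fractHump_le (x : ℝ) : fractHump x ≤ 1 / 8 := by
  unfold fractHump
  nlinarith [sq_nonneg (Int.fract x - 1 / 2)]

lemma abs_fractHump_sub_le_of_le {a b : ℝ} (hab : a ≤ b) :
    |fractHump a - fractHump b| ≤ (b - a) / 2 := by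
  have ha0 := Int.fract_nonneg a
  have ha1 := (Int.fract_lt_one a).le
  have hb0 := Int.fract_nonneg b
  have hb1 := (Int.fract_lt_one b).le
  have hfa := Int.floor_add_fract a
  have hfb := Int.floor_add_fract b
  unfold fractHump
  rcases (Int.floor_le_floor hab).eq_or_lt with h | h
  · rw [h] at hfa
    have hle : Int.fract a ≤ Int.fract b := by linarith
    rw [abs_le]
    constructor <;> nlinarith
  · have h' : (⌊a⌋ : ℝ) + 1 ≤ ⌊b⌋ := by exact_mod_cast h
    rw [abs_le]
    constructor <;> nlinarith

lemma abs_fractHump_sub_le (a b : ℝ) : |fractHump a - fractHump b| ≤ |a - b| / 2 := by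
  rcases le_total a b with h | h
  · rw [abs_sub_comm a b, abs_of_nonneg (sub_nonneg.2 h)]
    exact abs_fractHump_sub_le_of_le h
  · rw [abs_sub_comm, abs_of_nonneg (sub_nonneg.2 h)]
    exact abs_fractHump_sub_le_of_le h

lemma continuous_fractHump : Continuous fractHump := by
  refine (LipschitzWith.of_dist_le_mul (K := 1) fun a b => ?_).continuous
  rw [Real.dist_eq, Real.dist_eq]
  have := abs_fractHump_sub_le a b
  have := abs_nonneg (a - b)
  simp only [NNReal.coe_one]
  linarith

lemma sum_Icc_floor_sub {x : ℝ} (hx : 0 ≤ x) :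
    ∑ m ∈ Finset.Icc 1 ⌊x⌋₊, (x - m) = x ^ 2 / 2 - x / 2 + fractHump x := by
  have hs : ∀ n : ℕ, ∑ m ∈ Finset.Icc 1 n, (x - m) = n * x - n * (n + 1) / 2 := by
    intro n
    induction n with
    | zero => simp
    | succ k ih => rw [Finset.sum_Icc_succ_top (by omega), ih]; push_cast; ring
  have hf : Int.fract x = x - ⌊x⌋₊ := by
    rw [natCast_floor_eq_intCast_floor hx]; rfl
  rw [hs, fractHump, hf]
  ring

/-- The primitive of `fractHump x / x ^ 2` vanishing at `1`. -/
noncomputable def fractHumpPrim (x : ℝ) : ℝ := ∫ t in (1 : ℝ)..x, fractHump t / t ^ 2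

lemma intervalIntegrable_fractHump_div {a b : ℝ} (ha : 0 < a) (hb : 0 < b) :
    IntervalIntegrable (fun t => fractHump t / t ^ 2) volume a b := by
  apply ContinuousOn.intervalIntegrable
  intro t ht
  have : 0 < t := lt_of_lt_of_le (lt_min ha hb) ht.1
  exact (continuous_fractHump.continuousAt.div (by fun_prop) (by positivity)).continuousWithinAt

lemma fractHumpPrim_sub {a b : ℝ} (ha : 0 < a) (hb : 0 < b) :
    fractHumpPrim b - fractHumpPrim a = ∫ t in a..b, fractHump t / t ^ 2 :=
  intervalIntegral.integral_interval_sub_left (intervalIntegrable_fractHump_div one_pos hb)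
    (intervalIntegrable_fractHump_div one_pos ha)

lemma hasDerivAt_neg_const_div (c : ℝ) {t : ℝ} (ht : t ≠ 0) :
    HasDerivAt (fun t : ℝ => -(c / t)) (c / t ^ 2) t := by
  have := ((hasDerivAt_inv ht).const_mul c).neg
  simp only [div_eq_mul_inv]
  convert! this using 1
  simp

lemma intervalIntegrable_const_div_sq (c : ℝ) {a b : ℝ} (ha : 0 < a) (hb : 0 < b) :
    IntervalIntegrable (fun t : ℝ => c / t ^ 2) volume a b := by
  apply ContinuousOn.intervalIntegrable
  intro t ht
  have : 0 < t := lt_of_lt_of_le (lt_min ha hb) ht.1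
  exact (continuousAt_const.div (by fun_prop) (by positivity)).continuousWithinAt

lemma integral_const_div_sq (c : ℝ) {a b : ℝ} (ha : 0 < a) (hb : 0 < b) :
    ∫ t in a..b, c / t ^ 2 = c * (1 / a - 1 / b) := by
  rw [intervalIntegral.integral_eq_sub_of_hasDerivAt
    (f := fun t : ℝ => -(c / t)) _ (intervalIntegrable_const_div_sq c ha hb)]
  · ring
  · intro t ht
    have : 0 < t := lt_of_lt_of_le (lt_min ha hb) ht.1
    exact hasDerivAt_neg_const_div c this.ne'

lemma fractHumpPrim_sub_le {a b c : ℝ} (ha : 0 < a) (hab : a ≤ b)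
    (hc : ∀ t ∈ Set.Icc a b, fractHump t ≤ c) :
    fractHumpPrim b - fractHumpPrim a ≤ c * (1 / a - 1 / b) := by
  have hb := ha.trans_le hab
  rw [fractHumpPrim_sub ha hb, ← integral_const_div_sq c ha hb]
  refine intervalIntegral.integral_mono_on hab (intervalIntegrable_fractHump_div ha hb)
    (intervalIntegrable_const_div_sq c ha hb) fun t ht => ?_
  gcongr
  exact hc t ht

lemma le_fractHumpPrim_sub {a b c : ℝ} (ha : 0 < a) (hab : a ≤ b)
    (hc : ∀ t ∈ Set.Icc a b, c ≤ fractHump t) :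
    c * (1 / a - 1 / b) ≤ fractHumpPrim b - fractHumpPrim a := by
  have hb := ha.trans_le hab
  rw [fractHumpPrim_sub ha hb, ← integral_const_div_sq c ha hb]
  refine intervalIntegral.integral_mono_on hab (intervalIntegrable_const_div_sq c ha hb)
    (intervalIntegrable_fractHump_div ha hb) fun t ht => ?_
  gcongr
  exact hc t ht

lemma integral_fractHump_div_of_mem (n : ℕ) {a b : ℝ} (ha : 0 < a) (hab : a ≤ b) (hna : n ≤ a)
    (hbn : b ≤ n + 1) :
    ∫ t in a..b, fractHump t / t ^ 2 =
      (-b / 2 + (n + 1 / 2) * log b + n * (n + 1) / 2 / b) -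
      (-a / 2 + (n + 1 / 2) * log a + n * (n + 1) / 2 / a) := by
  refine intervalIntegral.integral_eq_sub_of_hasDerivAt
    (f := fun t : ℝ => -t / 2 + (n + 1 / 2) * log t + n * (n + 1) / 2 / t) ?_
    (intervalIntegrable_fractHump_div ha (ha.trans_le hab))
  intro t ht
  rw [Set.uIcc_of_le hab] at ht
  have ht0 : 0 < t := ha.trans_le ht.1
  have hg : fractHump t = (t - n) * (n + 1 - t) / 2 := by
    rcases (ht.2.trans hbn).eq_or_lt with h | h
    · have : Int.fract t = 0 := by
        rw [h]; exact_mod_cast Int.fract_natCast (n + 1)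
      rw [fractHump, this, h]; ring
    · have : Int.fract t = t - n := by
        have : ⌊t⌋ = (n : ℤ) := by
          rw [Int.floor_eq_iff]; push_cast; exact ⟨hna.trans ht.1, h⟩
        rw [Int.fract, this]; simp
      rw [fractHump, this]; ring
  have h1 := (((hasDerivAt_id t).neg.div_const 2).add
    ((Real.hasDerivAt_log ht0.ne').const_mul ((n : ℝ) + 1 / 2))).sub
    (hasDerivAt_neg_const_div ((n : ℝ) * (n + 1) / 2) ht0.ne')
  have h2 : (fun t : ℝ => -t / 2 + ((n : ℝ) + 1 / 2) * log t + (n : ℝ) * (n + 1) / 2 / t) =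
      (fun t : ℝ => -t / 2 + ((n : ℝ) + 1 / 2) * log t - -((n : ℝ) * (n + 1) / 2 / t)) := by
    funext t; ring
  rw [h2]
  convert! h1 using 1
  rw [hg]
  field_simp
  ring

lemma fractHumpPrim_of_le_one {x : ℝ} (hx : 0 < x) (hx1 : x ≤ 1) :
    fractHumpPrim x = 1 / 2 - x / 2 + log x / 2 := by
  have h := integral_fractHump_div_of_mem 0 hx hx1 (by simpa using hx.le) (by simp)
  rw [fractHumpPrim, intervalIntegral.integral_symm, h]
  simp
  ring

lemma fractHumpPrim_natCast_succ (n : ℕ) :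
    fractHumpPrim ((n + 1 : ℕ) : ℝ) = log (Stirling.stirlingSeq 1) -
      log (Stirling.stirlingSeq (n + 1)) := by
  induction n with
  | zero => simp [fractHumpPrim]
  | succ k ih =>
    have hk : (0 : ℝ) < ((k + 1 : ℕ) : ℝ) := by positivity
    have h := integral_fractHump_div_of_mem (k + 1) (b := ((k + 1 + 1 : ℕ) : ℝ)) hk
      (by push_cast; linarith) le_rfl (by push_cast; linarith)
    rw [← fractHumpPrim_sub hk (by positivity)] at h
    have h1 := Stirling.log_stirlingSeq_formula (k + 1)
    have h2 := Stirling.log_stirlingSeq_formula (k + 1 + 1)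
    have h3 : log (((k + 1 + 1).factorial : ℕ) : ℝ) =
        log ((k + 1 + 1 : ℕ) : ℝ) + log (((k + 1).factorial : ℕ) : ℝ) := by
      rw [Nat.factorial_succ, Nat.cast_mul, Real.log_mul (by positivity) (by positivity)]
    rw [Real.log_mul (by norm_num) (by positivity),
      Real.log_div (by positivity) (by positivity), Real.log_exp] at h1 h2
    rw [eq_add_of_sub_eq h, ih, h1, h2, h3]
    have : ((k + 1 + 1 : ℕ) : ℝ) = ((k + 1 : ℕ) : ℝ) + 1 := by push_cast; ring
    rw [this]
    field_simp
    ring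

open Filter Topology in
lemma tendsto_fractHumpPrim_natCast :
    Tendsto (fun n : ℕ => fractHumpPrim n) atTop (𝓝 (1 - log (2 * π) / 2)) := by
  rw [← tendsto_add_atTop_iff_nat 1]
  simp only [fractHumpPrim_natCast_succ]
  have h1 : (1 : ℝ) - log (2 * π) / 2 = log (Stirling.stirlingSeq 1) - log √π := by
    rw [Stirling.stirlingSeq_one, Real.log_div (by positivity) (by positivity), Real.log_exp,
      Real.log_sqrt (by positivity), Real.log_sqrt (by positivity),
      Real.log_mul (by positivity) (by positivity)]
    ring
  rw [h1]
  refine tendsto_const_nhds.sub ?_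
  exact ((tendsto_add_atTop_iff_nat 1).2 Stirling.tendsto_stirlingSeq_sqrt_pi).log
    (by positivity)

open Filter Topology in
lemma abs_fractHumpPrim_sub_lim_le {z : ℝ} (hz : 0 < z) :
    |fractHumpPrim z - (1 - log (2 * π) / 2)| ≤ 1 / 8 / z := by
  have hlim := tendsto_fractHumpPrim_natCast.sub_const (fractHumpPrim z)
  have h1 : 0 ≤ 1 - log (2 * π) / 2 - fractHumpPrim z := by
    refine ge_of_tendsto hlim ?_
    filter_upwards [eventually_ge_atTop ⌈z⌉₊] with n hn
    have := le_fractHumpPrim_sub hz (Nat.ceil_le.1 hn) (c := 0) fun t _ => fractHump_nonneg t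
    linarith
  have h2 : 1 - log (2 * π) / 2 - fractHumpPrim z ≤ 1 / 8 / z := by
    refine le_of_tendsto hlim ?_
    filter_upwards [eventually_ge_atTop ⌈z⌉₊] with n hn
    have hn' := Nat.ceil_le.1 hn
    have := fractHumpPrim_sub_le hz hn' (c := 1 / 8) fun t _ => fractHump_le t
    have h3 : (0 : ℝ) ≤ 1 / (n : ℝ) := by positivity
    have h4 : (1 : ℝ) / 8 / z = 1 / 8 * (1 / z) := by ring
    rw [h4]
    linarith
  rw [abs_sub_comm, abs_of_nonneg h1]
  exact h2

lemma abs_fractHump_sub_prim_le {z : ℝ} (hz : 0 < z) {f : ℕ} (hf : 1 ≤ f) :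
    |fractHump (z / f) - z * (fractHumpPrim (z / f) - fractHumpPrim (z / (f + 1 : ℕ)))| ≤
      min (1 / 8) ((z / f - z / (f + 1 : ℕ)) / 2) := by
  have hf0 : (0 : ℝ) < f := by exact_mod_cast hf
  have hf1 : (0 : ℝ) < (f + 1 : ℕ) := by positivity
  have hab : z / (f + 1 : ℕ) ≤ z / f := by
    gcongr
    omega
  have ha : 0 < z / (f + 1 : ℕ) := by positivity
  have key : ∀ c, z * (c * (1 / (z / (f + 1 : ℕ)) - 1 / (z / f))) = c := by
    intro c
    push_cast
    field_simp
    ring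
  have hlow : ∀ c, (∀ t ∈ Set.Icc (z / (f + 1 : ℕ)) (z / f), c ≤ fractHump t) →
      c ≤ z * (fractHumpPrim (z / f) - fractHumpPrim (z / (f + 1 : ℕ))) := by
    intro c hc
    calc c = _ := (key c).symm
      _ ≤ _ := mul_le_mul_of_nonneg_left (le_fractHumpPrim_sub ha hab hc) hz.le
  have hupp : ∀ c, (∀ t ∈ Set.Icc (z / (f + 1 : ℕ)) (z / f), fractHump t ≤ c) →
      z * (fractHumpPrim (z / f) - fractHumpPrim (z / (f + 1 : ℕ))) ≤ c := by
    intro c hc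
    calc _ ≤ _ := mul_le_mul_of_nonneg_left (fractHumpPrim_sub_le ha hab hc) hz.le
      _ = c := key c
  refine le_min ?_ ?_
  · have h1 := hlow 0 fun t _ => fractHump_nonneg t
    have h2 := hupp (1 / 8) fun t _ => fractHump_le t
    have h3 := fractHump_nonneg (z / f)
    have h4 := fractHump_le (z / f)
    rw [abs_le]
    constructor <;> linarith
  · have hl : ∀ t ∈ Set.Icc (z / (f + 1 : ℕ)) (z / f),
        |fractHump (z / f) - fractHump t| ≤ (z / f - z / (f + 1 : ℕ)) / 2 := by
      intro t ht
      have := abs_fractHump_sub_le_of_le ht.2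
      rw [abs_sub_comm]
      linarith [ht.1]
    have h1 := hlow (fractHump (z / f) - (z / f - z / (f + 1 : ℕ)) / 2)
      fun t ht => by linarith [(abs_le.1 (hl t ht)).2]
    have h2 := hupp (fractHump (z / f) + (z / f - z / (f + 1 : ℕ)) / 2)
      fun t ht => by linarith [(abs_le.1 (hl t ht)).1]
    rw [abs_le]
    constructor <;> linarith

lemma sum_min_sub_le {z : ℝ} (hz : 1 ≤ z) (N : ℕ) (hN : ⌊√z⌋₊ ≤ N) :
    ∑ f ∈ Finset.Icc 1 N, min (1 / 8) ((z / f - z / (f + 1 : ℕ)) / 2) ≤ √z := by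
  have hz0 : 0 ≤ z := by linarith
  have hind : ∑ f ∈ Finset.Icc 1 N, min (1 / 8) ((z / f - z / (f + 1 : ℕ)) / 2) ≤
      ⌊√z⌋₊ / 8 + (z / (⌊√z⌋₊ + 1 : ℕ) - z / (N + 1 : ℕ)) / 2 := by
    induction N, hN using Nat.le_induction with
    | base =>
      calc _ ≤ ∑ f ∈ Finset.Icc 1 ⌊√z⌋₊, (1 / 8 : ℝ) :=
            Finset.sum_le_sum fun f _ => min_le_left _ _
        _ = _ := by simp; ring
    | succ n hn ih =>
      rw [Finset.sum_Icc_succ_top (by omega)]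
      have := min_le_right (1 / 8) ((z / (n + 1 : ℕ) - z / (n + 1 + 1 : ℕ)) / 2)
      linarith
  have h1 : (⌊√z⌋₊ : ℝ) ≤ √z := Nat.floor_le (sqrt_nonneg _)
  have h2 : z / (⌊√z⌋₊ + 1 : ℕ) ≤ √z := by
    rw [div_le_iff₀ (by positivity)]
    have h3 : √z ≤ (⌊√z⌋₊ + 1 : ℕ) := by push_cast; exact (Nat.lt_floor_add_one _).le
    calc z = √z * √z := (Real.mul_self_sqrt hz0).symm
      _ ≤ _ := by gcongr
  have h4 : 0 ≤ z / (N + 1 : ℕ) := by positivity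
  linarith [sqrt_nonneg z]

lemma abs_sum_fractHump_sub_le {z : ℝ} (hz : 1 ≤ z) (N : ℕ) (hN : ⌊√z⌋₊ ≤ N) :
    |∑ f ∈ Finset.Icc 1 N, fractHump (z / f) -
      z * (fractHumpPrim z - fractHumpPrim (z / (N + 1 : ℕ)))| ≤ √z := by
  have htel : ∀ N : ℕ, z * (fractHumpPrim z - fractHumpPrim (z / (N + 1 : ℕ))) =
      ∑ f ∈ Finset.Icc 1 N, z * (fractHumpPrim (z / f) - fractHumpPrim (z / (f + 1 : ℕ))) := by
    intro N
    induction N with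
    | zero => simp
    | succ n ih => rw [Finset.sum_Icc_succ_top (by omega), ← ih]; ring
  rw [htel, ← Finset.sum_sub_distrib]
  calc _ ≤ _ := Finset.abs_sum_le_sum_abs _ _
    _ ≤ _ := Finset.sum_le_sum fun f hf =>
      abs_fractHump_sub_prim_le (by linarith) (Finset.mem_Icc.1 hf).1
    _ ≤ _ := sum_min_sub_le hz N hN

open Filter Topology in
/-- Asymptotics of `∑ f, ∑ m ≤ z / f, (z / f - m)` with an error term `O(√z)`. -/
lemma abs_sub_le_of_eq_sum_Icc {z D : ℝ} (hz : 1 ≤ z)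
    (hD : ∀ N : ℕ, ⌊z⌋₊ ≤ N →
      D = ∑ f ∈ Finset.Icc 1 N, ∑ m ∈ Finset.Icc 1 ⌊z / f⌋₊, (z / f - m)) :
    |D - ((∑' n : ℕ, 1 / (n : ℝ) ^ 2) / 2 * z ^ 2 - z * log z / 2 +
      (1 - Real.eulerMascheroniConstant - log (2 * π)) / 2 * z)| ≤ 2 * √z := by
  have hz0 : 0 < z := by linarith
  have hsum2 : Tendsto (fun N : ℕ => ∑ f ∈ Finset.Icc 1 N, 1 / (f : ℝ) ^ 2) atTop
      (𝓝 (∑' n : ℕ, 1 / (n : ℝ) ^ 2)) := by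
    have h := (Real.summable_one_div_nat_pow.2 one_lt_two).hasSum.tendsto_sum_nat
    have h' := (tendsto_add_atTop_iff_nat 1).2 h
    refine h'.congr fun N => ?_
    rw [Finset.range_eq_Ico, ← Finset.sum_Ioo_add_eq_sum_Ico (by omega)]
    simp
    rfl
  have hlim : Tendsto (fun N : ℕ => z ^ 2 / 2 * ∑ f ∈ Finset.Icc 1 N, 1 / (f : ℝ) ^ 2 -
      z / 2 * (((harmonic N : ℚ) : ℝ) - log (N + 1)) - z * log z / 2 + z * (fractHumpPrim z)
      - z / 2 + z * (z / 2) * (1 / ((N : ℝ) + 1))) atTop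
      (𝓝 (z ^ 2 / 2 * (∑' n : ℕ, 1 / (n : ℝ) ^ 2) - z / 2 * Real.eulerMascheroniConstant -
        z * log z / 2 + z * (fractHumpPrim z) - z / 2 + z * (z / 2) * 0)) := by
    exact (((((hsum2.const_mul _).sub (Real.tendsto_harmonic_sub_log_add_one.const_mul _)).sub
      tendsto_const_nhds).add tendsto_const_nhds).sub tendsto_const_nhds).add
      (tendsto_one_div_add_atTop_nhds_zero_nat.const_mul _)
  have hb : |D - (z ^ 2 / 2 * (∑' n : ℕ, 1 / (n : ℝ) ^ 2) -
      z / 2 * Real.eulerMascheroniConstant -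
        z * log z / 2 + z * (fractHumpPrim z) - z / 2 + z * (z / 2) * 0)| ≤ √z := by
    refine le_of_tendsto ((tendsto_const_nhds.sub hlim).abs) ?_
    filter_upwards [eventually_ge_atTop ⌊z⌋₊, eventually_ge_atTop ⌊√z⌋₊] with N hN hN'
    refine le_of_eq_of_le ?_ (abs_sum_fractHump_sub_le hz N hN')
    congr 1
    have hN1 : z ≤ (N + 1 : ℕ) := by
      have := Nat.lt_floor_add_one z
      have h2 : (⌊z⌋₊ : ℝ) ≤ N := by exact_mod_cast hN
      push_cast
      linarith
    rw [fractHumpPrim_of_le_one (by positivity) ((div_le_one (by positivity)).2 hN1), hD N hN,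
      Real.log_div hz0.ne' (by positivity)]
    have h3 : ∑ f ∈ Finset.Icc 1 N, ∑ m ∈ Finset.Icc 1 ⌊z / f⌋₊, (z / f - m) =
        z ^ 2 / 2 * (∑ f ∈ Finset.Icc 1 N, 1 / (f : ℝ) ^ 2) -
          z / 2 * (∑ f ∈ Finset.Icc 1 N, 1 / (f : ℝ)) +
          ∑ f ∈ Finset.Icc 1 N, fractHump (z / f) := by
      rw [Finset.mul_sum, Finset.mul_sum, ← Finset.sum_sub_distrib, ← Finset.sum_add_distrib]
      refine Finset.sum_congr rfl fun f _ => ?_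
      rw [sum_Icc_floor_sub (by positivity)]
      ring
    have h4 : ((harmonic N : ℚ) : ℝ) = ∑ f ∈ Finset.Icc 1 N, 1 / (f : ℝ) := by
      rw [harmonic_eq_sum_Icc]
      push_cast
      simp
    rw [h3, h4]
    push_cast
    ring
  have hq := abs_fractHumpPrim_sub_lim_le hz0
  have hq' : |z * (fractHumpPrim z - (1 - log (2 * π) / 2))| ≤ 1 / 8 := by
    rw [abs_mul, abs_of_pos hz0]
    calc _ ≤ z * (1 / 8 / z) := by gcongr
      _ = _ := by field_simp
  have hs : 1 ≤ √z := by rw [Real.one_le_sqrt]; exact hz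
  rw [abs_le] at hb hq' ⊢
  constructor <;> linarith [hb.1, hb.2, hq'.1, hq'.2]

open ArithmeticFunction in
/-- The arithmetic function `n ↦ 1 / n`. -/
noncomputable def recipArith : ArithmeticFunction ℝ := ⟨fun n => 1 / (n : ℝ), by simp⟩

lemma recipArith_apply (n : ℕ) : recipArith n = 1 / (n : ℝ) := rfl

lemma isMultiplicative_recipArith : recipArith.IsMultiplicative := by
  refine ⟨by simp [recipArith_apply], fun {m n} _ => ?_⟩
  simp only [recipArith_apply, Nat.cast_mul]
  rw [one_div_mul_one_div]

lemma recipArith_mul_pmul_moebius :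
    recipArith * ((ArithmeticFunction.moebius : ArithmeticFunction ℝ).pmul recipArith) = 1 := by
  ext n
  have h : ((ArithmeticFunction.zeta : ArithmeticFunction ℝ) *
      (ArithmeticFunction.moebius : ArithmeticFunction ℝ)) n = (1 : ArithmeticFunction ℝ) n := by
    rw [ArithmeticFunction.coe_zeta_mul_coe_moebius]
  rw [ArithmeticFunction.mul_apply] at h ⊢
  have h2 : ∀ x ∈ n.divisorsAntidiagonal, recipArith x.1 *
      (((ArithmeticFunction.moebius : ArithmeticFunction ℝ).pmul recipArith)) x.2 =
      1 / (n : ℝ) * (((ArithmeticFunction.zeta : ArithmeticFunction ℝ) x.1 *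
        (ArithmeticFunction.moebius : ArithmeticFunction ℝ) x.2)) := by
    intro x hx
    obtain ⟨hx1, hx2⟩ := Nat.mem_divisorsAntidiagonal.1 hx
    have hx0 : x.1 ≠ 0 := by
      rintro h0
      rw [h0, zero_mul] at hx1
      exact hx2 hx1.symm
    rw [ArithmeticFunction.pmul_apply, recipArith_apply, recipArith_apply, ← hx1,
      ArithmeticFunction.natCoe_apply, ArithmeticFunction.zeta_apply_ne hx0, Nat.cast_mul,
      ← one_div_mul_one_div]
    push_cast
    ring
  rw [Finset.sum_congr rfl h2, ← Finset.mul_sum, h]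
  by_cases hn : n = 1
  · simp [hn]
  · simp [ArithmeticFunction.one_apply_ne hn]

/-- `∏_{p ∣ n, p > 2} (p - 1) / (p - 2)` as an arithmetic function. -/
noncomputable def oddLocalProd : ArithmeticFunction ℝ :=
  ArithmeticFunction.prodPrimeFactors fun p => if 2 < p then ((p : ℝ) - 1) / ((p : ℝ) - 2) else 1

lemma isMultiplicative_oddLocalProd : oddLocalProd.IsMultiplicative :=
  ArithmeticFunction.IsMultiplicative.prodPrimeFactors _

lemma oddLocalProd_prime_pow {p : ℕ} (hp : p.Prime) (k : ℕ) :
    oddLocalProd (p ^ (k + 1)) = if 2 < p then ((p : ℝ) - 1) / ((p : ℝ) - 2) else 1 := by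
  rw [oddLocalProd, ArithmeticFunction.prodPrimeFactors_apply (pow_ne_zero _ hp.ne_zero),
    Nat.primeFactors_prime_pow (by omega) hp, Finset.prod_singleton]

/-- The arithmetic function `γ` with `oddLocalProd = γ * (recipArith * ζ)`. -/
noncomputable def sievedArith : ArithmeticFunction ℝ :=
  oddLocalProd * (ArithmeticFunction.moebius : ArithmeticFunction ℝ) *
    ((ArithmeticFunction.moebius : ArithmeticFunction ℝ).pmul recipArith)

lemma oddLocalProd_eq_mul :
    oddLocalProd = sievedArith * (recipArith * (ArithmeticFunction.zeta : ArithmeticFunction ℝ)) := by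
  have : sievedArith * (recipArith * (ArithmeticFunction.zeta : ArithmeticFunction ℝ)) =
      oddLocalProd * ((ArithmeticFunction.zeta : ArithmeticFunction ℝ) *
        (ArithmeticFunction.moebius : ArithmeticFunction ℝ)) *
      (recipArith * ((ArithmeticFunction.moebius : ArithmeticFunction ℝ).pmul recipArith)) := by
    rw [sievedArith]
    ring
  rw [this, recipArith_mul_pmul_moebius, ArithmeticFunction.coe_zeta_mul_coe_moebius, mul_one,
    mul_one]

lemma isMultiplicative_sievedArith : sievedArith.IsMultiplicative := by
  have hmu : (ArithmeticFunction.moebius : ArithmeticFunction ℝ).IsMultiplicative :=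
    ArithmeticFunction.isMultiplicative_moebius.intCast
  exact (isMultiplicative_oddLocalProd.mul hmu).mul (hmu.pmul isMultiplicative_recipArith)

lemma ArithmeticFunction.mul_prime_pow_succ_of_eq_zero {u v : ArithmeticFunction ℝ} {p : ℕ}
    (hp : p.Prime) (hv : ∀ j, v (p ^ (j + 2)) = 0) (k : ℕ) :
    (u * v) (p ^ (k + 1)) = u (p ^ (k + 1)) * v 1 + u (p ^ k) * v p := by
  rw [ArithmeticFunction.mul_apply,
    Nat.sum_divisorsAntidiagonal (fun a b => u a * v b), Nat.sum_divisors_prime_pow hp,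
    Finset.sum_range_succ, Finset.sum_range_succ, Finset.sum_eq_zero]
  · rw [Nat.div_self (pow_pos hp.pos _), pow_succ, Nat.mul_div_cancel_left _ (pow_pos hp.pos _)]
    ring
  · intro i hi
    have hi' := Finset.mem_range.1 hi
    obtain ⟨j, hj⟩ := Nat.exists_eq_add_of_lt hi'
    have : k + 1 = i + (j + 2) := by omega
    rw [this, pow_add, Nat.mul_div_cancel_left _ (pow_pos hp.pos _), hv, mul_zero]

lemma moebius_prime_pow_add_two {p : ℕ} (hp : p.Prime) (j : ℕ) :
    (ArithmeticFunction.moebius : ArithmeticFunction ℝ) (p ^ (j + 2)) = 0 := by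
  rw [ArithmeticFunction.intCoe_apply, ArithmeticFunction.moebius_apply_prime_pow hp (by omega)]
  simp

lemma oddLocalProd_mul_moebius_prime_pow_succ {p : ℕ} (hp : p.Prime) (k : ℕ) :
    (oddLocalProd * (ArithmeticFunction.moebius : ArithmeticFunction ℝ)) (p ^ (k + 1)) =
      oddLocalProd (p ^ (k + 1)) - oddLocalProd (p ^ k) := by
  rw [ArithmeticFunction.mul_prime_pow_succ_of_eq_zero hp (moebius_prime_pow_add_two hp)]
  simp [ArithmeticFunction.moebius_apply_prime hp, sub_eq_add_neg]

lemma sievedArith_prime_pow_succ {p : ℕ} (hp : p.Prime) (k : ℕ) :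
    sievedArith (p ^ (k + 1)) =
      (oddLocalProd * (ArithmeticFunction.moebius : ArithmeticFunction ℝ)) (p ^ (k + 1)) -
      (oddLocalProd * (ArithmeticFunction.moebius : ArithmeticFunction ℝ)) (p ^ k) / p := by
  rw [sievedArith, ArithmeticFunction.mul_prime_pow_succ_of_eq_zero hp]
  · simp only [ArithmeticFunction.pmul_apply, recipArith_apply, ArithmeticFunction.intCoe_apply,
      ArithmeticFunction.moebius_apply_prime hp]
    simp
    ring
  · intro j
    rw [ArithmeticFunction.pmul_apply, moebius_prime_pow_add_two hp, zero_mul]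

lemma oddLocalProd_one : oddLocalProd 1 = 1 := isMultiplicative_oddLocalProd.map_one

lemma sievedArith_prime {p : ℕ} (hp : p.Prime) (h2 : 2 < p) :
    sievedArith p = 2 / (p * ((p : ℝ) - 2)) := by
  have h := sievedArith_prime_pow_succ hp 0
  have h3 : (2 : ℝ) < p := by exact_mod_cast h2
  rw [oddLocalProd_mul_moebius_prime_pow_succ hp, oddLocalProd_prime_pow hp, if_pos h2] at h
  simp only [zero_add, pow_one, pow_zero, oddLocalProd_one, ArithmeticFunction.mul_apply_one,
    ArithmeticFunction.intCoe_apply, ArithmeticFunction.moebius_apply_one] at h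
  rw [h]
  have : (p : ℝ) - 2 ≠ 0 := by linarith
  field_simp
  push_cast
  ring

lemma sievedArith_prime_sq {p : ℕ} (hp : p.Prime) (h2 : 2 < p) :
    sievedArith (p ^ 2) = -1 / (p * ((p : ℝ) - 2)) := by
  have h := sievedArith_prime_pow_succ hp 1
  have h3 : (2 : ℝ) < p := by exact_mod_cast h2
  rw [oddLocalProd_mul_moebius_prime_pow_succ hp, oddLocalProd_prime_pow hp,
    oddLocalProd_prime_pow hp 0, oddLocalProd_mul_moebius_prime_pow_succ hp 0,
    oddLocalProd_prime_pow hp, if_pos h2, pow_zero, oddLocalProd_one] at h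
  rw [h]
  have : (p : ℝ) - 2 ≠ 0 := by linarith
  field_simp
  ring

lemma sievedArith_prime_pow_add_three {p : ℕ} (hp : p.Prime) (k : ℕ) :
    sievedArith (p ^ (k + 3)) = 0 := by
  rw [sievedArith_prime_pow_succ hp (k + 2), oddLocalProd_mul_moebius_prime_pow_succ hp,
    oddLocalProd_prime_pow hp, oddLocalProd_prime_pow hp (k + 1),
    oddLocalProd_mul_moebius_prime_pow_succ hp (k + 1), oddLocalProd_prime_pow hp,
    oddLocalProd_prime_pow hp]
  simp

lemma sievedArith_two : sievedArith 2 = -1 / 2 := by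
  have h := sievedArith_prime_pow_succ Nat.prime_two 0
  rw [oddLocalProd_mul_moebius_prime_pow_succ Nat.prime_two,
    oddLocalProd_prime_pow Nat.prime_two] at h
  simp only [zero_add, pow_one, pow_zero, oddLocalProd_one, ArithmeticFunction.mul_apply_one,
    ArithmeticFunction.intCoe_apply, ArithmeticFunction.moebius_apply_one] at h
  rw [h]
  norm_num

lemma sievedArith_four : sievedArith (2 ^ 2) = 0 := by
  rw [sievedArith_prime_pow_succ Nat.prime_two 1,
    oddLocalProd_mul_moebius_prime_pow_succ Nat.prime_two,
    oddLocalProd_prime_pow Nat.prime_two,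
    oddLocalProd_prime_pow Nat.prime_two 0, oddLocalProd_mul_moebius_prime_pow_succ Nat.prime_two 0,
    oddLocalProd_prime_pow Nat.prime_two]
  simp [oddLocalProd_one]

lemma Nat.Coprime.sum_divisors_mul_eq {m n : ℕ} (hmn : m.Coprime n) (F : ℕ → ℝ) :
    ∑ d ∈ (m * n).divisors, F d = ∑ a ∈ m.divisors, ∑ b ∈ n.divisors, F (a * b) := by
  rw [← Finset.sum_product', Nat.divisors_mul, Finset.mul_def, Finset.sum_image]
  intro x hx y hy hxy
  exact hmn.mul_injOn_divisors hx hy hxy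

lemma primorial_succ_of_prime {n : ℕ} (hp : (n + 1).Prime) :
    primorial (n + 1) = primorial n * (n + 1) := by
  rw [primorial, Finset.range_add_one, Finset.filter_insert, if_pos hp, Finset.prod_insert (by simp),
    mul_comm]
  rfl

lemma primorial_succ_of_not_prime {n : ℕ} (hp : ¬ (n + 1).Prime) :
    primorial (n + 1) = primorial n := by
  rw [primorial, Finset.range_add_one, Finset.filter_insert, if_neg hp]
  rfl

lemma coprime_primorial_sq_succ_sq {n : ℕ} (hp : (n + 1).Prime) :
    Nat.Coprime (primorial n ^ 2) ((n + 1) ^ 2) := by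
  refine Nat.Coprime.pow _ _ (Nat.Coprime.symm ((Nat.Prime.coprime_iff_not_dvd hp).2 fun h => ?_))
  have := hp.dvd_primorial_iff.1 h
  omega

lemma sum_divisors_prime_sq {p : ℕ} (hp : p.Prime) (F : ℕ → ℝ) :
    ∑ d ∈ (p ^ 2).divisors, F d = F 1 + F p + F (p ^ 2) := by
  rw [Nat.sum_divisors_prime_pow hp]
  simp [Finset.sum_range_succ]

/-- Sums of a multiplicative function over the divisors of `∏_{p ≤ N} p ^ 2`. -/
lemma sum_divisors_primorial_sq {h : ArithmeticFunction ℝ} (hh : h.IsMultiplicative) (N : ℕ) :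
    ∑ d ∈ (primorial N ^ 2).divisors, h d =
      ∏ p ∈ (Finset.range (N + 1)).filter Nat.Prime, (1 + h p + h (p ^ 2)) := by
  induction N with
  | zero => simp [hh.map_one, Finset.filter_singleton, Nat.not_prime_zero]
  | succ n ih =>
    rw [Finset.range_add_one, Finset.filter_insert]
    split_ifs with hp
    · rw [Finset.prod_insert (by simp), ← ih, primorial_succ_of_prime hp, mul_pow,
        (coprime_primorial_sq_succ_sq hp).sum_divisors_mul_eq, mul_comm, Finset.sum_mul]
      refine Finset.sum_congr rfl fun a ha => ?_
      rw [← hh.map_one, ← sum_divisors_prime_sq hp, Finset.mul_sum]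
      refine Finset.sum_congr rfl fun b hb => ?_
      exact hh.map_mul_of_coprime (((coprime_primorial_sq_succ_sq hp).coprime_dvd_left
        (Nat.dvd_of_mem_divisors ha)).coprime_dvd_right (Nat.dvd_of_mem_divisors hb))
    · rw [← ih, primorial_succ_of_not_prime hp]

/-- `∑ γ(d) log d = -log 2 ∑ γ(d)` over the divisors of `∏_{p ≤ N} p ^ 2`. -/
lemma sum_divisors_primorial_sq_log (N : ℕ) (hN : 2 ≤ N) :
    ∑ d ∈ (primorial N ^ 2).divisors, sievedArith d * log d =
      -log 2 * ∑ d ∈ (primorial N ^ 2).divisors, sievedArith d := by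
  have hh := isMultiplicative_sievedArith
  induction N, hN using Nat.le_induction with
  | base =>
    rw [primorial_two, sum_divisors_prime_sq Nat.prime_two (fun d => sievedArith d * log d),
      sum_divisors_prime_sq Nat.prime_two (fun d => sievedArith d), sievedArith_two,
      sievedArith_four, hh.map_one]
    simp
    ring
  | succ n hn ih =>
    by_cases hp : (n + 1).Prime
    · have hp2 : 2 < n + 1 := by omega
      rw [primorial_succ_of_prime hp, mul_pow,
        (coprime_primorial_sq_succ_sq hp).sum_divisors_mul_eq,
        (coprime_primorial_sq_succ_sq hp).sum_divisors_mul_eq]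
      have h1 : ∀ a ∈ (primorial n ^ 2).divisors, ∀ b ∈ ((n + 1) ^ 2).divisors,
          sievedArith (a * b) = sievedArith a * sievedArith b := fun a ha b hb =>
        hh.map_mul_of_coprime (((coprime_primorial_sq_succ_sq hp).coprime_dvd_left
          (Nat.dvd_of_mem_divisors ha)).coprime_dvd_right (Nat.dvd_of_mem_divisors hb))
      have h2 : ∀ a ∈ (primorial n ^ 2).divisors,
          ∑ b ∈ ((n + 1) ^ 2).divisors, sievedArith (a * b) * log ((a * b : ℕ) : ℝ) =
          sievedArith a * log a * ∑ b ∈ ((n + 1) ^ 2).divisors, sievedArith b := by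
        intro a ha
        have h3 : ∑ b ∈ ((n + 1) ^ 2).divisors, sievedArith b * log b = 0 := by
          rw [sum_divisors_prime_sq hp (fun d => sievedArith d * log d), sievedArith_prime hp hp2,
            sievedArith_prime_sq hp hp2, Nat.cast_pow, Real.log_pow]
          simp
          ring
        calc _ = ∑ b ∈ ((n + 1) ^ 2).divisors, (sievedArith a * log a * sievedArith b +
              sievedArith a * (sievedArith b * log b)) := by
              refine Finset.sum_congr rfl fun b hb => ?_
              have ha0 : (a : ℝ) ≠ 0 := by exact_mod_cast (Nat.pos_of_mem_divisors ha).ne'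
              have hb0 : (b : ℝ) ≠ 0 := by exact_mod_cast (Nat.pos_of_mem_divisors hb).ne'
              rw [h1 a ha b hb, Nat.cast_mul, Real.log_mul ha0 hb0]
              ring
          _ = _ := by rw [Finset.sum_add_distrib, ← Finset.mul_sum, ← Finset.mul_sum, h3]; ring
      rw [Finset.sum_congr rfl h2, ← Finset.sum_mul, ih, mul_assoc, Finset.sum_mul]
      congr 1
      refine Finset.sum_congr rfl fun a ha => ?_
      rw [Finset.mul_sum]
      exact Finset.sum_congr rfl fun b hb => (h1 a ha b hb).symm
    · rw [primorial_succ_of_not_prime hp, ih]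

lemma dvd_primorial_sq_of_sievedArith_ne_zero {e N : ℕ} (he : sievedArith e ≠ 0) (heN : e ≤ N) :
    e ∣ primorial N ^ 2 := by
  have he0 : e ≠ 0 := by
    rintro rfl
    simp at he
  rw [isMultiplicative_sievedArith.multiplicative_factorization _ he0, Finsupp.prod,
    Finset.prod_ne_zero_iff] at he
  rw [← Nat.factorization_prime_le_iff_dvd he0 (pow_ne_zero _ (primorial_ne_zero N))]
  intro p hp
  rw [Nat.factorization_pow, Finsupp.smul_apply, smul_eq_mul]
  by_cases hpe : p ∣ e
  · have h1 : e.factorization p ≤ 2 := by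
      by_contra! hlt
      obtain ⟨k, hk⟩ := Nat.exists_eq_add_of_lt hlt
      have := he p (by simp [hp, hpe, he0])
      rw [hk, show 2 + k + 1 = k + 3 by ring] at this
      exact this (sievedArith_prime_pow_add_three hp k)
    have h2 : 1 ≤ (primorial N).factorization p :=
      (hp.dvd_iff_one_le_factorization (primorial_ne_zero N)).1
        (hp.dvd_primorial_iff.2 ((Nat.le_of_dvd (Nat.pos_of_ne_zero he0) hpe).trans heN))
    omega
  · rw [Nat.factorization_eq_zero_of_not_dvd hpe]
    omega

open Filter Topology in
lemma tendsto_sum_divisors_primorial_sq {F : ℕ → ℝ} (hF : ∀ e, sievedArith e = 0 → F e = 0)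
    (hs : Summable F) :
    Tendsto (fun N => ∑ d ∈ (primorial N ^ 2).divisors, F d) atTop (𝓝 (∑' e, F e)) := by
  have ht : Tendsto (fun N => (primorial N ^ 2).divisors ∪ Finset.range N) atTop atTop := by
    refine tendsto_atTop_finset_of_monotone (fun a b hab => ?_) fun x => ⟨x + 1, by simp⟩
    refine Finset.union_subset_union ?_ (Finset.range_mono hab)
    exact Nat.divisors_subset_of_dvd (pow_ne_zero _ (primorial_ne_zero _))
      (pow_dvd_pow_of_dvd (primorial_dvd_primorial hab) 2)
  refine (hs.hasSum.comp ht).congr fun N => ?_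
  refine (Finset.sum_subset Finset.subset_union_left fun x hx hx' => hF x ?_).symm
  by_contra h
  have hxN : x ≤ N := by
    rcases Finset.mem_union.1 hx with h1 | h1
    · exact absurd h1 hx'
    · exact (Finset.mem_range.1 h1).le
  exact hx' (Nat.mem_divisors.2 ⟨dvd_primorial_sq_of_sievedArith_ne_zero h hxN,
    pow_ne_zero _ (primorial_ne_zero _)⟩)

lemma prime_eq_two_or_three_le {p : ℕ} (hp : p.Prime) : p = 2 ∨ 3 ≤ p := by
  have := hp.two_le
  omega

lemma abs_sievedArith_local_le {p : ℕ} (hp : p.Prime) {τ : ℝ} (hτ : 0 ≤ τ) :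
    |sievedArith p| * (p : ℝ) ^ τ + |sievedArith (p ^ 2)| * ((p ^ 2 : ℕ) : ℝ) ^ τ ≤
      9 * (p : ℝ) ^ (2 * τ - 2) := by
  have hp0 : (0 : ℝ) < p := by exact_mod_cast hp.pos
  have hp1 : (1 : ℝ) ≤ p := by exact_mod_cast hp.one_le
  have e1 : ((p ^ 2 : ℕ) : ℝ) ^ τ = (p : ℝ) ^ (2 * τ) := by
    rw [Nat.cast_pow, ← Real.rpow_natCast, ← Real.rpow_mul hp0.le]
    norm_num
  have e2 : (p : ℝ) ^ (2 * τ - 2) = (p : ℝ) ^ (2 * τ) / (p : ℝ) ^ 2 := by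
    rw [Real.rpow_sub hp0]
    norm_num
  have e3 : (p : ℝ) ^ τ ≤ (p : ℝ) ^ (2 * τ) := Real.rpow_le_rpow_of_exponent_le hp1 (by linarith)
  have e4 : 0 < (p : ℝ) ^ (2 * τ) := by positivity
  rw [e1, e2]
  rcases prime_eq_two_or_three_le hp with rfl | h3
  · rw [sievedArith_two, sievedArith_four, abs_zero, abs_of_neg (by norm_num)]
    push_cast at *
    linarith
  · have h3' : (3 : ℝ) ≤ p := by exact_mod_cast h3
    have hpos : 0 < (p : ℝ) * (p - 2) := mul_pos hp0 (by linarith)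
    rw [sievedArith_prime hp (by omega), sievedArith_prime_sq hp (by omega), abs_div, abs_div,
      abs_of_pos hpos, abs_neg, abs_one, abs_of_pos two_pos]
    calc _ ≤ 2 / ((p : ℝ) * (p - 2)) * (p : ℝ) ^ (2 * τ) +
          1 / ((p : ℝ) * (p - 2)) * (p : ℝ) ^ (2 * τ) := by gcongr
      _ = 3 / ((p : ℝ) * (p - 2)) * (p : ℝ) ^ (2 * τ) := by ring
      _ ≤ 9 / (p : ℝ) ^ 2 * (p : ℝ) ^ (2 * τ) := by
          gcongr ?_ * _
          rw [div_le_div_iff₀ hpos (by positivity)]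
          nlinarith
      _ = _ := by ring

lemma summable_abs_sievedArith_mul_rpow {τ : ℝ} (hτ : 0 ≤ τ) (hτ2 : τ < 1 / 2) :
    Summable fun e : ℕ => |sievedArith e| * (e : ℝ) ^ τ := by
  set h : ArithmeticFunction ℝ := ⟨fun e => |sievedArith e| * (e : ℝ) ^ τ, by simp⟩ with hdef
  have happ : ∀ e, h e = |sievedArith e| * (e : ℝ) ^ τ := fun e => rfl
  have hnn : ∀ e, 0 ≤ h e := fun e => by rw [happ]; positivity
  have hh : h.IsMultiplicative := by
    refine ⟨by simp [happ, isMultiplicative_sievedArith.map_one], fun {m n} hmn => ?_⟩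
    simp only [happ]
    rw [isMultiplicative_sievedArith.map_mul_of_coprime hmn, abs_mul, Nat.cast_mul,
      Real.mul_rpow (by positivity) (by positivity)]
    ring
  have hsum : Summable fun p : ℕ => 9 * (p : ℝ) ^ (2 * τ - 2) :=
    (Real.summable_nat_rpow.2 (by linarith)).mul_left 9
  refine summable_of_sum_range_le (f := fun e => h e)
    (c := Real.exp (∑' p : ℕ, 9 * (p : ℝ) ^ (2 * τ - 2))) hnn fun n => ?_
  calc ∑ e ∈ Finset.range n, h e ≤ ∑ e ∈ (primorial n ^ 2).divisors, h e := by
        rw [← Finset.sum_filter_ne_zero]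
        refine Finset.sum_le_sum_of_subset_of_nonneg (fun e he => ?_) fun _ _ _ => hnn _
        obtain ⟨he, hne⟩ := Finset.mem_filter.1 he
        refine Nat.mem_divisors.2 ⟨dvd_primorial_sq_of_sievedArith_ne_zero ?_
          (Finset.mem_range.1 he).le, pow_ne_zero _ (primorial_ne_zero _)⟩
        intro h0
        exact hne (by rw [happ, h0]; simp)
    _ = ∏ p ∈ (Finset.range (n + 1)).filter Nat.Prime, (1 + h p + h (p ^ 2)) :=
        sum_divisors_primorial_sq hh n
    _ ≤ ∏ p ∈ (Finset.range (n + 1)).filter Nat.Prime, Real.exp (9 * (p : ℝ) ^ (2 * τ - 2)) := by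
        refine Finset.prod_le_prod (fun p _ => ?_) fun p hp => ?_
        · linarith [hnn p, hnn (p ^ 2)]
        · have h1 := abs_sievedArith_local_le (Finset.mem_filter.1 hp).2 hτ
          rw [← happ, ← happ] at h1
          linarith [Real.add_one_le_exp (9 * (p : ℝ) ^ (2 * τ - 2))]
    _ = Real.exp (∑ p ∈ (Finset.range (n + 1)).filter Nat.Prime, 9 * (p : ℝ) ^ (2 * τ - 2)) :=
        (Real.exp_sum _ _).symm
    _ ≤ _ := by
        gcongr
        exact hsum.sum_le_tsum _ fun p _ => by positivity

lemma summable_sievedArith_of_abs_le {F : ℕ → ℝ} {τ c : ℝ} (hτ : 0 ≤ τ) (hτ2 : τ < 1 / 2)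
    (hF : ∀ e, |F e| ≤ c * (|sievedArith e| * (e : ℝ) ^ τ)) : Summable F :=
  Summable.of_norm_bounded ((summable_abs_sievedArith_mul_rpow hτ hτ2).mul_left c) hF

lemma summable_sievedArith : Summable fun e : ℕ => sievedArith e :=
  summable_sievedArith_of_abs_le (c := 1) le_rfl (by norm_num) fun e => by simp

lemma summable_sievedArith_div : Summable fun e : ℕ => sievedArith e / e := by
  refine summable_sievedArith_of_abs_le (c := 1) le_rfl (by norm_num) fun e => ?_
  rw [Real.rpow_zero, one_mul, mul_one, abs_div, Nat.abs_cast]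
  rcases Nat.eq_zero_or_pos e with rfl | he
  · simp
  · exact div_le_self (abs_nonneg _) (by exact_mod_cast he)

lemma summable_sievedArith_mul_log : Summable fun e : ℕ => sievedArith e * log e := by
  refine summable_sievedArith_of_abs_le (c := 4) (τ := 1 / 4) (by norm_num) (by norm_num)
    fun e => ?_
  have h1 := Real.log_natCast_le_rpow_div e (show (0 : ℝ) < 1 / 4 by norm_num)
  rw [abs_mul, abs_of_nonneg (Real.log_natCast_nonneg e)]
  calc _ ≤ |sievedArith e| * ((e : ℝ) ^ (1 / 4 : ℝ) / (1 / 4)) := by gcongr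
    _ = _ := by ring

lemma tsum_sievedArith_mul_log :
    ∑' e : ℕ, sievedArith e * log e = -log 2 * ∑' e : ℕ, sievedArith e := by
  have h1 := tendsto_sum_divisors_primorial_sq (F := fun e => sievedArith e * log e)
    (fun e he => by simp [he]) summable_sievedArith_mul_log
  have h2 := (tendsto_sum_divisors_primorial_sq (F := fun e => sievedArith e)
    (fun e he => he) summable_sievedArith).const_mul (-log 2)
  refine tendsto_nhds_unique h1 (h2.congr' ?_)
  filter_upwards [Filter.eventually_ge_atTop 2] with N hN
  exact (sum_divisors_primorial_sq_log N hN).symm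

/-- The Euler factor of the twin prime constant at `p`. -/
noncomputable def twinFactor (p : ℕ) : ℝ := if 2 < p then 1 - 1 / ((p : ℝ) - 1) ^ 2 else 1

lemma sievedArith_local_mul_twinFactor {p : ℕ} (hp : p.Prime) :
    (1 + sievedArith p + sievedArith (p ^ 2)) * twinFactor p = if p = 2 then 1 / 2 else 1 := by
  rcases prime_eq_two_or_three_le hp with rfl | h3
  · rw [sievedArith_two, sievedArith_four]
    norm_num [twinFactor]
  · have h3' : (3 : ℝ) ≤ p := by exact_mod_cast h3
    rw [sievedArith_prime hp (by omega), sievedArith_prime_sq hp (by omega), twinFactor,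
      if_pos (by omega), if_neg (by omega)]
    have h1 : (p : ℝ) - 2 ≠ 0 := by linarith
    have h2 : (p : ℝ) - 1 ≠ 0 := by linarith
    have h0 : (p : ℝ) ≠ 0 := by linarith
    field_simp
    ring

lemma sievedArith_div_local_mul_twinFactor {p : ℕ} (hp : p.Prime) :
    (1 + sievedArith p / p + sievedArith (p ^ 2) / (p ^ 2 : ℕ)) * twinFactor p =
      1 - 1 / (p : ℝ) ^ 2 := by
  rcases prime_eq_two_or_three_le hp with rfl | h3
  · rw [sievedArith_two, sievedArith_four]
    norm_num [twinFactor]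
  · have h3' : (3 : ℝ) ≤ p := by exact_mod_cast h3
    rw [sievedArith_prime hp (by omega), sievedArith_prime_sq hp (by omega), twinFactor,
      if_pos (by omega)]
    have h1 : (p : ℝ) - 2 ≠ 0 := by linarith
    have h2 : (p : ℝ) - 1 ≠ 0 := by linarith
    have h0 : (p : ℝ) ≠ 0 := by linarith
    push_cast
    field_simp
    ring

lemma multipliable_twinFactor : Multipliable fun p : Nat.Primes => twinFactor p := by
  have hs : Summable fun n : ℕ => ‖twinFactor n - 1‖ := by
    have hsum : Summable fun p : ℕ => 4 * (1 / (p : ℝ) ^ 2) :=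
      (Real.summable_one_div_nat_pow.2 one_lt_two).mul_left 4
    refine Summable.of_nonneg_of_le (fun n => norm_nonneg _) (fun n => ?_) hsum
    rw [twinFactor]
    split_ifs with h
    · have h3 : (3 : ℝ) ≤ n := by exact_mod_cast h
      rw [Real.norm_eq_abs, show (1 : ℝ) - 1 / ((n : ℝ) - 1) ^ 2 - 1 = -(1 / ((n : ℝ) - 1) ^ 2) by
        ring, abs_neg, abs_of_nonneg (by positivity), mul_one_div]
      rw [div_le_div_iff₀ (pow_pos (by linarith) 2) (by positivity)]
      nlinarith
    · simp
  have := multipliable_one_add_of_summable (f := fun p : Nat.Primes => twinFactor p - 1)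
    (hs.comp_injective Subtype.val_injective)
  simpa using this

open Filter Topology in
lemma tendsto_prod_twinFactor :
    Tendsto (fun N : ℕ => ∏ p ∈ (Finset.range (N + 1)).filter Nat.Prime, twinFactor p) atTop
      (𝓝 (∏' p : Nat.Primes, twinFactor p)) := by
  have h1 : HasProd (twinFactor ∘ Subtype.val (p := (· ∈ {x | Nat.Prime x})))
      (∏' p : Nat.Primes, twinFactor p) := multipliable_twinFactor.hasProd
  rw [hasProd_subtype_iff_mulIndicator] at h1
  have h2 := (tendsto_add_atTop_iff_nat 1).2 h1.tendsto_prod_nat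
  refine h2.congr fun N => ?_
  exact Finset.prod_mulIndicator_eq_prod_filter
    (Finset.range (N + 1)) (fun _ => twinFactor) (fun _ => {p | Nat.Prime p}) id

lemma twinConst_mul_tsum_sievedArith :
    (∏' p : Nat.Primes, twinFactor p) * ∑' e : ℕ, sievedArith e = 1 / 2 := by
  have h1 := tendsto_prod_twinFactor.mul (tendsto_sum_divisors_primorial_sq
    (F := fun e => sievedArith e) (fun e he => he) summable_sievedArith)
  refine tendsto_nhds_unique h1 (tendsto_const_nhds.congr' ?_)
  filter_upwards [Filter.eventually_ge_atTop 2] with N hN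
  rw [sum_divisors_primorial_sq isMultiplicative_sievedArith, mul_comm, ← Finset.prod_mul_distrib,
    Finset.prod_congr rfl fun p hp =>
      sievedArith_local_mul_twinFactor (Finset.mem_filter.1 hp).2, Finset.prod_ite_eq',
    if_pos (by simp [Nat.prime_two]; omega)]

open Filter Topology in
lemma twinConst_mul_tsum_sievedArith_div :
    (∏' p : Nat.Primes, twinFactor p) * (∑' e : ℕ, sievedArith e / e) *
      ∑' n : ℕ, 1 / (n : ℝ) ^ 2 = 1 := by
  set h : ArithmeticFunction ℝ := sievedArith.pmul recipArith with hdef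
  have happ : ∀ e, h e = sievedArith e / e := fun e => by
    rw [hdef, ArithmeticFunction.pmul_apply, recipArith_apply, mul_one_div]
  have hh : h.IsMultiplicative := isMultiplicative_sievedArith.pmul isMultiplicative_recipArith
  let f : ℕ →*₀ ℝ :=
    { toFun := fun n => 1 / (n : ℝ) ^ 2
      map_zero' := by simp
      map_one' := by simp
      map_mul' := fun a b => by push_cast; rw [mul_pow, one_div_mul_one_div] }
  have hf : Summable fun n => ‖f n‖ :=
    (Real.summable_one_div_nat_pow.2 one_lt_two).norm
  have hz := (tendsto_add_atTop_iff_nat 1).2 (EulerProduct.eulerProduct_completely_multiplicative hf)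
  have h1 := (tendsto_prod_twinFactor.mul (tendsto_sum_divisors_primorial_sq
    (F := fun e => sievedArith e / e) (fun e he => by simp [he]) summable_sievedArith_div)).mul hz
  refine tendsto_nhds_unique h1 (tendsto_const_nhds.congr fun N => ?_)
  simp only [← happ]
  rw [sum_divisors_primorial_sq hh, mul_comm (∏ p ∈ _, twinFactor p), ← Finset.prod_mul_distrib,
    Nat.primesBelow, ← Finset.prod_mul_distrib]
  refine (Finset.prod_eq_one fun p hp => ?_).symm
  have hp' := (Finset.mem_filter.1 hp).2
  rw [happ, happ, sievedArith_div_local_mul_twinFactor hp']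
  have h2 : (2 : ℝ) ≤ p := by exact_mod_cast hp'.two_le
  refine mul_inv_cancel₀ (ne_of_gt ?_)
  rw [sub_pos, div_lt_one (by positivity)]
  nlinarith

/-- The weighted summatory function `∑_{k ≤ z} v(k) (z - k)`. -/
noncomputable def rieszSum (v : ArithmeticFunction ℝ) (z : ℝ) : ℝ :=
  ∑ k ∈ Finset.Icc 1 ⌊z⌋₊, v k * (z - k)

lemma rieszSum_eq_sum_max (v : ArithmeticFunction ℝ) {z : ℝ} {N : ℕ} (hN : ⌊z⌋₊ ≤ N) :
    rieszSum v z = ∑ k ∈ Finset.Icc 1 N, v k * max (z - k) 0 := by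
  rw [rieszSum]
  refine Finset.sum_subset_zero_on_sdiff (Finset.Icc_subset_Icc le_rfl hN) (fun k hk => ?_)
    fun k hk => ?_
  · simp only [Finset.mem_sdiff, Finset.mem_Icc, not_and, not_le] at hk
    have : z < k := (Nat.floor_lt' (by omega)).1 (hk.2 hk.1.1)
    rw [max_eq_right (by linarith), mul_zero]
  · have h1 := Finset.mem_Icc.1 hk
    have : (k : ℝ) ≤ z := (Nat.le_floor_iff' (by omega)).1 h1.2
    rw [max_eq_left (by linarith)]

lemma rieszSum_eq_zero (v : ArithmeticFunction ℝ) {z : ℝ} (hz : z < 1) : rieszSum v z = 0 := by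
  rw [rieszSum, Nat.floor_eq_zero.2 hz]
  simp

lemma floor_div_natCast_le (z : ℝ) (e : ℕ) : ⌊z / e⌋₊ ≤ ⌊z⌋₊ := by
  rw [Nat.floor_div_natCast]
  exact Nat.div_le_self _ _

lemma rieszSum_mul (u v : ArithmeticFunction ℝ) {z : ℝ} {N : ℕ} (hN : ⌊z⌋₊ ≤ N) :
    rieszSum (u * v) z = ∑ e ∈ Finset.Icc 1 N, u e * e * rieszSum v (z / e) := by
  have hI : Finset.Icc 1 N = Finset.Ioc 0 N := by
    ext
    simp
    omega
  have key : ∀ n ∈ Finset.Ioc 0 N, (u * v) n * max (z - n) 0 =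
      ∑ x ∈ Finset.Ioc 0 N ×ˢ Finset.Ioc 0 N,
        if x.1 * x.2 = n then u x.1 * v x.2 * max (z - (x.1 * x.2 : ℕ)) 0 else 0 := by
    intro n hn
    have hn' := Finset.mem_Ioc.1 hn
    rw [ArithmeticFunction.mul_apply, Nat.divisorsAntidiagonal_eq_prod_filter_of_le hn'.1.ne' hn'.2,
      Finset.sum_mul, Finset.sum_filter]
    refine Finset.sum_congr rfl fun x _ => ?_
    split_ifs with h
    · rw [h]
    · rfl
  rw [rieszSum_eq_sum_max _ hN, hI, Finset.sum_congr rfl key, Finset.sum_comm,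
    Finset.sum_product]
  refine Finset.sum_congr rfl fun e he => ?_
  have he' := Finset.mem_Ioc.1 he
  have he0 : (0 : ℝ) < e := by exact_mod_cast he'.1
  rw [rieszSum_eq_sum_max v ((floor_div_natCast_le z e).trans hN), hI, Finset.mul_sum]
  refine Finset.sum_congr rfl fun k hk => ?_
  have hk' := Finset.mem_Ioc.1 hk
  have hmax : max (z - (e * k : ℕ)) 0 = e * max (z / e - k) 0 := by
    rw [mul_max_of_nonneg _ _ he0.le, mul_zero, mul_sub, mul_div_cancel₀ _ he0.ne', Nat.cast_mul]
  rw [Finset.sum_ite_eq]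
  split_ifs with h
  · rw [hmax]
    ring
  · have h1 : N < e * k := by
      rw [Finset.mem_Ioc, not_and, not_le] at h
      exact h (Nat.mul_pos he'.1 hk'.1)
    have h2 : z < (e * k : ℕ) := (Nat.floor_lt' (by omega)).1 (hN.trans_lt h1)
    rw [max_eq_right (by linarith)] at hmax
    have h3 : max (z / e - k) 0 = 0 := by
      rcases mul_eq_zero.1 hmax.symm with h | h
      · exact absurd h he0.ne'
      · exact h
    rw [h3]
    ring

lemma rieszSum_recipArith_mul_zeta {z : ℝ} {N : ℕ} (hN : ⌊z⌋₊ ≤ N) :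
    rieszSum (recipArith * (ArithmeticFunction.zeta : ArithmeticFunction ℝ)) z =
      ∑ f ∈ Finset.Icc 1 N, ∑ m ∈ Finset.Icc 1 ⌊z / f⌋₊, (z / f - m) := by
  rw [rieszSum_mul _ _ hN]
  refine Finset.sum_congr rfl fun f hf => ?_
  have hf0 : (f : ℝ) ≠ 0 := by
    have := (Finset.mem_Icc.1 hf).1
    exact_mod_cast (by omega : f ≠ 0)
  rw [recipArith_apply, one_div_mul_cancel hf0, one_mul, rieszSum]
  refine Finset.sum_congr rfl fun m hm => ?_
  have hm0 : m ≠ 0 := by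
    have := (Finset.mem_Icc.1 hm).1
    omega
  rw [ArithmeticFunction.natCoe_apply, ArithmeticFunction.zeta_apply_ne hm0, Nat.cast_one, one_mul]

/-- The main term of `rieszSum (recipArith * ζ)`. -/
noncomputable def rieszMain (z : ℝ) : ℝ :=
  (∑' n : ℕ, 1 / (n : ℝ) ^ 2) / 2 * z ^ 2 - z * log z / 2 +
    (1 - Real.eulerMascheroniConstant - log (2 * π)) / 2 * z

lemma abs_rieszMain_le_of_le_one {σ : ℝ} (hσ : σ < 1) :
    ∃ K : ℝ, 0 ≤ K ∧ ∀ z : ℝ, 0 < z → z ≤ 1 → |rieszMain z| ≤ K * z ^ σ := by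
  set a : ℝ := (∑' n : ℕ, 1 / (n : ℝ) ^ 2) / 2 with ha
  set c : ℝ := (1 - Real.eulerMascheroniConstant - log (2 * π)) / 2 with hc
  have hσ' : 0 < 1 - σ := by linarith
  refine ⟨|a| + 1 / (1 - σ) + |c|, by positivity, fun z hz hz1 => ?_⟩
  have h1 : z ≤ z ^ σ := by
    simpa using Real.rpow_le_rpow_of_exponent_ge hz hz1 hσ.le
  have h2 : z ^ 2 ≤ z ^ σ := by nlinarith
  have h3 : |z * log z / 2| ≤ 1 / (1 - σ) * z ^ σ := by
    have h4 := (Real.abs_log_mul_self_rpow_lt z (1 - σ) hz hz1 hσ').le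
    have h5 : z * log z / 2 = z ^ σ * (log z * z ^ (1 - σ)) / 2 := by
      have : z ^ σ * z ^ (1 - σ) = z := by rw [← Real.rpow_add hz]; simp
      linear_combination -(log z / 2) * this
    have h6 : 0 ≤ z ^ σ := by positivity
    rw [h5, abs_div, abs_mul, abs_of_nonneg h6, abs_two]
    have := mul_le_mul_of_nonneg_left h4 h6
    have h7 : 0 ≤ z ^ σ * |log z * z ^ (1 - σ)| := by positivity
    linarith
  calc |rieszMain z| = |a * z ^ 2 - z * log z / 2 + c * z| := rfl
    _ ≤ |a * z ^ 2| + |z * log z / 2| + |c * z| :=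
        (abs_add_le _ _).trans (add_le_add_left (abs_sub _ _) _)
    _ ≤ |a| * z ^ σ + 1 / (1 - σ) * z ^ σ + |c| * z ^ σ := by
        rw [abs_mul, abs_mul, abs_of_nonneg (sq_nonneg z), abs_of_pos hz]
        gcongr
    _ = _ := by ring

lemma abs_rieszSum_recipArith_mul_zeta_sub_le {σ : ℝ} (hσ : 1 / 2 ≤ σ) (hσ1 : σ < 1) :
    ∃ K : ℝ, 0 ≤ K ∧ ∀ z : ℝ, 0 < z →
      |rieszSum (recipArith * (ArithmeticFunction.zeta : ArithmeticFunction ℝ)) z - rieszMain z| ≤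
        K * z ^ σ := by
  obtain ⟨K, hK, h⟩ := abs_rieszMain_le_of_le_one hσ1
  refine ⟨K + 2, by linarith, fun z hz => ?_⟩
  have h0 : 0 ≤ z ^ σ := by positivity
  rcases lt_or_ge z 1 with h1 | h1
  · rw [rieszSum_eq_zero _ h1, zero_sub, abs_neg]
    have := h z hz h1.le
    linarith
  · have h2 := abs_sub_le_of_eq_sum_Icc h1 fun N hN => rieszSum_recipArith_mul_zeta hN
    have h3 : √z ≤ z ^ σ := by
      rw [Real.sqrt_eq_rpow]
      exact Real.rpow_le_rpow_of_exponent_le h1 hσ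
    have h4 : 0 ≤ K * z ^ σ := by positivity
    rw [rieszMain]
    linarith

lemma hasSum_rieszSum_oddLocalProd (z : ℝ) :
    HasSum (fun e : ℕ => sievedArith e * e *
      rieszSum (recipArith * (ArithmeticFunction.zeta : ArithmeticFunction ℝ)) (z / e))
      (rieszSum oddLocalProd z) := by
  rw [oddLocalProd_eq_mul, rieszSum_mul _ _ le_rfl]
  refine hasSum_sum_of_ne_finset_zero fun e he => ?_
  rcases Nat.eq_zero_or_pos e with rfl | he0
  · simp
  · have h1 : z < e := (Nat.floor_lt' he0.ne').1 (by
      rw [Finset.mem_Icc, not_and, not_le] at he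
      exact he he0)
    rw [rieszSum_eq_zero _ ((div_lt_one (by exact_mod_cast he0)).2 h1), mul_zero]

lemma hasSum_rieszMain {z : ℝ} (hz : 0 < z) :
    HasSum (fun e : ℕ => sievedArith e * e * rieszMain (z / e))
      ((∑' n : ℕ, 1 / (n : ℝ) ^ 2) / 2 * z ^ 2 * ∑' e : ℕ, sievedArith e / e +
        (-(z * log z / 2) + (1 - Real.eulerMascheroniConstant - log (2 * π)) / 2 * z) *
          ∑' e : ℕ, sievedArith e + z / 2 * (-log 2 * ∑' e : ℕ, sievedArith e)) := by
  have h := ((summable_sievedArith_div.hasSum.mul_left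
    ((∑' n : ℕ, 1 / (n : ℝ) ^ 2) / 2 * z ^ 2)).add (summable_sievedArith.hasSum.mul_left
    (-(z * log z / 2) + (1 - Real.eulerMascheroniConstant - log (2 * π)) / 2 * z))).add
    (summable_sievedArith_mul_log.hasSum.mul_left (z / 2))
  rw [tsum_sievedArith_mul_log] at h
  have hf : (fun e : ℕ => sievedArith e * e * rieszMain (z / e)) = fun e : ℕ =>
      (∑' n : ℕ, 1 / (n : ℝ) ^ 2) / 2 * z ^ 2 * (sievedArith e / e) +
        (-(z * log z / 2) + (1 - Real.eulerMascheroniConstant - log (2 * π)) / 2 * z) *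
          sievedArith e + z / 2 * (sievedArith e * log e) := by
    funext e
    rcases Nat.eq_zero_or_pos e with rfl | he
    · simp
    · have he0 : (e : ℝ) ≠ 0 := by exact_mod_cast he.ne'
      rw [rieszMain, Real.log_div hz.ne' he0]
      field_simp
      ring
  rwa [hf]

lemma abs_rieszSum_oddLocalProd_sub_le {σ : ℝ} (hσ : 1 / 2 < σ) (hσ1 : σ < 1) :
    ∃ K : ℝ, 0 ≤ K ∧ ∀ z : ℝ, 0 < z →
      |rieszSum oddLocalProd z -
        ((∑' n : ℕ, 1 / (n : ℝ) ^ 2) / 2 * z ^ 2 * ∑' e : ℕ, sievedArith e / e +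
        (-(z * log z / 2) + (1 - Real.eulerMascheroniConstant - log (2 * π)) / 2 * z) *
          ∑' e : ℕ, sievedArith e + z / 2 * (-log 2 * ∑' e : ℕ, sievedArith e))| ≤ K * z ^ σ := by
  obtain ⟨K, hK, h⟩ := abs_rieszSum_recipArith_mul_zeta_sub_le hσ.le hσ1
  have hs := summable_abs_sievedArith_mul_rpow (τ := 1 - σ) (by linarith) (by linarith)
  refine ⟨K * ∑' e : ℕ, |sievedArith e| * (e : ℝ) ^ (1 - σ),
    mul_nonneg hK (tsum_nonneg fun e => by positivity), fun z hz => ?_⟩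
  rw [mul_right_comm K]
  refine ((hasSum_rieszSum_oddLocalProd z).sub (hasSum_rieszMain hz)).norm_le_of_bounded
    (hs.hasSum.mul_left (K * z ^ σ)) fun e => ?_
  rcases Nat.eq_zero_or_pos e with rfl | he
  · simp
  · have he0 : (0 : ℝ) < e := by exact_mod_cast he
    rw [← mul_sub, norm_mul, norm_mul, Real.norm_eq_abs, Real.norm_eq_abs, Nat.abs_cast,
      Real.norm_eq_abs]
    calc _ ≤ |sievedArith e| * e * (K * (z / e) ^ σ) := by
          gcongr
          exact h _ (by positivity)
      _ = _ := by
          rw [Real.div_rpow hz.le he0.le, Real.rpow_sub he0, Real.rpow_one]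
          ring

lemma singularSeries_two_mul {m : ℕ} (hm : m ≠ 0) :
    singularSeries (2 * m) = 2 * (∏' p : Nat.Primes, twinFactor p) * oddLocalProd m := by
  have h : ((2 * m).primeFactors.filter fun p => 2 < p) = m.primeFactors.filter fun p => 2 < p := by
    rw [Nat.primeFactors_mul two_ne_zero hm, Nat.prime_two.primeFactors, Finset.filter_union]
    simp [Finset.filter_singleton]
  rw [singularSeries, if_pos (even_two_mul m), h, oddLocalProd,
    ArithmeticFunction.prodPrimeFactors_apply hm, Finset.prod_filter]
  rfl

lemma sum_singularSeries_mul_sub (y : ℝ) :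
    ∑ n ∈ Finset.Icc 1 ⌊y⌋₊, singularSeries n * (y - n) =
      4 * (∏' p : Nat.Primes, twinFactor p) * rieszSum oddLocalProd (y / 2) := by
  have h1 : (Finset.Icc 1 ⌊y⌋₊).filter Even = (Finset.Icc 1 ⌊y / 2⌋₊).image (2 * ·) := by
    rw [Nat.floor_div_ofNat]
    ext n
    simp only [Finset.mem_filter, Finset.mem_Icc, Finset.mem_image]
    constructor
    · rintro ⟨h, k, rfl⟩
      exact ⟨k, by omega, by omega⟩
    · rintro ⟨k, hk, rfl⟩
      exact ⟨by omega, even_two_mul k⟩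
  rw [← Finset.sum_filter_of_ne (p := Even), h1, Finset.sum_image, rieszSum, Finset.mul_sum]
  · refine Finset.sum_congr rfl fun m hm => ?_
    have hm0 : m ≠ 0 := by
      have := (Finset.mem_Icc.1 hm).1
      omega
    rw [singularSeries_two_mul hm0]
    push_cast
    ring
  · intro a _ b _ hab
    simpa using hab
  · intro n _ hn
    by_contra h
    exact hn (by rw [singularSeries, if_neg h, zero_mul])

lemma sum_Icc_zero_indicator (N : ℕ) (g : ℕ → ℝ) :
    ∑ k ∈ Finset.Icc 0 N, (if k = 0 then 0 else g k) = ∑ k ∈ Finset.Icc 1 N, g k := by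
  rw [← Finset.sum_filter_of_ne (p := (· ≠ 0))]
  · have : (Finset.Icc 0 N).filter (· ≠ 0) = Finset.Icc 1 N := by
      ext
      simp
      omega
    rw [this]
    refine Finset.sum_congr rfl fun k hk => if_neg ?_
    have := (Finset.mem_Icc.1 hk).1
    omega
  · intro k _ hk h
    exact hk (if_pos h)

lemma integral_sum_Icc_floor (g : ℕ → ℝ) {y : ℝ} (hy : 1 ≤ y) :
    ∫ u in (1 : ℝ)..y, ∑ k ∈ Finset.Icc 1 ⌊u⌋₊, g k =
      ∑ n ∈ Finset.Icc 1 ⌊y⌋₊, g n * (y - n) := by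
  have h := sum_mul_eq_sub_integral_mul₀ (f := fun t : ℝ => t) (fun k => if k = 0 then 0 else g k)
    (by simp) y (fun t _ => differentiableAt_id) (by simp)
  simp only [deriv_id'', one_mul, sum_Icc_zero_indicator] at h
  have h2 : ∑ k ∈ Finset.Icc 0 ⌊y⌋₊, (k : ℝ) * (if k = 0 then 0 else g k) =
      ∑ k ∈ Finset.Icc 1 ⌊y⌋₊, k * g k := by
    rw [← sum_Icc_zero_indicator]
    exact Finset.sum_congr rfl fun k _ => by split_ifs <;> simp
  rw [h2] at h
  rw [intervalIntegral.integral_of_le hy]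
  simp only [mul_sub, Finset.sum_sub_distrib, ← Finset.sum_mul]
  rw [Finset.sum_congr rfl fun k _ => mul_comm (g k) (k : ℝ)]
  linarith

lemma intervalIntegrable_sum_Icc_floor (g : ℕ → ℝ) {y : ℝ} (hy : 1 ≤ y) :
    IntervalIntegrable (fun u : ℝ => ∑ k ∈ Finset.Icc 1 ⌊u⌋₊, g k) volume 1 y := by
  rw [intervalIntegrable_iff_integrableOn_Icc_of_le hy]
  have h := (locallyIntegrableOn_mul_sum_Icc (m := 1) g zero_le_one (g := fun _ : ℝ => (1 : ℝ))
    ((MeasureTheory.locallyIntegrable_const (1 : ℝ)).locallyIntegrableOn _)).integrableOn_compact_subset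
    (Set.Icc_subset_Ici_self : Set.Icc 1 y ⊆ Set.Ici 1) isCompact_Icc
  simpa using h

lemma fErr_eq {y : ℝ} (hy : 1 ≤ y) :
    fErr y = ∑ n ∈ Finset.Icc 1 ⌊y⌋₊, singularSeries n * (y - n) - (y ^ 2 - 1) / 2 +
      (y * log y - y + 1) / 2 - Bconst / 2 * (y - 1) := by
  have h1 := intervalIntegrable_sum_Icc_floor (fun k => singularSeries k) hy
  have h2 : IntervalIntegrable (fun u : ℝ => u) volume 1 y :=
    continuous_id.intervalIntegrable _ _
  have h3 : IntervalIntegrable (fun u : ℝ => log u / 2) volume 1 y :=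
    intervalIntegral.intervalIntegrable_log'.div_const 2
  have h4 : IntervalIntegrable (fun _ : ℝ => Bconst / 2) volume 1 y := intervalIntegrable_const
  simp only [fErr, epsErr]
  rw [intervalIntegral.integral_sub ((h1.sub h2).add h3) h4,
    intervalIntegral.integral_add (h1.sub h2) h3, intervalIntegral.integral_sub h1 h2,
    integral_sum_Icc_floor _ hy, integral_id, intervalIntegral.integral_div, integral_log,
    intervalIntegral.integral_const, smul_eq_mul, Real.log_one]
  ring

/-- Consequence of Lemma 2.2: `f(y) = ∫_1^y (ε(u) - B/2) du` satisfies
`f(y) = O(y^(1/2+ε))` for every `ε > 0`. -/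
theorem fErr_bound (ε : ℝ) (hε : 0 < ε) :
    ∃ C : ℝ, 0 < C ∧ ∀ y : ℝ, 1 ≤ y → |fErr y| ≤ C * y ^ ((1 : ℝ) / 2 + ε) := by
  set σ : ℝ := 1 / 2 + min ε (1 / 4) with hσ
  have hσ0 : 1 / 2 < σ := by
    have : 0 < min ε (1 / 4) := lt_min hε (by norm_num)
    linarith
  have hσ1 : σ < 1 := by linarith [min_le_right ε (1 / 4)]
  have hσε : σ ≤ 1 / 2 + ε := by linarith [min_le_left ε (1 / 4)]
  obtain ⟨K, hK, h⟩ := abs_rieszSum_oddLocalProd_sub_le hσ0 hσ1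
  set P : ℝ := ∏' p : Nat.Primes, twinFactor p with hP
  set S : ℝ := ∑' e : ℕ, sievedArith e
  set A : ℝ := ∑' e : ℕ, sievedArith e / e
  set Z : ℝ := ∑' n : ℕ, 1 / (n : ℝ) ^ 2
  have hS : P * S = 1 / 2 := twinConst_mul_tsum_sievedArith
  have hA : P * A * Z = 1 := twinConst_mul_tsum_sievedArith_div
  refine ⟨4 * |P| * K + |1 + Bconst / 2| + 1, by positivity, fun y hy => ?_⟩
  have hy0 : 0 < y := by linarith
  have hyε : 1 ≤ y ^ (1 / 2 + ε) := Real.one_le_rpow hy (by linarith)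
  have h1 := h (y / 2) (by positivity)
  set R : ℝ := rieszSum oddLocalProd (y / 2)
  rw [Real.log_div hy0.ne' two_ne_zero] at h1
  set X : ℝ := R - (Z / 2 * (y / 2) ^ 2 * A +
    (-(y / 2 * (log y - log 2) / 2) +
      (1 - Real.eulerMascheroniConstant - log (2 * π)) / 2 * (y / 2)) * S +
      y / 2 / 2 * (-log 2 * S))
    with hX
  have h2 : fErr y = 4 * P * X + (1 + Bconst / 2) := by
    rw [fErr_eq hy, sum_singularSeries_mul_sub, hX, Bconst]
    linear_combination y ^ 2 / 2 * hA + (-(y * log y) + (1 - Real.eulerMascheroniConstant -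
      log (2 * π)) * y) * hS
  have h3 : (y / 2) ^ σ ≤ y ^ (1 / 2 + ε) :=
    (Real.rpow_le_rpow (by positivity) (by linarith) (by linarith)).trans
      (Real.rpow_le_rpow_of_exponent_le hy hσε)
  calc |fErr y| ≤ 4 * |P| * |X| + |1 + Bconst / 2| := by
        rw [h2]
        refine (abs_add_le _ _).trans (le_of_eq ?_)
        rw [abs_mul, abs_mul, abs_of_pos (by norm_num : (0 : ℝ) < 4)]
    _ ≤ 4 * |P| * (K * y ^ (1 / 2 + ε)) + |1 + Bconst / 2| * y ^ (1 / 2 + ε) := by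
        gcongr
        · exact h1.trans (by gcongr)
        · exact le_mul_of_one_le_right (abs_nonneg _) hyε
    _ ≤ _ := by linarith
end

section
/- Let T, x, Δ > 0 with TΔ ≤ x, let K be a positive integer with K ≥ 2, set Re Ψ̂(y) = (sin(2πy)/(2πy)) · (sin(2πΔy)/(2πΔy))^{K+1}, and fix 0 < ε < 1/2. If F : [1,∞) → ℝ is measurable and satisfies F(y) = O(y^{−3/2+ε}), then ∫_1^∞ F(y) · Re Ψ̂(Ty/(2πx)) dy = ∫_1^∞ F(y) · (sin((T/x)y)/((T/x)y)) dy + O(KΔ), where the implicit constant depends only on ε and the implied constant in the bound for F. -/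
open Real MeasureTheory

/-- `Re Ψ̂(y) = (sin(2πy)/(2πy)) · (sin(2πΔy)/(2πΔy))^{K+1}`, the real part of the
Fourier transform of the smoothed indicator `Ψ = χ_{K+1}`. -/
noncomputable def RePsiHat (Δ : ℝ) (K : ℕ) (y : ℝ) : ℝ :=
  Real.sin (2 * Real.pi * y) / (2 * Real.pi * y) *
    (Real.sin (2 * Real.pi * Δ * y) / (2 * Real.pi * Δ * y)) ^ (K + 1)

theorem Real.abs_sinc_sub_one_le (u : ℝ) : |sinc u - 1| ≤ 2 * |u| := by
  wlog hu : 0 ≤ u generalizing u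
  · simpa using this (-u) (by linarith)
  rw [abs_of_nonneg hu]
  rcases hu.eq_or_lt with rfl | hu
  · simp
  rcases le_or_gt u 1 with h1 | h1
  · have h := sin_gt_sub_cube hu
    have hle := sinc_le_one u
    have hge : 1 - u ^ 2 / 6 ≤ sinc u := by
      rw [sinc_of_ne_zero hu.ne', le_div_iff₀ hu]
      nlinarith
    rw [abs_of_nonpos (by linarith)]
    nlinarith
  · have hle := sinc_le_one u
    have hge := neg_one_le_sinc u
    rw [abs_of_nonpos (by linarith)]
    linarith

theorem Real.abs_sinc_pow_sub_one_le (u : ℝ) (n : ℕ) : |sinc u ^ n - 1| ≤ 2 * n * |u| := by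
  have h := abs_pow_sub_pow_le (sinc u) 1 n
  rw [one_pow, abs_one, max_eq_right (abs_sinc_le_one u), one_pow, mul_one] at h
  nlinarith [abs_sinc_sub_one_le u, (Nat.cast_nonneg n : (0 : ℝ) ≤ n)]

theorem Real.abs_sinc_mul_sinc_pow_sub_one_le {v : ℝ} (hv : v ≠ 0) (d : ℝ) (n : ℕ) :
    |sinc v * (sinc (d * v) ^ n - 1)| ≤ 2 * n * |d| := by
  have hv' : 0 < |v| := abs_pos.mpr hv
  have hsin : |sinc v| ≤ 1 / |v| := by
    rw [sinc_of_ne_zero hv, abs_div]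
    gcongr
    exact abs_sin_le_one v
  calc |sinc v * (sinc (d * v) ^ n - 1)|
      = |sinc v| * |sinc (d * v) ^ n - 1| := abs_mul _ _
    _ ≤ 1 / |v| * (2 * n * |d * v|) := by
      gcongr
      exact abs_sinc_pow_sub_one_le _ n
    _ = 2 * n * |d| := by
      rw [abs_mul]
      field_simp

theorem RePsiHat_eq_sinc {Δ y : ℝ} (hΔ : Δ ≠ 0) (hy : y ≠ 0) (K : ℕ) :
    RePsiHat Δ K y = sinc (2 * π * y) * sinc (Δ * (2 * π * y)) ^ (K + 1) := by
  have h : 2 * π * y ≠ 0 := by positivity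
  rw [RePsiHat, sinc_of_ne_zero h, sinc_of_ne_zero (mul_ne_zero hΔ h),
    show 2 * π * Δ * y = Δ * (2 * π * y) by ring]

/-- Lemma 2.6: if `F(y) ≪ y^{-3/2+ε}` then
`∫_1^∞ F(y) Re Ψ̂(Ty/2πx) dy = ∫_1^∞ F(y) sin((T/x)y)/((T/x)y) dy + O(KΔ)`,
where the implicit constant depends only on `ε` and the implied constant for `F`. -/
theorem RePsiHat_integral_general (ε : ℝ) (hε : 0 < ε) (hε' : ε < 1 / 2)
    (Cf : ℝ) (hCf : 0 < Cf) :
    ∃ C : ℝ, 0 < C ∧ ∀ (T x Δ : ℝ) (K : ℕ) (F : ℝ → ℝ),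
      0 < T → 0 < x → 0 < Δ → T * Δ ≤ x → 2 ≤ K →
      Measurable F → (∀ y : ℝ, 1 ≤ y → |F y| ≤ Cf * y ^ (-(3 : ℝ) / 2 + ε)) →
      |(∫ y in Set.Ioi (1 : ℝ), F y * RePsiHat Δ K (T * y / (2 * π * x))) -
          ∫ y in Set.Ioi (1 : ℝ), F y * (Real.sin (T / x * y) / (T / x * y))| ≤
        C * K * Δ := by
  have hexp : -(3 : ℝ) / 2 + ε < -1 := by linarith
  have hpos : 0 < 1 / 2 - ε := by linarith
  refine ⟨4 * Cf / (1 / 2 - ε), by positivity, ?_⟩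
  intro T x Δ K F hT hx hΔ _ hK hF hbound
  set g : ℝ → ℝ := fun y => y ^ (-(3 : ℝ) / 2 + ε)
  have hg : IntegrableOn g (Set.Ioi 1) := integrableOn_Ioi_rpow_of_lt hexp one_pos
  have hgint : ∫ y in Set.Ioi (1 : ℝ), g y = 1 / (1 / 2 - ε) := by
    rw [integral_Ioi_rpow_of_lt hexp one_pos, one_rpow,
      show -(3 : ℝ) / 2 + ε + 1 = -(1 / 2 - ε) by ring, neg_div_neg_eq]
  have hFint : IntegrableOn F (Set.Ioi 1) := by
    refine (hg.const_mul Cf).mono' hF.aestronglyMeasurable ?_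
    filter_upwards [ae_restrict_mem measurableSet_Ioi] with y hy
    exact hbound y (le_of_lt hy)
  have hne : ∀ y ∈ Set.Ioi (1 : ℝ), T / x * y ≠ 0 := fun y hy => by
    have : 0 < y := one_pos.trans hy
    positivity
  have hleft : ∀ y ∈ Set.Ioi (1 : ℝ), F y * RePsiHat Δ K (T * y / (2 * π * x)) =
      F y * (sinc (T / x * y) * sinc (Δ * (T / x * y)) ^ (K + 1)) := fun y hy => by
    have hy0 : 0 < y := one_pos.trans hy
    rw [RePsiHat_eq_sinc hΔ.ne' (by positivity),
      show 2 * π * (T * y / (2 * π * x)) = T / x * y by field_simp]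
  have hright : ∀ y ∈ Set.Ioi (1 : ℝ), F y * (Real.sin (T / x * y) / (T / x * y)) =
      F y * sinc (T / x * y) := fun y hy => by
    rw [sinc_of_ne_zero (hne y hy)]
  rw [setIntegral_congr_fun measurableSet_Ioi hleft,
    setIntegral_congr_fun measurableSet_Ioi hright, ← integral_sub]
  · have hKΔ : 2 * ((K + 1 : ℕ) : ℝ) * |Δ| ≤ 4 * K * Δ := by
      rw [abs_of_pos hΔ]
      have : (2 : ℝ) ≤ K := by exact_mod_cast hK
      push_cast
      nlinarith
    calc _ ≤ ∫ y in Set.Ioi (1 : ℝ), Cf * (4 * K * Δ) * g y := by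
          rw [← Real.norm_eq_abs]
          refine norm_integral_le_of_norm_le (hg.const_mul _) ?_
          filter_upwards [ae_restrict_mem measurableSet_Ioi] with y hy
          rw [← mul_sub, ← mul_sub_one, Real.norm_eq_abs, abs_mul]
          calc _ ≤ Cf * g y * (4 * K * Δ) := by
                gcongr
                · exact (abs_nonneg _).trans (hbound y (le_of_lt hy))
                · exact hbound y (le_of_lt hy)
                · exact (abs_sinc_mul_sinc_pow_sub_one_le (hne y hy) Δ (K + 1)).trans hKΔ
            _ = _ := by ring
      _ = _ := by
          rw [integral_const_mul, hgint]
          ring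
  · refine hFint.mul_bdd (c := 1) (by fun_prop) (ae_of_all _ fun y => ?_)
    rw [Real.norm_eq_abs, abs_mul, abs_pow]
    exact mul_le_one₀ (abs_sinc_le_one _) (by positivity)
      (pow_le_one₀ (abs_nonneg _) (abs_sinc_le_one _))
  · exact hFint.mul_bdd (c := 1) (by fun_prop) (ae_of_all _ fun y => abs_sinc_le_one _)
end

section
/- Assume the Riemann Hypothesis. For any ε > 0, Σ_{n > x} Λ(n)²/n³ = (1/2)(log x)/x² + (1/4)/x² + O_ε(1/x^{5/2−ε}) as x → ∞, where Λ is the von Mangoldt function. -/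
section RHBound

open Complex Set Filter Topology MeasureTheory Asymptotics

/-- The entire function `(s - 1) * ζ(s)`. -/
noncomputable def poleFreeZeta : ℂ → ℂ :=
  Function.update (fun s ↦ (s - 1) * riemannZeta s) 1 1

lemma poleFreeZeta_of_ne {s : ℂ} (hs : s ≠ 1) :
    poleFreeZeta s = (s - 1) * riemannZeta s := by
  simp [poleFreeZeta, Function.update_of_ne hs]

lemma differentiable_poleFreeZeta : Differentiable ℂ poleFreeZeta := by
  have key : ∀ s : ℂ, s ≠ 1 → DifferentiableAt ℂ poleFreeZeta s := fun s hs ↦ by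
    have h : poleFreeZeta =ᶠ[𝓝 s] fun s ↦ (s - 1) * riemannZeta s := by
      filter_upwards [isOpen_ne.mem_nhds hs] with z hz using poleFreeZeta_of_ne hz
    refine DifferentiableAt.congr_of_eventuallyEq ?_ h
    exact (by fun_prop : DifferentiableAt ℂ (fun s : ℂ ↦ s - 1) s).mul
      (differentiableAt_riemannZeta hs)
  intro s
  rcases eq_or_ne s 1 with rfl | hs
  · refine (analyticAt_of_differentiable_on_punctured_nhds_of_continuousAt ?_ ?_).differentiableAt
    · filter_upwards [self_mem_nhdsWithin] with t ht using key t ht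
    · simpa only [poleFreeZeta, continuousAt_update_same] using riemannZeta_residue_one
  · exact key s hs

lemma poleFreeZeta_ne_zero (hRH : RiemannHypothesis) {s : ℂ} (hs : 1 / 2 < s.re) :
    poleFreeZeta s ≠ 0 := by
  rcases eq_or_ne s 1 with rfl | h1
  · simp [poleFreeZeta]
  rw [poleFreeZeta_of_ne h1]
  refine mul_ne_zero (sub_ne_zero.mpr h1) fun h0 ↦ ?_
  have := hRH s h0 (by
    rintro ⟨n, rfl⟩
    have : ((-2 * ((n : ℂ) + 1)).re) = -2 * ((n : ℝ) + 1) := by simp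
    rw [this] at hs
    have : (0 : ℝ) ≤ n := n.cast_nonneg
    linarith) h1
  linarith

lemma logDeriv_poleFreeZeta {s : ℂ} (hs : 1 < s.re) :
    logDeriv poleFreeZeta s =
      1 / (s - 1) - LSeries (fun n ↦ (ArithmeticFunction.vonMangoldt n : ℂ)) s := by
  have h1 : s ≠ 1 := by rintro rfl; simp at hs
  have h : poleFreeZeta =ᶠ[𝓝 s] fun s ↦ (s - 1) * riemannZeta s := by
    filter_upwards [isOpen_ne.mem_nhds h1] with z hz using poleFreeZeta_of_ne hz
  have hz := riemannZeta_ne_zero_of_one_lt_re hs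
  have hd : HasDerivAt (fun s ↦ (s - 1) * riemannZeta s)
      (1 * riemannZeta s + (s - 1) * deriv riemannZeta s) s :=
    ((hasDerivAt_id s).sub_const 1).mul (differentiableAt_riemannZeta h1).hasDerivAt
  rw [logDeriv_apply, h.deriv_eq, h.eq_of_nhds, hd.deriv,
    ArithmeticFunction.LSeries_vonMangoldt_eq_deriv_riemannZeta_div hs]
  have := sub_ne_zero.mpr h1
  field_simp
  ring

/-- The fractional part on `(1, ∞)`, whose Mellin transform at `-s` gives the continuation of
`ζ` to the right half-plane. -/
noncomputable def fractIoi : ℝ → ℂ := (Ioi (1 : ℝ)).indicator fun t ↦ ((Int.fract t : ℝ) : ℂ)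

lemma norm_fractIoi_le (t : ℝ) : ‖fractIoi t‖ ≤ 1 := by
  unfold fractIoi
  refine (norm_indicator_le_norm_self _ _).trans ?_
  rw [norm_real, Real.norm_of_nonneg (Int.fract_nonneg t)]
  exact (Int.fract_lt_one t).le

lemma measurable_fractIoi : Measurable fractIoi :=
  (measurable_ofReal.comp measurable_fract).indicator measurableSet_Ioi

lemma differentiableAt_mellin_fractIoi {s : ℂ} (hs : s.re < 0) :
    DifferentiableAt ℂ (mellin fractIoi) s := by
  refine mellin_differentiableAt_of_isBigO_rpow (a := 0) (b := s.re - 1) ?_ ?_ hs ?_ (by linarith)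
  · refine LocallyIntegrable.locallyIntegrableOn ?_ _
    refine (locallyIntegrable_const (1 : ℝ)).mono measurable_fractIoi.aestronglyMeasurable ?_
    exact Eventually.of_forall fun t ↦ by simpa using norm_fractIoi_le t
  · refine IsBigO.of_bound 1 (Eventually.of_forall fun t ↦ ?_)
    simpa using norm_fractIoi_le t
  · refine (isBigO_zero _ _).congr' ?_ EventuallyEq.rfl
    filter_upwards [mem_nhdsWithin_of_mem_nhds (Iio_mem_nhds (zero_lt_one' ℝ))] with t ht
    have ht' : t ∉ Ioi (1 : ℝ) := not_lt.mpr (le_of_lt (mem_Iio.mp ht))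
    rw [fractIoi, indicator_of_notMem ht']

lemma mellin_fractIoi (s : ℂ) :
    mellin fractIoi (-s) = ∫ t in Ioi (1 : ℝ), ((Int.fract t : ℝ) : ℂ) * (t : ℂ) ^ (-(s + 1)) := by
  unfold mellin fractIoi
  rw [← integral_indicator measurableSet_Ioi, ← integral_indicator measurableSet_Ioi]
  congr 1 with t
  by_cases h : 1 < t
  · have h0 : 0 < t := by linarith
    simp only [mem_Ioi, h, h0, indicator_of_mem, smul_eq_mul]
    rw [mul_comm]; congr 2; ring
  · simp [indicator, h]

lemma norm_mellin_fractIoi_le {s : ℂ} (hs : 1 / 2 ≤ s.re) : ‖mellin fractIoi (-s)‖ ≤ 2 := by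
  rw [mellin_fractIoi]
  have h1 : ∀ t ∈ Ioi (1 : ℝ), ‖((Int.fract t : ℝ) : ℂ) * (t : ℂ) ^ (-(s + 1))‖
      ≤ t ^ (-(3 / 2) : ℝ) := fun t ht ↦ by
    have ht' : (1 : ℝ) < t := ht
    rw [norm_mul, norm_real, Real.norm_of_nonneg (Int.fract_nonneg t),
      norm_cpow_eq_rpow_re_of_pos (by linarith)]
    have h2 : t ^ (-(s + 1)).re ≤ t ^ (-(3 / 2) : ℝ) :=
      Real.rpow_le_rpow_of_exponent_le ht'.le (by simp; linarith)
    have h3 : 0 ≤ t ^ (-(s + 1)).re := Real.rpow_nonneg (by linarith) _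
    nlinarith [Int.fract_nonneg t, Int.fract_lt_one t]
  refine (norm_integral_le_of_norm_le
    (integrableOn_Ioi_rpow_of_lt (by norm_num : (-(3 / 2) : ℝ) < -1) zero_lt_one) ?_).trans ?_
  · exact (ae_restrict_iff' measurableSet_Ioi).mpr (Eventually.of_forall h1)
  · rw [integral_Ioi_rpow_of_lt (by norm_num) zero_lt_one]; norm_num

lemma poleFreeZeta_eq_of_one_lt_re {s : ℂ} (hs : 1 < s.re) :
    poleFreeZeta s = s - s * (s - 1) * mellin fractIoi (-s) := by
  have h1 : s ≠ 1 := by rintro rfl; simp at hs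
  have hsum := LSeries_eq_mul_integral (fun _ ↦ (1 : ℂ)) zero_le_one (s := s) hs
    (LSeriesSummable_one_iff.mpr hs) (by
      refine IsBigO.of_bound 1 (Eventually.of_forall fun n ↦ ?_)
      simp)
  have hL : LSeries (fun _ ↦ (1 : ℂ)) s = riemannZeta s := LSeries_one_eq_riemannZeta hs
  have hcong : ∫ t in Ioi (1 : ℝ), (∑ k ∈ Finset.Icc 1 ⌊t⌋₊, (1 : ℂ)) * (t : ℂ) ^ (-(s + 1)) =
      ∫ t in Ioi (1 : ℝ), ((t : ℂ) ^ (-s) - ((Int.fract t : ℝ) : ℂ) * (t : ℂ) ^ (-(s + 1))) := by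
    refine setIntegral_congr_fun measurableSet_Ioi fun t ht ↦ ?_
    have ht' : (0 : ℝ) < t := lt_trans zero_lt_one ht
    have ht0 : (t : ℂ) ≠ 0 := ofReal_ne_zero.mpr ht'.ne'
    have e1 : (t : ℂ) ^ (-s) = t * (t : ℂ) ^ (-(s + 1)) := by
      rw [show -s = 1 + -(s + 1) by ring, cpow_add _ _ ht0, cpow_one]
    have e2 : (⌊t⌋₊ : ℂ) = t - ((Int.fract t : ℝ) : ℂ) := by
      have : (⌊t⌋₊ : ℝ) = t - Int.fract t := by
        rw [Int.fract, ← natCast_floor_eq_intCast_floor ht'.le]; ring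
      exact_mod_cast congrArg (fun x : ℝ ↦ (x : ℂ)) this
    simp only [Finset.sum_const, Nat.card_Icc, add_tsub_cancel_right, nsmul_eq_mul, mul_one]
    rw [e1, e2]; ring
  have hi1 : IntegrableOn (fun t : ℝ ↦ (t : ℂ) ^ (-s)) (Ioi 1) :=
    integrableOn_Ioi_cpow_of_lt (by simpa using hs) zero_lt_one
  have hi2 : IntegrableOn
      (fun t : ℝ ↦ ((Int.fract t : ℝ) : ℂ) * (t : ℂ) ^ (-(s + 1))) (Ioi 1) := by
    refine Integrable.bdd_mul (c := 1)
      (integrableOn_Ioi_cpow_of_lt (by simp; linarith) zero_lt_one)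
      (measurable_ofReal.comp measurable_fract).aestronglyMeasurable
      (Eventually.of_forall fun t ↦ ?_)
    rw [norm_real, Real.norm_of_nonneg (Int.fract_nonneg t)]
    exact (Int.fract_lt_one t).le
  rw [hL, hcong, integral_sub hi1 hi2, ← mellin_fractIoi,
    integral_Ioi_cpow_of_lt (by simpa using hs) zero_lt_one] at hsum
  rw [poleFreeZeta_of_ne h1, hsum]
  have e3 : -s + 1 ≠ 0 := by rw [neg_add_eq_sub]; exact sub_ne_zero.mpr h1.symm
  have e4 := sub_ne_zero.mpr h1
  simp only [ofReal_one, one_cpow]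
  have e5 : (-1 : ℂ) / (-s + 1) = 1 / (s - 1) := by
    rw [div_eq_div_iff e3 e4]; ring
  rw [e5]
  field_simp

lemma poleFreeZeta_eq {s : ℂ} (hs : 0 < s.re) :
    poleFreeZeta s = s - s * (s - 1) * mellin fractIoi (-s) := by
  have hopen : IsOpen {z : ℂ | 0 < z.re} := isOpen_lt continuous_const continuous_re
  have hconv : Convex ℝ {z : ℂ | 0 < z.re} := convex_halfSpace_re_gt 0
  have hR : DifferentiableOn ℂ (fun s ↦ s - s * (s - 1) * mellin fractIoi (-s))
      {z : ℂ | 0 < z.re} := fun z hz ↦ by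
    have : DifferentiableAt ℂ (fun s ↦ mellin fractIoi (-s)) z :=
      DifferentiableAt.comp z (f := fun s : ℂ ↦ -s)
        (differentiableAt_mellin_fractIoi (by simpa using hz)) (by fun_prop)
    exact DifferentiableAt.differentiableWithinAt (by fun_prop)
  refine AnalyticOnNhd.eqOn_of_preconnected_of_eventuallyEq (z₀ := 2)
    (differentiable_poleFreeZeta.differentiableOn.analyticOnNhd hopen)
    (hR.analyticOnNhd hopen) hconv.isPreconnected (by simp) ?_ hs
  have h2 : {z : ℂ | 1 < z.re} ∈ 𝓝 (2 : ℂ) :=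
    (isOpen_lt continuous_const continuous_re).mem_nhds (by simp)
  filter_upwards [h2] with z hz using poleFreeZeta_eq_of_one_lt_re hz

lemma norm_poleFreeZeta_le {s : ℂ} (hs : 1 / 2 ≤ s.re) :
    ‖poleFreeZeta s‖ ≤ 2 * (1 + ‖s‖) ^ 2 := by
  rw [poleFreeZeta_eq (by linarith)]
  have h1 := norm_mellin_fractIoi_le hs
  have h2 : ‖s - 1‖ ≤ ‖s‖ + 1 := (norm_sub_le _ _).trans (by simp)
  calc _ ≤ ‖s‖ + ‖s * (s - 1) * mellin fractIoi (-s)‖ := norm_sub_le _ _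
    _ ≤ ‖s‖ + ‖s‖ * (‖s‖ + 1) * 2 := by rw [norm_mul, norm_mul]; gcongr
    _ ≤ _ := by nlinarith [norm_nonneg s]

lemma one_div_four_le_norm_riemannZeta {s : ℂ} (hs : s.re = 2) : 1 / 4 ≤ ‖riemannZeta s‖ := by
  have h1 : 1 < s.re := by linarith
  have hnorm : ∀ n : ℕ, ‖1 / (n : ℂ) ^ s‖ = 1 / (n : ℝ) ^ 2 := fun n ↦ by
    rcases Nat.eq_zero_or_pos n with rfl | hn
    · have : s ≠ 0 := by rintro rfl; simp at hs
      simp [zero_cpow this]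
    · rw [norm_div, norm_one, norm_natCast_cpow_of_pos hn, hs]; norm_cast
  have hsumm : Summable fun n : ℕ ↦ 1 / (n : ℂ) ^ s :=
    Summable.of_norm (by simp_rw [hnorm]; exact hasSum_zeta_two.summable)
  have hz : riemannZeta s = 1 + ∑' n : ℕ, 1 / ((n + 2 : ℕ) : ℂ) ^ s := by
    rw [zeta_eq_tsum_one_div_nat_cpow h1, ← hsumm.sum_add_tsum_nat_add 2]
    have : s ≠ 0 := by rintro rfl; simp at hs
    simp [Finset.sum_range_succ, zero_cpow this]
  have ht : HasSum (fun n : ℕ ↦ 1 / ((n + 2 : ℕ) : ℝ) ^ 2) (Real.pi ^ 2 / 6 - 1) := by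
    have := (hasSum_nat_add_iff' (f := fun n : ℕ ↦ 1 / (n : ℝ) ^ 2) 2).mpr hasSum_zeta_two
    simpa [Finset.sum_range_succ] using this
  have hb : ‖∑' n : ℕ, 1 / ((n + 2 : ℕ) : ℂ) ^ s‖ ≤ Real.pi ^ 2 / 6 - 1 :=
    tsum_of_norm_bounded ht fun n ↦ (hnorm (n + 2)).le
  have hpi := Real.pi_lt_d2
  have hpi0 := Real.pi_pos
  have h3 : ‖(1 : ℂ)‖ - ‖∑' n : ℕ, 1 / ((n + 2 : ℕ) : ℂ) ^ s‖ ≤ ‖riemannZeta s‖ := by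
    rw [hz]; exact norm_sub_le_norm_add _ _
  rw [norm_one] at h3
  nlinarith

lemma exists_exp_eq_of_ne_zero_on_ball {f : ℂ → ℂ} {c : ℂ} {r : ℝ} (hr : 0 < r)
    (hf : Differentiable ℂ f) (h0 : ∀ z ∈ Metric.ball c r, f z ≠ 0) :
    ∃ L : ℂ → ℂ, L c = 0 ∧ (∀ z ∈ Metric.ball c r, HasDerivAt L (logDeriv f z) z) ∧
      ∀ z ∈ Metric.ball c r, f z = f c * exp (L z) := by
  have hd : DifferentiableOn ℂ (logDeriv f) (Metric.ball c r) :=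
    (hf.differentiableOn.deriv Metric.isOpen_ball).div hf.differentiableOn h0
  obtain ⟨L, hL0, hL⟩ := hd.isExactOn_ball.with_val_at c 0
  refine ⟨L, hL0, hL, fun z hz ↦ ?_⟩
  have hder : ∀ w ∈ Metric.ball c r, HasDerivAt (fun w ↦ f w * exp (-L w)) 0 w := fun w hw ↦ by
    have := (hf w).hasDerivAt.mul (hL w hw).neg.cexp
    convert! this using 1
    rw [logDeriv_apply]
    field_simp [h0 w hw]
    ring
  have hc := (convex_ball c r).is_const_of_fderivWithin_eq_zero (𝕜 := ℂ)
    (f := fun w ↦ f w * exp (-L w))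
    (fun w hw ↦ (hder w hw).differentiableAt.differentiableWithinAt)
    (fun w hw ↦ by
      rw [fderivWithin_of_isOpen Metric.isOpen_ball hw]
      ext; simp [(hder w hw).deriv]) hz (Metric.mem_ball_self hr)
  simp only [hL0, neg_zero, exp_zero, mul_one] at hc
  rw [← hc, mul_assoc, ← exp_add]
  simp

lemma norm_logDeriv_poleFreeZeta_le (hRH : RiemannHypothesis) {δ : ℝ} (hδ : 0 < δ) {s : ℂ}
    (h1 : 1 / 2 + δ ≤ s.re) (h2 : s.re ≤ 2) :
    ‖logDeriv poleFreeZeta s‖ ≤ 72 / δ ^ 2 * Real.log (3 + |s.im|) := by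
  set t := s.im with ht
  set c : ℂ := 2 + t * I with hc
  have hcre : c.re = 2 := by simp [hc]
  have hcim : c.im = t := by simp [hc]
  have hδ1 : δ ≤ 3 / 2 := by linarith
  have hball : ∀ z ∈ Metric.ball c (3 / 2), 1 / 2 < z.re := fun z hz ↦ by
    have := (abs_re_le_norm (z - c)).trans_lt (mem_ball_iff_norm.mp hz)
    rw [sub_re, hcre, abs_lt] at this
    linarith
  obtain ⟨L, hL0, hLd, hLe⟩ := exists_exp_eq_of_ne_zero_on_ball (c := c) (r := 3 / 2)
    (by norm_num) differentiable_poleFreeZeta fun z hz ↦ poleFreeZeta_ne_zero hRH (hball z hz)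
  have hT : (3 : ℝ) ≤ 3 + |t| := by linarith [abs_nonneg t]
  have hlog : 0 < Real.log (3 + |t|) := Real.log_pos (by linarith)
  set M := 6 * Real.log (3 + |t|) with hM
  have hMpos : 0 < M := by positivity
  have hcl : 1 / 4 ≤ ‖poleFreeZeta c‖ := by
    have hc1 : c ≠ 1 := fun h ↦ by rw [h] at hcre; norm_num at hcre
    rw [poleFreeZeta_of_ne hc1, norm_mul]
    have h3 := one_div_four_le_norm_riemannZeta hcre
    have h4 : 1 ≤ ‖c - 1‖ := by
      have := abs_re_le_norm (c - 1)
      rw [sub_re, hcre, one_re] at this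
      norm_num at this; exact this
    nlinarith
  have hre : ∀ z ∈ Metric.ball c (3 / 2), (L z).re ≤ M := fun z hz ↦ by
    have h3 := norm_poleFreeZeta_le (hball z hz).le
    have h4 : ‖z‖ ≤ 7 / 2 + |t| := by
      have h5 : ‖c‖ ≤ 2 + |t| := by
        refine (norm_add_le _ _).trans ?_
        simp
      have h6 := norm_le_norm_add_norm_sub' z c
      have := mem_ball_iff_norm.mp hz
      linarith
    rw [hLe z hz, norm_mul, norm_exp] at h3
    have h5 : Real.exp (L z).re ≤ (3 + |t|) ^ 6 := by
      have e1 : 1 / 4 * Real.exp (L z).re ≤ 8 * (3 + |t|) ^ 2 := by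
        calc _ ≤ ‖poleFreeZeta c‖ * Real.exp (L z).re := by gcongr
          _ ≤ _ := h3
          _ ≤ 2 * (2 * (3 + |t|)) ^ 2 := by gcongr; linarith [abs_nonneg t]
          _ = _ := by ring
      have e2 : (3 : ℝ) ^ 4 ≤ (3 + |t|) ^ 4 := by gcongr
      nlinarith [sq_nonneg (3 + |t|)]
    have h6 := Real.log_le_log (Real.exp_pos _) h5
    rwa [Real.log_exp, Real.log_pow] at h6
  have hshift : ∀ w ∈ Metric.ball (0 : ℂ) (3 / 2), c + w ∈ Metric.ball c (3 / 2) := fun w hw ↦ by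
    simpa [mem_ball_iff_norm] using hw
  have hBC : ∀ z ∈ Metric.closedBall s (δ / 2), z ∈ Metric.ball c (3 / 2) ∧ ‖L z‖ ≤ 6 * M / δ := by
    intro z hz
    have h3 : ‖z - c‖ ≤ 3 / 2 - δ / 2 := by
      have h4 : s - c = ((s.re - 2 : ℝ) : ℂ) := by
        apply Complex.ext <;> simp [hcre, hcim, ht]
      have h5 : ‖s - c‖ ≤ 3 / 2 - δ := by
        rw [h4, norm_real, Real.norm_eq_abs, abs_le]; constructor <;> linarith
      have h6 := mem_closedBall_iff_norm.mp hz
      calc ‖z - c‖ = ‖(z - s) + (s - c)‖ := by ring_nf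
        _ ≤ ‖z - s‖ + ‖s - c‖ := norm_add_le _ _
        _ ≤ _ := by linarith
    have hzb : ‖z - c‖ < 3 / 2 := by linarith
    refine ⟨mem_ball_iff_norm.mpr hzb, ?_⟩
    have := borelCaratheodory_zero (f := fun w ↦ L (c + w)) (R := 3 / 2) (z := z - c) hMpos
      (fun w hw ↦ by
        have := (hLd _ (hshift w hw)).differentiableAt
        exact (DifferentiableAt.comp w (f := fun w ↦ c + w) this
          (by fun_prop)).differentiableWithinAt)
      (fun w hw ↦ hre _ (hshift w hw)) (by norm_num)
      (mem_ball_zero_iff.mpr hzb) (by simpa using hL0)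
    rw [add_sub_cancel] at this
    refine this.trans ?_
    rw [div_le_div_iff₀ (by linarith) hδ]
    nlinarith [norm_nonneg (z - c), mul_le_mul_of_nonneg_left h3 hMpos.le,
      mul_le_mul_of_nonneg_left hδ1 hMpos.le, mul_pos hMpos hδ,
      mul_le_mul_of_nonneg_left hzb.le (mul_pos hMpos hδ).le]
  have hs := (hBC s (Metric.mem_closedBall_self (by positivity))).1
  rw [← (hLd s hs).deriv]
  have hfin := norm_deriv_le_of_forall_mem_sphere_norm_le (c := s) (R := δ / 2) (f := L)
    (C := 6 * M / δ) (by positivity)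
    (DifferentiableOn.diffContOnCl_ball (U := Metric.ball c (3 / 2))
      (fun z hz ↦ (hLd z hz).differentiableAt.differentiableWithinAt)
      fun z hz ↦ (hBC z hz).1)
    fun z hz ↦ (hBC z (Metric.sphere_subset_closedBall hz)).2
  refine hfin.trans (le_of_eq ?_)
  rw [hM]; field_simp; norm_num

lemma integrable_vertical_of_norm_le {f : ℂ → ℂ} {a C : ℝ} (ha : 1 / 2 < a)
    (hf : DifferentiableOn ℂ f {s | 1 / 2 < s.re})
    (hb : ∀ y : ℝ, ‖f (a + y * I)‖ ≤ C * (1 + |y|) ^ (-(3 / 2) : ℝ)) :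
    Integrable fun y : ℝ ↦ f (a + y * I) := by
  have hi : Integrable fun y : ℝ ↦ C * (1 + ‖y‖) ^ (-(3 / 2) : ℝ) :=
    (integrable_one_add_norm (by norm_num)).const_mul C
  refine hi.mono' ?_ (Eventually.of_forall hb)
  have : Continuous fun y : ℝ ↦ f (a + y * I) :=
    hf.continuousOn.comp_continuous (by fun_prop) fun y ↦ by simpa using ha
  exact this.aestronglyMeasurable

lemma integral_vertical_eq_of_norm_le {f : ℂ → ℂ} {a b C : ℝ} (ha : 1 / 2 < a) (hab : a ≤ b)
    (hf : DifferentiableOn ℂ f {s | 1 / 2 < s.re})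
    (hb : ∀ s : ℂ, a ≤ s.re → s.re ≤ b → ‖f s‖ ≤ C * (1 + |s.im|) ^ (-(3 / 2) : ℝ)) :
    ∫ y : ℝ, f (a + y * I) = ∫ y : ℝ, f (b + y * I) := by
  have hia := integrable_vertical_of_norm_le ha hf fun y ↦ by
    simpa using hb (a + y * I) (by simp) (by simpa using hab)
  have hib := integrable_vertical_of_norm_le (ha.trans_le hab) hf fun y ↦ by
    simpa using hb (b + y * I) (by simpa using hab) (by simp)
  have lim (h : ℝ → ℂ) (hh : Integrable h) :
      Tendsto (fun T : ℝ ↦ ∫ y in (-T)..T, h y) atTop (𝓝 (∫ y, h y)) :=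
    intervalIntegral_tendsto_integral hh tendsto_neg_atTop_atBot tendsto_id
  have hdec : Tendsto (fun T : ℝ ↦ C * (1 + |T|) ^ (-(3 / 2) : ℝ) * |b - a|) atTop (𝓝 0) := by
    have h1 : Tendsto (fun T : ℝ ↦ 1 + |T|) atTop atTop :=
      tendsto_atTop_add_const_left _ _ tendsto_abs_atTop_atTop
    have h2 := (tendsto_rpow_neg_atTop (by norm_num : (0 : ℝ) < 3 / 2)).comp h1
    simpa using (h2.const_mul C).mul_const |b - a|
  have hor (ε : ℝ) (hε : |ε| = 1) :
      Tendsto (fun T : ℝ ↦ ∫ x in a..b, f (x + (ε * T : ℝ) * I)) atTop (𝓝 0) := by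
    refine squeeze_zero_norm (fun T ↦ ?_) hdec
    refine intervalIntegral.norm_integral_le_of_norm_le_const fun x hx ↦ ?_
    rw [uIoc_of_le hab] at hx
    have := hb (x + (ε * T : ℝ) * I) (by simpa using hx.1.le) (by simpa using hx.2)
    simpa [abs_mul, hε] using this
  have hrect (T : ℝ) : (∫ y in (-T)..T, f (b + y * I)) - (∫ y in (-T)..T, f (a + y * I)) =
      I * ((∫ x in a..b, f (x + ((-1) * T : ℝ) * I)) - ∫ x in a..b, f (x + (1 * T : ℝ) * I)) := by
    have := integral_boundary_rect_eq_zero_of_differentiableOn f (a + ((-T : ℝ) : ℂ) * I)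
      (b + (T : ℂ) * I) (hf.mono fun z hz ↦ by
        have h := hz.1
        simp only [add_re, ofReal_re, mul_re, I_re, mul_zero, ofReal_im, I_im, mul_one, sub_self,
          add_zero, mem_preimage, uIcc_of_le hab] at h
        exact ha.trans_le h.1)
    simp only [add_re, ofReal_re, mul_re, I_re, mul_zero, ofReal_im, I_im, mul_one, sub_self,
      add_zero, add_im, mul_im, zero_add, smul_eq_mul] at this
    simp only [neg_one_mul, one_mul]
    linear_combination (-I) * this + ((∫ y in (-T)..T, f (b + y * I)) -
      (∫ y in (-T)..T, f (a + y * I))) * I_mul_I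
  have hlim := ((lim _ hib).sub (lim _ hia)).congr hrect
  have h0 := ((hor (-1) (by simp)).sub (hor 1 (by simp))).const_mul I
  rw [sub_zero, mul_zero] at h0
  exact (sub_eq_zero.mp (tendsto_nhds_unique hlim h0)).symm

lemma one_add_abs_le_norm {s : ℂ} (hs : 1 / 2 ≤ s.re) : (1 + |s.im|) / 3 ≤ ‖s‖ := by
  have h1 := abs_re_le_norm s
  have h2 := abs_im_le_norm s
  have h3 := le_abs_self s.re
  linarith

lemma inv_norm_le {s : ℂ} (hs : 1 / 2 ≤ s.re) : ‖s‖⁻¹ ≤ 3 * (1 + |s.im|)⁻¹ := by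
  have h := one_add_abs_le_norm hs
  have h0 : 0 < 1 + |s.im| := by positivity
  rw [← div_eq_mul_inv, inv_eq_one_div, div_le_div_iff₀ (by linarith) h0]
  linarith

lemma differentiableOn_inv_mul_inv :
    DifferentiableOn ℂ (fun s : ℂ ↦ s⁻¹ * (s + 1)⁻¹) {s | 1 / 2 < s.re} := fun s hs ↦ by
  have hs' : 1 / 2 < s.re := hs
  have h0 : s ≠ 0 := by rintro rfl; norm_num at hs'
  have h1 : s + 1 ≠ 0 := fun h ↦ by
    have := congrArg re h; simp at this; linarith
  exact (((differentiableAt_id).inv h0).mul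
    ((by fun_prop : DifferentiableAt ℂ (fun s : ℂ ↦ s + 1) s).inv h1)).differentiableWithinAt

lemma norm_inv_mul_inv_le {s : ℂ} (hs : 1 / 2 ≤ s.re) :
    ‖s⁻¹ * (s + 1)⁻¹‖ ≤ 9 * (1 + |s.im|) ^ (-2 : ℝ) := by
  have h1 := inv_norm_le hs
  have h2 := inv_norm_le (s := s + 1) (by simp; linarith)
  simp only [add_im, one_im, add_zero] at h2
  have h0 : 0 < 1 + |s.im| := by positivity
  rw [norm_mul, norm_inv, norm_inv, Real.rpow_neg h0.le, Real.rpow_two]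
  calc _ ≤ (3 * (1 + |s.im|)⁻¹) * (3 * (1 + |s.im|)⁻¹) := by gcongr
    _ = _ := by field_simp; norm_num

lemma log_three_add_le {η : ℝ} (hη : 0 < η) (hη1 : η ≤ 1) (y : ℝ) :
    Real.log (3 + |y|) ≤ 3 / η * (1 + |y|) ^ η := by
  have h0 : 0 < 1 + |y| := by positivity
  have h1 := Real.log_le_rpow_div (x := 3 + |y|) (by positivity) hη
  have h2 : (3 + |y|) ^ η ≤ 3 * (1 + |y|) ^ η := by
    calc (3 + |y|) ^ η ≤ (3 * (1 + |y|)) ^ η := by gcongr; linarith [abs_nonneg y]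
      _ = 3 ^ η * (1 + |y|) ^ η := Real.mul_rpow (by norm_num) h0.le
      _ ≤ 3 ^ (1 : ℝ) * (1 + |y|) ^ η := by gcongr; norm_num
      _ = _ := by rw [Real.rpow_one]
  calc _ ≤ (3 + |y|) ^ η / η := h1
    _ ≤ 3 * (1 + |y|) ^ η / η := by gcongr
    _ = _ := by ring

/-- The indicator of `(0, 1]` applied to a power, evaluated at a positive real. -/
lemma indicator_Ioc_cpow {t : ℝ} (ht : 0 < t) (a : ℝ) :
    (Ioc (0 : ℝ) 1).indicator (fun t ↦ (t : ℂ) ^ (a : ℂ)) t = ((if t ≤ 1 then t ^ a else 0 : ℝ) : ℂ)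
    := by
  by_cases h : t ≤ 1
  · rw [indicator_of_mem (show t ∈ Ioc (0 : ℝ) 1 from ⟨ht, h⟩), if_pos h, ofReal_cpow ht.le]
  · rw [indicator_of_notMem (fun h' ↦ h h'.2), if_neg h, ofReal_zero]

lemma integral_cpow_of_hasMellin {f : ℝ → ℂ} {g : ℝ → ℝ} {K : ℂ → ℂ} {C : ℝ}
    (hf : ∀ y : ℝ, HasMellin f (2 + y * I) (K (2 + y * I)))
    (hK : DifferentiableOn ℂ K {s | 1 < s.re})
    (hKb : ∀ y : ℝ, ‖K (2 + y * I)‖ ≤ C * (1 + |y|) ^ (-(3 / 2) : ℝ))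
    (hg : ∀ t, 0 < t → f t = g t) (hgc : ∀ t, 0 < t → ContinuousAt g t) {u : ℝ} (hu : 0 < u) :
    ∫ y : ℝ, (u : ℂ) ^ (-(2 + y * I)) * K (2 + y * I) = 2 * Real.pi * g u := by
  have hcont : Continuous fun y : ℝ ↦ K (2 + y * I) :=
    hK.continuousOn.comp_continuous (by fun_prop) fun y ↦ by simp
  have hKi : Integrable fun y : ℝ ↦ K (2 + y * I) := by
    have hi : Integrable fun y : ℝ ↦ C * (1 + ‖y‖) ^ (-(3 / 2) : ℝ) :=
      (integrable_one_add_norm (by norm_num)).const_mul C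
    exact hi.mono' hcont.aestronglyMeasurable (Eventually.of_forall hKb)
  have hfc : ContinuousAt f u := by
    have h1 : ContinuousAt (fun t ↦ (g t : ℂ)) u :=
      continuous_ofReal.continuousAt.comp (hgc u hu)
    refine h1.congr ?_
    filter_upwards [Ioi_mem_nhds hu] with t ht using (hg t ht).symm
  have hm : ∀ y : ℝ, mellin f ((2 : ℝ) + y * I) = K (2 + y * I) := fun y ↦ (hf y).2
  have key := mellinInv_mellin_eq 2 f hu (by simpa using (hf 0).1)
    (by simp only [VerticalIntegrable, hm]; exact hKi) hfc
  simp only [mellinInv, hm, smul_eq_mul, hg u hu] at key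
  simp only [ofReal_ofNat, real_smul] at key
  have h2 : (2 * Real.pi : ℂ) * ((1 / (2 * Real.pi) : ℝ) : ℂ) = 1 := by
    have : (Real.pi : ℂ) ≠ 0 := ofReal_ne_zero.mpr Real.pi_ne_zero
    push_cast
    field_simp
  rw [← key, ← mul_assoc, h2, one_mul]

lemma integral_natCast_div_cpow_kernel {u : ℝ} (hu : 0 < u) :
    ∫ y : ℝ, (u : ℂ) ^ (-(2 + y * I)) * ((2 + y * I)⁻¹ * ((2 + y * I) + 1)⁻¹) =
      2 * Real.pi * (max 0 (1 - u) : ℝ) := by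
  refine integral_cpow_of_hasMellin (K := fun s ↦ s⁻¹ * (s + 1)⁻¹) (C := 9)
    (g := fun t ↦ max 0 (1 - t))
    (f := fun t ↦ (Ioc (0 : ℝ) 1).indicator (fun t ↦ (t : ℂ) ^ ((0 : ℝ) : ℂ)) t -
      (Ioc (0 : ℝ) 1).indicator (fun t ↦ (t : ℂ) ^ ((1 : ℝ) : ℂ)) t) ?_ ?_ ?_ ?_ ?_ hu
  · intro y
    have h0 := hasMellin_cpow_Ioc ((0 : ℝ) : ℂ) (s := 2 + y * I) (by simp)
    have h1 := hasMellin_cpow_Ioc ((1 : ℝ) : ℂ) (s := 2 + y * I) (by simp; norm_num)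
    have h := hasMellin_sub h0.1 h1.1
    rw [h0.2, h1.2] at h
    have e0 : (2 + y * I : ℂ) ≠ 0 := fun h ↦ by simpa using congrArg re h
    have e1 : (2 + y * I : ℂ) + 1 ≠ 0 := fun h ↦ by
      have := congrArg re h; norm_num at this
    refine ⟨h.1, h.2.trans ?_⟩
    push_cast
    rw [add_zero]
    field_simp
    ring
  · exact differentiableOn_inv_mul_inv.mono fun s hs ↦ by
      have : 1 < s.re := hs
      show 1 / 2 < s.re
      linarith
  · intro y
    have := norm_inv_mul_inv_le (s := 2 + y * I) (by simp; norm_num)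
    refine this.trans ?_
    simp only [add_im, mul_im, ofReal_re, I_im, mul_one, ofReal_im, I_re, mul_zero, add_zero,
      im_ofNat, zero_add]
    gcongr
    · linarith [abs_nonneg y]
    · norm_num
  · intro t ht
    rw [indicator_Ioc_cpow ht, indicator_Ioc_cpow ht, ← ofReal_sub]
    congr 1
    split_ifs with h
    · rw [max_eq_right (by linarith)]; simp
    · rw [max_eq_left (by linarith)]; simp
  · intro t _
    fun_prop

lemma integral_cpow_kernel_pole {u : ℝ} (hu : 0 < u) :
    ∫ y : ℝ, (u : ℂ) ^ (-(2 + y * I)) *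
      ((2 + y * I)⁻¹ * ((2 + y * I) + 1)⁻¹ * (1 / (2 + y * I - 1))) =
      2 * Real.pi * (max 0 (1 - u) ^ 2 / (2 * u) : ℝ) := by
  refine integral_cpow_of_hasMellin (K := fun s ↦ s⁻¹ * (s + 1)⁻¹ * (1 / (s - 1))) (C := 9)
    (g := fun t ↦ max 0 (1 - t) ^ 2 / (2 * t))
    (f := fun t ↦
      ((1 / 2 : ℂ) • (Ioc (0 : ℝ) 1).indicator (fun t ↦ (t : ℂ) ^ ((-1 : ℝ) : ℂ)) t +
      (1 / 2 : ℂ) • (Ioc (0 : ℝ) 1).indicator (fun t ↦ (t : ℂ) ^ ((1 : ℝ) : ℂ)) t) -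
      (Ioc (0 : ℝ) 1).indicator (fun t ↦ (t : ℂ) ^ ((0 : ℝ) : ℂ)) t) ?_ ?_ ?_ ?_ ?_ hu
  · intro y
    have h0 := hasMellin_cpow_Ioc ((0 : ℝ) : ℂ) (s := 2 + y * I) (by simp)
    have h1 := hasMellin_cpow_Ioc ((1 : ℝ) : ℂ) (s := 2 + y * I) (by simp; norm_num)
    have h2 := hasMellin_cpow_Ioc ((-1 : ℝ) : ℂ) (s := 2 + y * I) (by simp)
    have h1' := hasMellin_const_smul h1.1 (1 / 2 : ℂ)
    have h2' := hasMellin_const_smul h2.1 (1 / 2 : ℂ)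
    have h3 := hasMellin_add h2'.1 h1'.1
    have h := hasMellin_sub h3.1 h0.1
    rw [h3.2, h2'.2, h1'.2, h0.2, h1.2, h2.2] at h
    have e0 : (2 + y * I : ℂ) ≠ 0 := fun h ↦ by simpa using congrArg re h
    have e1 : (2 + y * I : ℂ) + 1 ≠ 0 := fun h ↦ by
      have := congrArg re h; norm_num at this
    have e2 : (2 + y * I : ℂ) - 1 ≠ 0 := fun h ↦ by
      have := congrArg re h; norm_num at this
    refine ⟨h.1, h.2.trans ?_⟩
    push_cast
    rw [add_zero, ← sub_eq_add_neg, smul_eq_mul, smul_eq_mul]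
    field_simp
    ring
  · refine (differentiableOn_inv_mul_inv.mono fun s hs ↦ ?_).mul ?_
    · have : 1 < s.re := hs
      show 1 / 2 < s.re
      linarith
    · intro s hs
      have hs' : 1 < s.re := hs
      have : s - 1 ≠ 0 := fun h ↦ by
        have := congrArg re h; simp at this; linarith
      have hd : DifferentiableAt ℂ (fun s : ℂ ↦ s - 1) s := by fun_prop
      exact ((differentiableAt_const (1 : ℂ)).fun_div hd this).differentiableWithinAt
  · intro y
    have := norm_inv_mul_inv_le (s := 2 + y * I) (by simp; norm_num)
    have h2 : ‖1 / (2 + y * I - 1)‖ ≤ 1 := by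
      rw [norm_div, norm_one]
      have : (1 : ℝ) ≤ ‖(2 + y * I - 1 : ℂ)‖ := by
        refine le_trans ?_ (abs_re_le_norm _)
        norm_num
      exact div_le_one_of_le₀ this (norm_nonneg _)
    rw [norm_mul]
    refine (mul_le_of_le_one_right (norm_nonneg _) h2).trans (this.trans ?_)
    simp only [add_im, mul_im, ofReal_re, I_im, mul_one, ofReal_im, I_re, mul_zero, add_zero,
      im_ofNat, zero_add]
    gcongr
    · linarith [abs_nonneg y]
    · norm_num
  · intro t ht
    rw [indicator_Ioc_cpow ht, indicator_Ioc_cpow ht, indicator_Ioc_cpow ht, smul_eq_mul,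
      smul_eq_mul]
    split_ifs with h
    · rw [max_eq_right (by linarith), Real.rpow_neg_one, Real.rpow_one, Real.rpow_zero]
      push_cast
      have : (t : ℂ) ≠ 0 := ofReal_ne_zero.mpr ht.ne'
      field_simp
      ring
    · rw [max_eq_left (by linarith)]; simp
  · intro t ht
    have : 2 * t ≠ 0 := by positivity
    fun_prop (disch := assumption)

lemma natCast_div_cpow_neg {m n : ℕ} (hm : m ≠ 0) (hn : n ≠ 0) (s : ℂ) :
    (((m : ℝ) / n : ℝ) : ℂ) ^ (-s) = (n : ℂ) ^ s / (m : ℂ) ^ s := by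
  have h : (((m : ℝ) / n : ℝ) : ℂ) = ((m : ℝ) : ℂ) * (((n : ℝ)⁻¹ : ℝ) : ℂ) := by
    push_cast; rw [div_eq_mul_inv]
  rw [h, mul_cpow_ofReal_nonneg (by positivity) (by positivity), cpow_neg]
  have h2 : (((n : ℝ)⁻¹ : ℝ) : ℂ) ^ (-s) = (n : ℂ) ^ s := by
    rw [ofReal_inv, ofReal_natCast, inv_cpow _ _ (by simp [natCast_arg, Real.pi_pos.ne]),
      cpow_neg, inv_inv]
  rw [h2, ofReal_natCast, div_eq_inv_mul]

lemma integrable_kernel_vertical_two :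
    Integrable fun y : ℝ ↦ (2 + y * I : ℂ)⁻¹ * ((2 + y * I) + 1)⁻¹ := by
  have := integrable_vertical_of_norm_le (a := 2) (C := 9) (by norm_num)
    differentiableOn_inv_mul_inv fun y ↦ by
      have := norm_inv_mul_inv_le (s := (2 : ℝ) + y * I) (by simp; norm_num)
      refine this.trans ?_
      simp only [add_im, mul_im, ofReal_re, I_im, mul_one, ofReal_im, I_re, mul_zero, add_zero,
        zero_add]
      gcongr
      · linarith [abs_nonneg y]
      · norm_num
  simpa using this

lemma hasSum_integral_term_vonMangoldt {N : ℕ} (hN : N ≠ 0) :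
    HasSum (fun n : ℕ ↦ 2 * Real.pi *
        ((ArithmeticFunction.vonMangoldt n * max 0 ((N : ℝ) - n) : ℝ) : ℂ))
      (∫ y : ℝ, (N : ℂ) ^ ((2 + y * I) + 1) * ((2 + y * I)⁻¹ * ((2 + y * I) + 1)⁻¹) *
        LSeries (fun n ↦ (ArithmeticFunction.vonMangoldt n : ℂ)) (2 + y * I)) := by
  set K : ℝ → ℂ := fun y ↦ (2 + y * I)⁻¹ * ((2 + y * I) + 1)⁻¹ with hK
  set L : ℕ → ℂ := fun n ↦ (ArithmeticFunction.vonMangoldt n : ℂ) with hL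
  have hN0 : (N : ℂ) ≠ 0 := Nat.cast_ne_zero.mpr hN
  have hterm (n : ℕ) (y : ℝ) : (N : ℂ) ^ ((2 + y * I) + 1) * K y * LSeries.term L (2 + y * I) n =
      (N * L n : ℂ) * (((((n : ℝ) / N : ℝ) : ℂ) ^ (-(2 + y * I))) * K y) := by
    rcases eq_or_ne n 0 with rfl | hn
    · simp [hL]
    · rw [natCast_div_cpow_neg hn hN, LSeries.term_of_ne_zero hn, cpow_add _ _ hN0, cpow_one]
      ring
  have hnorm (n : ℕ) (y : ℝ) : ‖(N : ℂ) ^ ((2 + y * I) + 1) * K y *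
      LSeries.term L (2 + y * I) n‖ = (N : ℝ) ^ (3 : ℝ) * ‖LSeries.term L 2 n‖ * ‖K y‖ := by
    rw [norm_mul, norm_mul, norm_natCast_cpow_of_pos (Nat.pos_of_ne_zero hN), LSeries.norm_term_eq,
      LSeries.norm_term_eq]
    have h1 : (2 + y * I + 1 : ℂ).re = 3 := by norm_num
    have h2 : (2 + y * I : ℂ).re = (2 : ℂ).re := by simp
    rw [h1, h2]
    ring
  have hcont (n : ℕ) : Continuous fun y : ℝ ↦
      (N : ℂ) ^ ((2 + y * I) + 1) * LSeries.term L (2 + y * I) n := by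
    rcases eq_or_ne n 0 with rfl | hn
    · simp [continuous_const]
    · simp only [LSeries.term_of_ne_zero hn]
      have hn0 : (n : ℂ) ≠ 0 := Nat.cast_ne_zero.mpr hn
      refine Continuous.mul ?_ (continuous_const.div ?_ fun y ↦ by simp [cpow_eq_zero_iff, hn])
      · exact Continuous.const_cpow (by fun_prop) (Or.inl hN0)
      · exact Continuous.const_cpow (by fun_prop) (Or.inl hn0)
  have hint (n : ℕ) : Integrable fun y : ℝ ↦
      (N : ℂ) ^ ((2 + y * I) + 1) * K y * LSeries.term L (2 + y * I) n := by
    have hKi : Integrable K := integrable_kernel_vertical_two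
    refine (hKi.norm.const_mul ((N : ℝ) ^ (3 : ℝ) * ‖LSeries.term L 2 n‖)).mono' ?_
      (Eventually.of_forall fun y ↦ (hnorm n y).le)
    refine ((hcont n).aestronglyMeasurable.mul hKi.aestronglyMeasurable).congr
      (Eventually.of_forall fun y ↦ ?_)
    show _ * LSeries.term L (2 + y * I) n * K y = _ * K y * LSeries.term L (2 + y * I) n
    ring
  have hsum : Summable fun n ↦ ∫ y : ℝ,
      ‖(N : ℂ) ^ ((2 + y * I) + 1) * K y * LSeries.term L (2 + y * I) n‖ := by
    simp only [hnorm, integral_const_mul]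
    have : LSeriesSummable L 2 := ArithmeticFunction.LSeriesSummable_vonMangoldt (by simp)
    exact (this.norm.mul_left _).mul_right _
  have key := hasSum_integral_of_summable_integral_norm hint hsum
  simp only [tsum_mul_left] at key
  have hval (n : ℕ) : 2 * Real.pi *
        ((ArithmeticFunction.vonMangoldt n * max 0 ((N : ℝ) - n) : ℝ) : ℂ) =
      ∫ y : ℝ, (N : ℂ) ^ ((2 + y * I) + 1) * K y * LSeries.term L (2 + y * I) n := by
    simp only [hterm, integral_const_mul]
    rcases eq_or_ne n 0 with rfl | hn
    · simp [hL]
    rw [hK, integral_natCast_div_cpow_kernel (by positivity)]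
    have hNr : (0 : ℝ) < N := by positivity
    have : max 0 ((N : ℝ) - n) = N * max 0 (1 - (n : ℝ) / N) := by
      rw [mul_max_of_nonneg _ _ hNr.le, mul_zero, mul_sub, mul_one, mul_div_cancel₀ _ hNr.ne']
    rw [this, hL]
    push_cast
    ring
  rw [funext hval]
  exact key

/-- The integrand in Perron's formula for the second-order summatory function of `Λ`,
with the pole of `-ζ'/ζ` at `1` removed. -/
noncomputable def perronIntegrand (N : ℕ) (s : ℂ) : ℂ :=
  (N : ℂ) ^ (s + 1) * (s⁻¹ * (s + 1)⁻¹) * logDeriv poleFreeZeta s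

lemma differentiableOn_perronIntegrand (hRH : RiemannHypothesis) {N : ℕ} (hN : N ≠ 0) :
    DifferentiableOn ℂ (perronIntegrand N) {s | 1 / 2 < s.re} := by
  refine DifferentiableOn.mul (DifferentiableOn.mul ?_ differentiableOn_inv_mul_inv) ?_
  · intro s _
    exact (DifferentiableAt.const_cpow (by fun_prop)
      (Or.inl (Nat.cast_ne_zero.mpr hN))).differentiableWithinAt
  · intro s hs
    have h1 : DifferentiableAt ℂ (deriv poleFreeZeta) s :=
      (differentiable_poleFreeZeta.contDiff (n := 2)).differentiable_deriv_two s
    exact (h1.div (differentiable_poleFreeZeta s)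
      (poleFreeZeta_ne_zero hRH hs)).differentiableWithinAt

lemma norm_perronIntegrand_le (hRH : RiemannHypothesis) {N : ℕ} (hN : N ≠ 0) {δ : ℝ} (hδ : 0 < δ)
    {s : ℂ} (h1 : 1 / 2 + δ ≤ s.re) (h2 : s.re ≤ 2) :
    ‖perronIntegrand N s‖ ≤
      (N : ℝ) ^ (3 : ℝ) * 9 * (72 / δ ^ 2 * 6) * (1 + |s.im|) ^ (-(3 / 2) : ℝ) := by
  have h3 := norm_inv_mul_inv_le (s := s) (by linarith)
  have h4 := norm_logDeriv_poleFreeZeta_le hRH hδ h1 h2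
  have h5 := log_three_add_le (η := 1 / 2) (by norm_num) (by norm_num) s.im
  have hN1 : (1 : ℝ) ≤ N := by exact_mod_cast Nat.one_le_iff_ne_zero.mpr hN
  rw [perronIntegrand, norm_mul, norm_mul, norm_natCast_cpow_of_pos (Nat.pos_of_ne_zero hN)]
  have hp : (0 : ℝ) < 1 + |s.im| := by positivity
  calc _ ≤ (N : ℝ) ^ (3 : ℝ) * (9 * (1 + |s.im|) ^ (-2 : ℝ)) *
        (72 / δ ^ 2 * (3 / (1 / 2) * (1 + |s.im|) ^ (1 / 2 : ℝ))) := by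
        gcongr
        · simp; linarith
        · exact h4.trans (by gcongr)
    _ = (N : ℝ) ^ (3 : ℝ) * 9 * (72 / δ ^ 2 * 6) *
        ((1 + |s.im|) ^ (-2 : ℝ) * (1 + |s.im|) ^ (1 / 2 : ℝ)) := by ring
    _ = _ := by rw [← Real.rpow_add hp]; norm_num

lemma integrable_perronIntegrand (hRH : RiemannHypothesis) {N : ℕ} (hN : N ≠ 0) {a : ℝ}
    (ha : 1 / 2 < a) (ha2 : a ≤ 2) : Integrable fun y : ℝ ↦ perronIntegrand N (a + y * I) :=
  integrable_vertical_of_norm_le ha (differentiableOn_perronIntegrand hRH hN) fun y ↦ by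
    simpa using norm_perronIntegrand_le hRH hN (s := a + y * I) (δ := a - 1 / 2) (by linarith)
      (by simp) (by simpa using ha2)

lemma integral_perronIntegrand_two (hRH : RiemannHypothesis) {N : ℕ} (hN : N ≠ 0) :
    ∫ y : ℝ, perronIntegrand N (2 + y * I) = 2 * Real.pi * (((N - 1 : ℝ) ^ 2 / 2 -
      ∑ n ∈ Finset.range N, ArithmeticFunction.vonMangoldt n * ((N : ℝ) - n) : ℝ) : ℂ) := by
  have hN0 : (N : ℂ) ≠ 0 := Nat.cast_ne_zero.mpr hN
  have hN1 : (1 : ℝ) ≤ N := by exact_mod_cast Nat.one_le_iff_ne_zero.mpr hN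
  set f1 : ℝ → ℂ := fun y ↦ (N : ℂ) ^ ((2 + y * I) + 1) *
    ((2 + y * I)⁻¹ * ((2 + y * I) + 1)⁻¹) * (1 / (2 + y * I - 1)) with hf1
  set f2 : ℝ → ℂ := fun y ↦ (N : ℂ) ^ ((2 + y * I) + 1) *
    ((2 + y * I)⁻¹ * ((2 + y * I) + 1)⁻¹) *
    LSeries (fun n ↦ (ArithmeticFunction.vonMangoldt n : ℂ)) (2 + y * I) with hf2
  have hsub (y : ℝ) : f1 y - f2 y = perronIntegrand N (2 + y * I) := by
    rw [perronIntegrand, logDeriv_poleFreeZeta (by simp), hf1, hf2]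
    ring
  have hi1 : Integrable f1 := by
    refine (integrable_kernel_vertical_two.norm.const_mul ((N : ℝ) ^ (3 : ℝ))).mono' ?_ ?_
    · have e1 : Continuous fun y : ℝ ↦ (N : ℂ) ^ ((2 + y * I) + 1 : ℂ) :=
        Continuous.const_cpow (by fun_prop) (Or.inl hN0)
      have e2 : Continuous fun y : ℝ ↦ 1 / (2 + y * I - 1 : ℂ) :=
        continuous_const.div (by fun_prop) fun y h ↦ by
          have := congrArg re h; norm_num at this
      exact (e1.aestronglyMeasurable.mul
        integrable_kernel_vertical_two.aestronglyMeasurable).mul e2.aestronglyMeasurable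
    · refine Eventually.of_forall fun y ↦ ?_
      have h2 : ‖1 / (2 + y * I - 1 : ℂ)‖ ≤ 1 := by
        rw [norm_div, norm_one]
        have : (1 : ℝ) ≤ ‖(2 + y * I - 1 : ℂ)‖ := by
          refine le_trans ?_ (abs_re_le_norm _)
          norm_num
        exact div_le_one_of_le₀ this (norm_nonneg _)
      have hre : (2 + y * I + 1 : ℂ).re = 3 := by norm_num
      rw [hf1, norm_mul, norm_mul, norm_natCast_cpow_of_pos (Nat.pos_of_ne_zero hN), hre]
      exact mul_le_of_le_one_right (by positivity) h2
  have hi0 : Integrable fun y : ℝ ↦ perronIntegrand N (2 + y * I) := by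
    simpa using integrable_perronIntegrand hRH hN (a := 2) (by norm_num) le_rfl
  have hi2 : Integrable f2 := by
    refine (hi1.sub hi0).congr
      (Eventually.of_forall fun y ↦ ?_)
    show f1 y - perronIntegrand N (2 + y * I) = f2 y
    rw [← hsub]; ring
  have hv1 : ∫ y, f1 y = 2 * Real.pi * (((N - 1 : ℝ) ^ 2 / 2 : ℝ) : ℂ) := by
    have h := integral_cpow_kernel_pole (u := ((1 : ℕ) : ℝ) / N) (by positivity)
    simp only [natCast_div_cpow_neg one_ne_zero hN] at h
    have h3 : max 0 (1 - ((1 : ℕ) : ℝ) / N) = 1 - 1 / N := by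
      rw [Nat.cast_one]
      refine max_eq_right (sub_nonneg.mpr ?_)
      exact div_le_one_of_le₀ hN1 (by positivity)
    have h4 (y : ℝ) : f1 y = N * ((N : ℂ) ^ (2 + y * I : ℂ) / ((1 : ℕ) : ℂ) ^ (2 + y * I : ℂ) *
        ((2 + y * I)⁻¹ * ((2 + y * I) + 1)⁻¹ * (1 / (2 + y * I - 1)))) := by
      simp only [hf1]
      rw [Nat.cast_one, one_cpow, div_one, cpow_add _ _ hN0, cpow_one]
      ring
    simp only [h4, integral_const_mul]
    rw [h, h3]
    push_cast
    field_simp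
  have hv2 : ∫ y, f2 y = 2 * Real.pi * ((∑ n ∈ Finset.range N,
      ArithmeticFunction.vonMangoldt n * ((N : ℝ) - n) : ℝ) : ℂ) := by
    refine (hasSum_integral_term_vonMangoldt hN).unique ?_
    have : HasSum (fun n : ℕ ↦ 2 * Real.pi *
        ((ArithmeticFunction.vonMangoldt n * max 0 ((N : ℝ) - n) : ℝ) : ℂ))
        (∑ n ∈ Finset.range N, 2 * Real.pi *
          ((ArithmeticFunction.vonMangoldt n * max 0 ((N : ℝ) - n) : ℝ) : ℂ)) := by
      refine hasSum_sum_of_ne_finset_zero fun n hn ↦ ?_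
      have : (N : ℝ) ≤ n := by simpa using hn
      rw [max_eq_left (by linarith)]
      simp
    convert this using 1
    rw [ofReal_sum, Finset.mul_sum]
    refine Finset.sum_congr rfl fun n hn ↦ ?_
    have : (n : ℝ) < N := by simpa using hn
    rw [max_eq_right (by linarith)]
  simp only [← hsub]
  rw [integral_sub hi1 hi2, hv1, hv2]
  push_cast
  ring

lemma integral_perronIntegrand_succ_sub (hRH : RiemannHypothesis) {N : ℕ} (hN : N ≠ 0) {a : ℝ}
    (ha : 1 / 2 < a) (ha2 : a ≤ 2) :
    ∫ y : ℝ, (perronIntegrand (N + 1) (a + y * I) - perronIntegrand N (a + y * I)) =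
      2 * Real.pi * ((N - 1 / 2 - Chebyshev.psi N : ℝ) : ℂ) := by
  have shift {M : ℕ} (hM : M ≠ 0) : ∫ y : ℝ, perronIntegrand M (a + y * I) =
      ∫ y : ℝ, perronIntegrand M (2 + y * I) := by
    have := integral_vertical_eq_of_norm_le ha ha2 (differentiableOn_perronIntegrand hRH hM)
      fun s h1 h2 ↦ norm_perronIntegrand_le hRH hM (δ := a - 1 / 2) (by linarith)
        (by linarith) h2
    simpa using this
  rw [integral_sub (integrable_perronIntegrand hRH N.succ_ne_zero ha ha2)
    (integrable_perronIntegrand hRH hN ha ha2), shift N.succ_ne_zero, shift hN,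
    integral_perronIntegrand_two hRH N.succ_ne_zero, integral_perronIntegrand_two hRH hN,
    ← mul_sub, ← ofReal_sub]
  congr 2
  have hpsi : Chebyshev.psi N = ∑ n ∈ Finset.range (N + 1), ArithmeticFunction.vonMangoldt n := by
    rw [Chebyshev.psi_eq_sum_Icc, Nat.floor_natCast, ← Nat.range_succ_eq_Icc_zero]
  rw [hpsi, Finset.sum_range_succ, Finset.sum_range_succ]
  have : ∑ n ∈ Finset.range N, ArithmeticFunction.vonMangoldt n * (((N + 1 : ℕ) : ℝ) - n) =
      ∑ n ∈ Finset.range N, ArithmeticFunction.vonMangoldt n * ((N : ℝ) - n) +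
      ∑ n ∈ Finset.range N, ArithmeticFunction.vonMangoldt n := by
    rw [← Finset.sum_add_distrib]
    refine Finset.sum_congr rfl fun n _ ↦ ?_
    push_cast
    ring
  rw [this]
  push_cast
  ring

lemma norm_succ_cpow_sub_le {N : ℕ} (hN : N ≠ 0) {w : ℂ} (hw : 1 ≤ w.re) :
    ‖((N + 1 : ℕ) : ℂ) ^ w - (N : ℂ) ^ w‖ ≤ ‖w‖ * ((N : ℝ) + 1) ^ (w.re - 1) := by
  have hN0 : (0 : ℝ) < N := by positivity
  have hw0 : w ≠ 0 := by rintro rfl; norm_num at hw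
  have h := Convex.norm_image_sub_le_of_norm_hasDerivWithin_le (f := fun t : ℝ ↦ (t : ℂ) ^ w)
    (f' := fun t : ℝ ↦ w * (t : ℂ) ^ (w - 1)) (s := Icc (N : ℝ) (N + 1)) (x := N) (y := N + 1)
    (C := ‖w‖ * ((N : ℝ) + 1) ^ (w.re - 1)) ?_ ?_ (convex_Icc _ _) ?_ ?_
  · simpa using h
  · intro t ht
    have ht0 : 0 < t := hN0.trans_le ht.1
    exact (hasDerivAt_ofReal_cpow_const ht0.ne' hw0).hasDerivWithinAt
  · intro t ht
    have ht0 : 0 < t := hN0.trans_le ht.1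
    rw [norm_mul, norm_cpow_eq_rpow_re_of_pos ht0, sub_re, one_re]
    gcongr
    exact ht.2
  · simp
  · simp

lemma norm_succ_cpow_sub_le_two_mul {N : ℕ} (hN : N ≠ 0) {w : ℂ} (hw : 0 ≤ w.re) :
    ‖((N + 1 : ℕ) : ℂ) ^ w - (N : ℂ) ^ w‖ ≤ 2 * ((N : ℝ) + 1) ^ w.re := by
  refine (norm_sub_le _ _).trans ?_
  rw [norm_natCast_cpow_of_pos N.succ_pos, norm_natCast_cpow_of_pos (Nat.pos_of_ne_zero hN)]
  have : (N : ℝ) ^ w.re ≤ ((N : ℝ) + 1) ^ w.re := by gcongr; linarith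
  push_cast
  linarith

lemma norm_succ_cpow_sub_le_interp {N : ℕ} (hN : N ≠ 0) {w : ℂ} (hw : 1 ≤ w.re) {δ : ℝ}
    (hδ : 0 ≤ δ) (hδ1 : δ ≤ 1) :
    ‖((N + 1 : ℕ) : ℂ) ^ w - (N : ℂ) ^ w‖ ≤ 2 * ‖w‖ ^ (1 - δ) * ((N : ℝ) + 1) ^ (w.re - 1 + δ) := by
  have h1 := norm_succ_cpow_sub_le hN hw
  have h2 := norm_succ_cpow_sub_le_two_mul hN (zero_le_one.trans hw)
  set X := ‖((N + 1 : ℕ) : ℂ) ^ w - (N : ℂ) ^ w‖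
  have hX : 0 ≤ X := norm_nonneg _
  have hp : (0 : ℝ) < N + 1 := by positivity
  calc X = X ^ (1 - δ) * X ^ δ := by
        rw [← Real.rpow_add_of_nonneg hX (by linarith) hδ]; simp
    _ ≤ (‖w‖ * ((N : ℝ) + 1) ^ (w.re - 1)) ^ (1 - δ) * (2 * ((N : ℝ) + 1) ^ w.re) ^ δ := by
        gcongr
    _ = 2 ^ δ * ‖w‖ ^ (1 - δ) *
        (((N : ℝ) + 1) ^ ((w.re - 1) * (1 - δ)) * ((N : ℝ) + 1) ^ (w.re * δ)) := by
        rw [Real.mul_rpow (norm_nonneg _) (by positivity), Real.mul_rpow (by norm_num)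
          (by positivity), ← Real.rpow_mul hp.le, ← Real.rpow_mul hp.le]
        ring
    _ = 2 ^ δ * ‖w‖ ^ (1 - δ) * ((N : ℝ) + 1) ^ (w.re - 1 + δ) := by
        rw [← Real.rpow_add hp]; ring_nf
    _ ≤ _ := by
        gcongr
        calc (2 : ℝ) ^ δ ≤ 2 ^ (1 : ℝ) := by gcongr; norm_num
          _ = 2 := by norm_num

lemma norm_perronIntegrand_succ_sub_le (hRH : RiemannHypothesis) {N : ℕ} (hN : N ≠ 0) {δ : ℝ}
    (hδ : 0 < δ) (hδ1 : δ ≤ 1) (y : ℝ) :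
    ‖perronIntegrand (N + 1) ((1 / 2 + δ : ℝ) + y * I) -
      perronIntegrand N ((1 / 2 + δ : ℝ) + y * I)‖ ≤
    (7776 / δ ^ 3 * ((N : ℝ) + 1) ^ (1 / 2 + 2 * δ)) * (1 + ‖y‖) ^ (-(1 + δ / 2)) := by
  set s : ℂ := (1 / 2 + δ : ℝ) + y * I with hs
  have hre : s.re = 1 / 2 + δ := by simp [hs]
  have him : s.im = y := by simp [hs]
  have hp : (0 : ℝ) < 1 + |y| := by positivity
  have h1 := norm_succ_cpow_sub_le_interp hN (w := s + 1) (by simp [hre]; linarith) hδ.le hδ1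
  have hre1 : (s + 1).re - 1 + δ = 1 / 2 + 2 * δ := by simp [hre]; ring
  rw [hre1] at h1
  have h2 := norm_logDeriv_poleFreeZeta_le hRH hδ hre.ge (by rw [hre]; linarith)
  have h3 := log_three_add_le (η := δ / 2) (by linarith) (by linarith) y
  rw [him] at h2
  have h4 := inv_norm_le (s := s) (by rw [hre]; linarith)
  have h5 := inv_norm_le (s := s + 1) (by simp [hre]; linarith)
  rw [him] at h4
  simp only [add_im, one_im, add_zero, him] at h5
  have hw : 0 < ‖s + 1‖ := norm_pos_iff.mpr fun h ↦ by
    have := congrArg re h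
    simp [hre] at this
    linarith
  have h6 : ‖s + 1‖ ^ (1 - δ) * ‖s + 1‖⁻¹ ≤ 3 * (1 + |y|) ^ (-δ) := by
    calc ‖s + 1‖ ^ (1 - δ) * ‖s + 1‖⁻¹ = (‖s + 1‖⁻¹) ^ δ := by
          rw [← Real.rpow_neg_one, ← Real.rpow_add hw, ← Real.rpow_mul hw.le]; ring_nf
      _ ≤ (3 * (1 + |y|)⁻¹) ^ δ := by gcongr
      _ = 3 ^ δ * (1 + |y|) ^ (-δ) := by
          rw [Real.mul_rpow (by norm_num) (by positivity), Real.inv_rpow hp.le,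
            Real.rpow_neg hp.le]
      _ ≤ 3 ^ (1 : ℝ) * (1 + |y|) ^ (-δ) := by gcongr; norm_num
      _ = _ := by rw [Real.rpow_one]
  have heq : perronIntegrand (N + 1) s - perronIntegrand N s =
      (((N + 1 : ℕ) : ℂ) ^ (s + 1) - (N : ℂ) ^ (s + 1)) * (s⁻¹ * (s + 1)⁻¹) *
        logDeriv poleFreeZeta s := by
    simp only [perronIntegrand]; ring
  rw [heq, norm_mul, norm_mul, norm_mul, norm_inv, norm_inv, Real.norm_eq_abs]
  calc _ ≤ (2 * ‖s + 1‖ ^ (1 - δ) * ((N : ℝ) + 1) ^ (1 / 2 + 2 * δ)) *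
        (3 * (1 + |y|)⁻¹ * ‖s + 1‖⁻¹) *
        (72 / δ ^ 2 * (3 / (δ / 2) * (1 + |y|) ^ (δ / 2))) := by
        gcongr
        exact h2.trans (by gcongr)
    _ = (2592 / δ ^ 3 * ((N : ℝ) + 1) ^ (1 / 2 + 2 * δ)) *
        ((1 + |y|)⁻¹ * (1 + |y|) ^ (δ / 2)) * (‖s + 1‖ ^ (1 - δ) * ‖s + 1‖⁻¹) := by
        field_simp
        ring
    _ ≤ (2592 / δ ^ 3 * ((N : ℝ) + 1) ^ (1 / 2 + 2 * δ)) *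
        ((1 + |y|)⁻¹ * (1 + |y|) ^ (δ / 2)) * (3 * (1 + |y|) ^ (-δ)) := by gcongr
    _ = (7776 / δ ^ 3 * ((N : ℝ) + 1) ^ (1 / 2 + 2 * δ)) *
        ((1 + |y|) ^ (-1 : ℝ) * (1 + |y|) ^ (δ / 2) * (1 + |y|) ^ (-δ)) := by
        rw [Real.rpow_neg_one]; ring
    _ = _ := by
        rw [← Real.rpow_add hp, ← Real.rpow_add hp]; ring_nf

/-- Under RH, `ψ(x) = x + O(x^{1/2 + 2δ})`. -/
lemma exists_abs_psi_sub_le (hRH : RiemannHypothesis) {δ : ℝ} (hδ : 0 < δ) (hδ1 : δ ≤ 1) :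
    ∃ C : ℝ, 0 ≤ C ∧ ∀ x : ℝ, 1 ≤ x → |Chebyshev.psi x - x| ≤ C * x ^ (1 / 2 + 2 * δ) := by
  have hint : Integrable fun y : ℝ ↦ (1 + ‖y‖) ^ (-(1 + δ / 2)) :=
    integrable_one_add_norm (by simp; linarith)
  set J : ℝ := ∫ y : ℝ, (1 + ‖y‖) ^ (-(1 + δ / 2)) with hJ
  have hJ0 : 0 ≤ J := integral_nonneg fun y ↦ by positivity
  set D : ℝ := 7776 / δ ^ 3 * J with hD
  have hD0 : 0 ≤ D := by positivity
  have hnat (N : ℕ) (hN : N ≠ 0) :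
      |(N : ℝ) - 1 / 2 - Chebyshev.psi N| ≤ D * ((N : ℝ) + 1) ^ (1 / 2 + 2 * δ) := by
    have h := integral_perronIntegrand_succ_sub hRH hN (a := 1 / 2 + δ) (by linarith) (by linarith)
    have h2 := norm_integral_le_of_norm_le (hint.const_mul _)
      (Eventually.of_forall (norm_perronIntegrand_succ_sub_le hRH hN hδ hδ1))
    rw [h, integral_const_mul, norm_mul, norm_real, Real.norm_eq_abs] at h2
    have h3 : (1 : ℝ) ≤ ‖(2 * Real.pi : ℂ)‖ := by
      rw [norm_mul, norm_real, Real.norm_eq_abs, abs_of_pos Real.pi_pos]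
      norm_num
      linarith [Real.pi_gt_three]
    calc _ ≤ ‖(2 * Real.pi : ℂ)‖ * |(N : ℝ) - 1 / 2 - Chebyshev.psi N| :=
          le_mul_of_one_le_left (abs_nonneg _) h3
      _ ≤ _ := h2
      _ = _ := by rw [hD]; ring
  refine ⟨D * 8 + 2, by positivity, fun x hx ↦ ?_⟩
  have hx0 : 0 ≤ x := by linarith
  have hfl := Nat.floor_le hx0
  have hfl2 := Nat.lt_floor_add_one x
  have hN : ⌊x⌋₊ ≠ 0 := (Nat.floor_pos.mpr hx).ne'
  have h1 := hnat _ hN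
  rw [← Chebyshev.psi_eq_psi_coe_floor] at h1
  have h2 : ((⌊x⌋₊ : ℝ) + 1) ^ (1 / 2 + 2 * δ) ≤ 8 * x ^ (1 / 2 + 2 * δ) := by
    calc _ ≤ (2 * x) ^ (1 / 2 + 2 * δ) := by gcongr; linarith
      _ = 2 ^ (1 / 2 + 2 * δ) * x ^ (1 / 2 + 2 * δ) := Real.mul_rpow (by norm_num) hx0
      _ ≤ 2 ^ (3 : ℝ) * x ^ (1 / 2 + 2 * δ) := by gcongr <;> linarith
      _ = _ := by norm_num
  have h3 : 1 ≤ x ^ (1 / 2 + 2 * δ) := Real.one_le_rpow hx (by linarith)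
  have h4 := mul_le_mul_of_nonneg_left h2 hD0
  rw [abs_le] at h1 ⊢
  constructor <;> nlinarith [h1.1, h1.2]

lemma theta_le_sum_vonMangoldt_sq_div_log (x : ℝ) :
    Chebyshev.theta x ≤
      ∑ k ∈ Finset.Icc 0 ⌊x⌋₊, ArithmeticFunction.vonMangoldt k ^ 2 / Real.log k := by
  rw [Chebyshev.theta_eq_sum_Icc, Finset.sum_filter]
  refine Finset.sum_le_sum fun k _ ↦ ?_
  split_ifs with h
  · rw [ArithmeticFunction.vonMangoldt_apply_prime h, sq, mul_self_div_self]
  · have := Real.log_natCast_nonneg k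
    positivity

lemma sum_vonMangoldt_sq_div_log_le_psi (x : ℝ) :
    ∑ k ∈ Finset.Icc 0 ⌊x⌋₊, ArithmeticFunction.vonMangoldt k ^ 2 / Real.log k ≤
      Chebyshev.psi x := by
  rw [Chebyshev.psi_eq_sum_Icc]
  refine Finset.sum_le_sum fun k _ ↦ ?_
  have h0 : 0 ≤ ArithmeticFunction.vonMangoldt k := ArithmeticFunction.vonMangoldt_nonneg
  have h1 : ArithmeticFunction.vonMangoldt k ≤ Real.log k := ArithmeticFunction.vonMangoldt_le_log
  refine div_le_of_le_mul₀ (h0.trans h1) h0 ?_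
  rw [sq]
  gcongr

lemma exists_abs_sum_vonMangoldt_sq_div_log_sub_le (hRH : RiemannHypothesis) {δ : ℝ} (hδ : 0 < δ)
    (hδ1 : δ ≤ 1) : ∃ C : ℝ, 0 ≤ C ∧ ∀ x : ℝ, 1 ≤ x →
      |(∑ k ∈ Finset.Icc 0 ⌊x⌋₊, ArithmeticFunction.vonMangoldt k ^ 2 / Real.log k) - x| ≤
        C * x ^ (1 / 2 + 2 * δ) := by
  obtain ⟨C, hC, h⟩ := exists_abs_psi_sub_le hRH hδ hδ1
  refine ⟨C + 1 / δ, by positivity, fun x hx ↦ ?_⟩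
  have hx0 : 0 < x := by linarith
  have h1 := abs_le.mp (h x hx)
  have h2 := theta_le_sum_vonMangoldt_sq_div_log x
  have h3 := sum_vonMangoldt_sq_div_log_le_psi x
  have h4 := Chebyshev.psi_sub_theta_le hx
  have h5 : 2 * √x * Real.log x ≤ 1 / δ * x ^ (1 / 2 + 2 * δ) := by
    have := Real.log_le_rpow_div hx0.le (by positivity : 0 < 2 * δ)
    calc _ ≤ 2 * x ^ (1 / 2 : ℝ) * (x ^ (2 * δ) / (2 * δ)) := by
          rw [Real.sqrt_eq_rpow]; gcongr
      _ = _ := by rw [Real.rpow_add hx0]; field_simp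
  rw [abs_le, add_mul]
  have h6 : 0 ≤ 1 / δ * x ^ (1 / 2 + 2 * δ) := by positivity
  constructor <;> linarith [h1.1, h1.2]

lemma hasDerivAt_log_div_cube {t : ℝ} (ht : 0 < t) :
    HasDerivAt (fun t : ℝ ↦ Real.log t / t ^ 3) ((1 - 3 * Real.log t) / t ^ 4) t := by
  convert! (Real.hasDerivAt_log ht.ne').div (hasDerivAt_pow 3 t) (by positivity) using 1
  field_simp
  push_cast
  ring

lemma hasDerivAt_log_div_sq {t : ℝ} (ht : 0 < t) :
    HasDerivAt (fun t : ℝ ↦ -(1 / 2 * Real.log t / t ^ 2 + 1 / 4 / t ^ 2))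
      (Real.log t / t ^ 3) t := by
  convert! ((((Real.hasDerivAt_log ht.ne').const_mul (1 / 2)).div (hasDerivAt_pow 2 t)
    (by positivity)).add ((hasDerivAt_const t (1 / 4 : ℝ)).div (hasDerivAt_pow 2 t)
    (by positivity))).neg using 1
  field_simp
  push_cast
  ring

lemma abs_one_sub_three_mul_log_le {δ t : ℝ} (hδ : 0 < δ) (ht : 1 ≤ t) :
    |1 - 3 * Real.log t| ≤ (1 + 3 / δ) * t ^ δ := by
  have h0 := Real.log_nonneg ht
  have h1 := Real.log_le_rpow_div (by linarith : 0 ≤ t) hδ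
  have h2 : 1 ≤ t ^ δ := Real.one_le_rpow ht hδ.le
  have h3 : (1 + 3 / δ) * t ^ δ = t ^ δ + 3 * (t ^ δ / δ) := by ring
  rw [abs_le, h3]
  constructor <;> linarith

/-- Partial summation of `log t / t ^ 3` against a sequence whose summatory function is close to
the identity. -/
lemma abs_sum_mul_log_div_cube_sub_le {c : ℕ → ℝ} {δ A : ℝ} (hδ : 0 < δ) (hδ1 : δ ≤ 1 / 4)
    (hA : 0 ≤ A)
    (hc : ∀ x : ℝ, 1 ≤ x → |(∑ k ∈ Finset.Icc 0 ⌊x⌋₊, c k) - x| ≤ A * x ^ (1 / 2 + 2 * δ))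
    {a b : ℝ} (ha : 1 ≤ a) (hab : a ≤ b) :
    |(∑ k ∈ Finset.Ioc ⌊a⌋₊ ⌊b⌋₊, Real.log k / (k : ℝ) ^ 3 * c k) -
        (1 / 2 * Real.log a / a ^ 2 + 1 / 4 / a ^ 2)| ≤
      3 * (1 + 3 / δ) * A * a ^ (-(5 / 2) + 3 * δ) + 1 / b := by
  set S : ℝ → ℝ := fun t ↦ ∑ k ∈ Finset.Icc 0 ⌊t⌋₊, c k with hS
  set g : ℝ → ℝ := fun t ↦ Real.log t / t ^ 3 with hg
  set g' : ℝ → ℝ := fun t ↦ (1 - 3 * Real.log t) / t ^ 4 with hg'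
  set G : ℝ → ℝ := fun t ↦ -(1 / 2 * Real.log t / t ^ 2 + 1 / 4 / t ^ 2) with hG
  have hpos {t : ℝ} (ht : t ∈ Icc a b) : 0 < t := by linarith [ht.1]
  have hb0 : 0 < b := by linarith
  have hg'c : ContinuousOn g' (Icc a b) := by
    intro t ht
    have h0 := hpos ht
    have : t ≠ 0 := h0.ne'
    have : t ^ 4 ≠ 0 := by positivity
    exact ContinuousAt.continuousWithinAt (by fun_prop (disch := assumption))
  have hderiv {t : ℝ} (ht : t ∈ Icc a b) : deriv g t = g' t :=
    (hasDerivAt_log_div_cube (hpos ht)).deriv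
  have hg'i : IntegrableOn g' (Icc a b) := hg'c.integrableOn_Icc
  have hdi : IntegrableOn (deriv g) (Icc a b) :=
    hg'i.congr_fun (fun t ht ↦ (hderiv ht).symm) measurableSet_Icc
  have habel := sum_mul_eq_sub_sub_integral_mul c (f := g) (by linarith) hab
    (fun t ht ↦ (hasDerivAt_log_div_cube (hpos ht)).differentiableAt) hdi
  have hSi : IntegrableOn (fun t ↦ g' t * S t) (Icc a b) :=
    integrableOn_mul_sum_Icc c (m := 0) (by linarith) hg'i
  have hti : IntegrableOn (fun t ↦ g' t * t) (Icc a b) :=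
    (hg'c.mul continuousOn_id).integrableOn_Icc
  have hint1 : ∫ t in Ioc a b, deriv g t * S t =
      (∫ t in Ioc a b, g' t * t) + ∫ t in Ioc a b, g' t * (S t - t) := by
    rw [← integral_add (hti.mono_set Ioc_subset_Icc_self)
      (((hSi.sub hti).mono_set Ioc_subset_Icc_self).congr (Eventually.of_forall fun t ↦ by
        show g' t * S t - g' t * t = g' t * (S t - t)
        ring))]
    refine setIntegral_congr_fun measurableSet_Ioc fun t ht ↦ ?_
    show deriv g t * S t = g' t * t + g' t * (S t - t)
    rw [hderiv (Ioc_subset_Icc_self ht)]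
    ring
  have hint2 : ∫ t in Ioc a b, g' t * t = (g b * b - G b) - (g a * a - G a) := by
    rw [← intervalIntegral.integral_of_le hab]
    refine intervalIntegral.integral_eq_sub_of_hasDerivAt (f := fun t ↦ g t * t - G t) ?_ ?_
    · intro t ht
      rw [uIcc_of_le hab] at ht
      have h0 := hpos ht
      convert! ((hasDerivAt_log_div_cube h0).mul (hasDerivAt_id t)).sub
        (hasDerivAt_log_div_sq h0) using 1
      simp [hg']
    · rw [intervalIntegrable_iff_integrableOn_Icc_of_le hab]
      exact hti
  have hlogb {t : ℝ} (ht : t ∈ Icc a b) : |g' t * (S t - t)| ≤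
      (1 + 3 / δ) * A * t ^ (-(7 / 2) + 3 * δ) := by
    have h0 := hpos ht
    have h1 : 1 ≤ t := ha.trans ht.1
    rw [abs_mul, hg', abs_div, abs_of_pos (by positivity : 0 < t ^ 4)]
    calc _ ≤ ((1 + 3 / δ) * t ^ δ) / t ^ 4 * (A * t ^ (1 / 2 + 2 * δ)) := by
          gcongr
          · exact abs_one_sub_three_mul_log_le hδ h1
          · exact hc t h1
      _ = (1 + 3 / δ) * A * (t ^ δ * t ^ (-4 : ℝ) * t ^ (1 / 2 + 2 * δ)) := by
          rw [Real.rpow_neg h0.le, show (4 : ℝ) = (4 : ℕ) by norm_num, Real.rpow_natCast]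
          ring
      _ = _ := by
          rw [← Real.rpow_add h0, ← Real.rpow_add h0]; ring_nf
  have hgE {t : ℝ} (ht : t ∈ Icc a b) : |g t * (S t - t)| ≤
      (1 + 3 / δ) * A * a ^ (-(5 / 2) + 3 * δ) := by
    have h0 := hpos ht
    have h1 : 1 ≤ t := ha.trans ht.1
    have h2 : |Real.log t| ≤ (1 + 3 / δ) * t ^ δ := by
      rw [abs_of_nonneg (Real.log_nonneg h1)]
      refine (Real.log_le_rpow_div h0.le hδ).trans ?_
      rw [div_eq_inv_mul]
      gcongr
      rw [inv_eq_one_div]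
      have : 1 / δ ≤ 3 / δ := by gcongr; norm_num
      linarith
    rw [abs_mul, hg, abs_div, abs_of_pos (by positivity : 0 < t ^ 3)]
    calc _ ≤ ((1 + 3 / δ) * t ^ δ) / t ^ 3 * (A * t ^ (1 / 2 + 2 * δ)) := by
          gcongr
          exact hc t h1
      _ = (1 + 3 / δ) * A * (t ^ δ * t ^ (-3 : ℝ) * t ^ (1 / 2 + 2 * δ)) := by
          rw [Real.rpow_neg h0.le, show (3 : ℝ) = (3 : ℕ) by norm_num, Real.rpow_natCast]
          ring
      _ = (1 + 3 / δ) * A * t ^ (-(5 / 2) + 3 * δ) := by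
          rw [← Real.rpow_add h0, ← Real.rpow_add h0]; ring_nf
      _ ≤ _ := by
          gcongr ?_ * ?_
          exact Real.rpow_le_rpow_of_nonpos (by linarith) ht.1 (by linarith)
  have hint3 : |∫ t in Ioc a b, g' t * (S t - t)| ≤
      (1 + 3 / δ) * A * a ^ (-(5 / 2) + 3 * δ) := by
    have hci : IntegrableOn (fun t : ℝ ↦ (1 + 3 / δ) * A * t ^ (-(7 / 2) + 3 * δ)) (Ioc a b) := by
      refine ((ContinuousOn.integrableOn_Icc fun t ht ↦ ?_).mono_set Ioc_subset_Icc_self)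
      exact (continuousAt_const.mul
        (Real.continuousAt_rpow_const _ _ (Or.inl (hpos ht).ne'))).continuousWithinAt
    have h1 : |∫ t in Ioc a b, g' t * (S t - t)| ≤
        ∫ t in Ioc a b, (1 + 3 / δ) * A * t ^ (-(7 / 2) + 3 * δ) := by
      rw [← Real.norm_eq_abs]
      refine norm_integral_le_of_norm_le hci ?_
      filter_upwards [ae_restrict_mem measurableSet_Ioc] with t ht
      exact hlogb (Ioc_subset_Icc_self ht)
    refine h1.trans ?_
    rw [integral_const_mul]
    gcongr ?_ * ?_
    rw [← intervalIntegral.integral_of_le hab, integral_rpow (Or.inr ⟨by linarith, fun h ↦ by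
      rw [uIcc_of_le hab] at h
      linarith [h.1]⟩)]
    have e : -(7 / 2) + 3 * δ + 1 = -(5 / 2) + 3 * δ := by ring
    rw [e, ← neg_div_neg_eq, neg_sub]
    have hb1 : 0 ≤ b ^ (-(5 / 2) + 3 * δ) := by positivity
    have ha1 : 0 ≤ a ^ (-(5 / 2) + 3 * δ) := by positivity
    refine div_le_of_le_mul₀ (by linarith) ha1 ?_
    nlinarith
  have hGb : |G b| ≤ 1 / b := by
    have hb1 : 1 ≤ b := ha.trans hab
    have h1 := Real.log_nonneg hb1
    have h2 := Real.log_le_self hb0.le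
    rw [hG, abs_neg, abs_of_nonneg (by positivity), ← add_div, div_le_div_iff₀ (by positivity) hb0]
    nlinarith
  have hga := hgE (left_mem_Icc.mpr hab)
  have hgb := hgE (right_mem_Icc.mpr hab)
  have hfin : (∑ k ∈ Finset.Ioc ⌊a⌋₊ ⌊b⌋₊, Real.log k / (k : ℝ) ^ 3 * c k) -
        (1 / 2 * Real.log a / a ^ 2 + 1 / 4 / a ^ 2) =
      G b + g b * (S b - b) - g a * (S a - a) - ∫ t in Ioc a b, g' t * (S t - t) := by
    have h1 : (∑ k ∈ Finset.Ioc ⌊a⌋₊ ⌊b⌋₊, Real.log k / (k : ℝ) ^ 3 * c k) =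
        g b * S b - g a * S a - ∫ t in Ioc a b, deriv g t * S t := habel
    rw [h1, hint1, hint2]
    simp only [hG]
    ring
  rw [hfin]
  rw [abs_le] at *
  constructor <;> linarith [hGb.1, hGb.2, hga.1, hga.2, hgb.1, hgb.2, hint3.1, hint3.2]

lemma vonMangoldt_sq_div_cube_le (n : ℕ) :
    ArithmeticFunction.vonMangoldt n ^ 2 / (n : ℝ) ^ 3 ≤ 4 * (1 / (n : ℝ) ^ 2) := by
  rcases eq_or_ne n 0 with rfl | hn
  · simp
  have hn0 : (0 : ℝ) < n := by positivity
  have h0 : 0 ≤ ArithmeticFunction.vonMangoldt n := ArithmeticFunction.vonMangoldt_nonneg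
  have h1 : ArithmeticFunction.vonMangoldt n ≤ Real.log n := ArithmeticFunction.vonMangoldt_le_log
  have h2 := Real.log_le_rpow_div hn0.le (by norm_num : (0 : ℝ) < 1 / 2)
  rw [← Real.sqrt_eq_rpow] at h2
  have h3 : ArithmeticFunction.vonMangoldt n ^ 2 ≤ 4 * n := by
    calc _ ≤ (√n / (1 / 2)) ^ 2 := by gcongr; exact h1.trans h2
      _ = 4 * √n ^ 2 := by ring
      _ = _ := by rw [Real.sq_sqrt hn0.le]
  calc _ ≤ 4 * (n : ℝ) / (n : ℝ) ^ 3 := by gcongr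
    _ = _ := by field_simp

lemma summable_vonMangoldt_sq_tail (x : ℝ) : Summable fun n : ℕ ↦
    if x < (n : ℝ) then ArithmeticFunction.vonMangoldt n ^ 2 / (n : ℝ) ^ 3 else 0 := by
  refine Summable.of_nonneg_of_le (fun n ↦ ?_) (fun n ↦ ?_)
    ((Real.summable_one_div_nat_pow.mpr (by norm_num : 1 < 2)).mul_left 4)
  · positivity
  · split_ifs
    · exact vonMangoldt_sq_div_cube_le n
    · positivity

lemma sum_range_vonMangoldt_sq_tail {x : ℝ} (hx : 2 ≤ x) (M : ℕ) :
    ∑ n ∈ Finset.range (M + 1),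
      (if x < (n : ℝ) then ArithmeticFunction.vonMangoldt n ^ 2 / (n : ℝ) ^ 3 else 0) =
    ∑ k ∈ Finset.Ioc ⌊x⌋₊ M, Real.log k / (k : ℝ) ^ 3 *
      (ArithmeticFunction.vonMangoldt k ^ 2 / Real.log k) := by
  rw [← Finset.sum_filter]
  have hset : (Finset.range (M + 1)).filter (fun n : ℕ ↦ x < n) = Finset.Ioc ⌊x⌋₊ M := by
    ext n
    simp only [Finset.mem_filter, Finset.mem_range, Finset.mem_Ioc,
      Nat.floor_lt (by linarith : 0 ≤ x), Nat.lt_succ_iff]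
    tauto
  rw [hset]
  refine Finset.sum_congr rfl fun k hk ↦ ?_
  have hk2 : x < k := (Nat.floor_lt (by linarith)).mp (Finset.mem_Ioc.mp hk).1
  have hlog : Real.log k ≠ 0 := (Real.log_pos (by linarith)).ne'
  have hk0 : (k : ℝ) ≠ 0 := by linarith
  field_simp

end RHBound

open Real ArithmeticFunction

/-- Lemma 2.7 (second part): assuming RH, for any `ε > 0`,
`Σ_{n > x} Λ(n)²/n³ = (1/2)(log x)/x² + (1/4)/x² + O_ε(x^{-5/2+ε})`. -/
theorem vonMangoldt_sq_tail_sum (hRH : RiemannHypothesis) (ε : ℝ) (hε : 0 < ε) :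
    ∃ C : ℝ, 0 < C ∧ ∀ x : ℝ, 2 ≤ x →
      |(∑' n : ℕ, if x < (n : ℝ) then
          ArithmeticFunction.vonMangoldt n ^ 2 / (n : ℝ) ^ 3 else 0) -
        ((1 / 2) * Real.log x / x ^ 2 + (1 / 4) / x ^ 2)| ≤
        C / x ^ ((5 : ℝ) / 2 - ε) := by
  set δ : ℝ := min (ε / 3) (1 / 4) with hδ_def
  have hδ : 0 < δ := lt_min (by positivity) (by norm_num)
  have hδ1 : δ ≤ 1 / 4 := min_le_right _ _
  have hδε : 3 * δ ≤ ε := by linarith [min_le_left (ε / 3) (1 / 4)]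
  obtain ⟨A, hA, hc⟩ := exists_abs_sum_vonMangoldt_sq_div_log_sub_le hRH hδ (by linarith)
  set B : ℝ := 3 * (1 + 3 / δ) * A with hB
  have hB0 : 0 ≤ B := by positivity
  refine ⟨B + 1, by positivity, fun x hx ↦ ?_⟩
  have hx0 : 0 < x := by linarith
  have hlim := (summable_vonMangoldt_sq_tail x).hasSum.tendsto_sum_nat.comp
    (Filter.tendsto_add_atTop_nat 1)
  have hbound := ((hlim.sub_const (1 / 2 * Real.log x / x ^ 2 + 1 / 4 / x ^ 2)).abs)
  have hrhs : Filter.Tendsto (fun M : ℕ ↦ B * x ^ (-(5 / 2) + 3 * δ) + 1 / (M : ℝ)) Filter.atTop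
      (nhds (B * x ^ (-(5 / 2) + 3 * δ) + 0)) :=
    tendsto_const_nhds.add tendsto_one_div_atTop_nhds_zero_nat
  have hle := le_of_tendsto_of_tendsto hbound hrhs (by
    filter_upwards [Filter.eventually_ge_atTop ⌈x⌉₊] with M hM
    have hxM : x ≤ M := Nat.ceil_le.mp hM
    have := abs_sum_mul_log_div_cube_sub_le hδ hδ1 hA hc (by linarith) hxM
    rw [Nat.floor_natCast] at this
    simpa only [Function.comp, sum_range_vonMangoldt_sq_tail hx] using this)
  rw [add_zero] at hle
  refine hle.trans ?_
  rw [div_eq_mul_inv (B + 1), ← Real.rpow_neg hx0.le]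
  have hexp : x ^ (-(5 / 2) + 3 * δ) ≤ x ^ (-((5 : ℝ) / 2 - ε)) :=
    Real.rpow_le_rpow_of_exponent_le (by linarith) (by linarith)
  gcongr
  linarith
end

section
/- For every real α > 0 and every real y ≥ 1, S_α(y) = −y^α/(2α) + ε(y) y^α − α ∫_1^y ε(u) u^{α−1} du + (1/(2α) + α/(α+1)), where S_α(y) = Σ_{h ≤ y} 𝔖(h) h^α − y^{α+1}/(α+1). -/
open Real MeasureTheory

/-- Abel summation for the weights `h ^ α`, over the positive integers up to `y`. -/
theorem sum_mul_rpow_eq_sub_integral (c : ℕ → ℝ) (α y : ℝ) :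
    ∑ h ∈ Finset.Icc 1 ⌊y⌋₊, c h * (h : ℝ) ^ α =
      y ^ α * (∑ h ∈ Finset.Icc 1 ⌊y⌋₊, c h) -
        ∫ u in Set.Ioc 1 y, α * u ^ (α - 1) * ∑ h ∈ Finset.Icc 1 ⌊u⌋₊, c h := by
  have hpos : ∀ t ∈ Set.Icc 1 y, t ≠ 0 := fun t ht => (zero_lt_one.trans_le ht.1).ne'
  have hderiv : ∀ t ∈ Set.Icc 1 y, deriv (fun x : ℝ => x ^ α) t = α * t ^ (α - 1) :=
    fun t ht => (Real.hasDerivAt_rpow_const (Or.inl (hpos t ht))).deriv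
  have hint : IntegrableOn (deriv fun x : ℝ => x ^ α) (Set.Icc 1 y) := by
    rw [integrableOn_congr_fun hderiv measurableSet_Icc]
    refine ContinuousOn.integrableOn_Icc (continuousOn_const.mul ?_)
    exact continuousOn_id.rpow_const fun t ht => Or.inl (hpos t ht)
  have habel := sum_mul_eq_sub_integral_mul₀ (fun n => if n = 0 then 0 else c n) (by simp) y
    (fun t ht => (Real.hasDerivAt_rpow_const (Or.inl (hpos t ht))).differentiableAt) hint
  have hzero : ∀ (g : ℕ → ℝ) (n : ℕ), g 0 = 0 →
      ∑ k ∈ Finset.Icc 0 n, g k = ∑ k ∈ Finset.Icc 1 n, g k := fun g n hg => by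
    rw [← Finset.add_sum_Ioc_eq_sum_Icc (Nat.zero_le n), hg, zero_add]
    rfl
  have hsum : ∀ n : ℕ, ∑ k ∈ Finset.Icc 0 n, (if k = 0 then 0 else c k) =
      ∑ k ∈ Finset.Icc 1 n, c k := fun n => by
    rw [hzero _ n (by simp)]
    refine Finset.sum_congr rfl fun k hk => if_neg ?_
    have := (Finset.mem_Icc.mp hk).1
    omega
  rw [hzero _ _ (by simp)] at habel
  simp only [hsum] at habel
  rw [setIntegral_congr_fun measurableSet_Ioc
    (g := fun u => α * u ^ (α - 1) * ∑ h ∈ Finset.Icc 1 ⌊u⌋₊, c h)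
    fun t ht => by simp only [hderiv t ⟨ht.1.le, ht.2⟩]] at habel
  rw [← habel]
  refine Finset.sum_congr rfl fun k hk => ?_
  have := (Finset.mem_Icc.mp hk).1
  rw [if_neg (by omega), mul_comm]

/-- An antiderivative of `α u ^ α - (α / 2) u ^ (α - 1) log u`. -/
theorem hasDerivAt_rpow_sub_rpow_mul_log {α u : ℝ} (hα : 0 < α) (hu : 0 < u) :
    HasDerivAt
      (fun x : ℝ => α / (α + 1) * x ^ (α + 1) - (x ^ α * Real.log x - x ^ α / α) / 2)
      (α * u ^ (α - 1) * (u - Real.log u / 2)) u := by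
  have h₁ := Real.hasDerivAt_rpow_const (p := α + 1) (Or.inl hu.ne')
  have h₂ := Real.hasDerivAt_rpow_const (p := α) (Or.inl hu.ne')
  refine ((h₁.const_mul _).sub
    (((h₂.mul (Real.hasDerivAt_log hu.ne')).sub (h₂.div_const α)).div_const 2)).congr_deriv ?_
  have hα' : α + 1 ≠ 0 := by positivity
  have hrpow : u ^ α = u ^ (α - 1) * u := by
    rw [← Real.rpow_add_one hu.ne', sub_add_cancel]
  rw [add_sub_cancel_right, hrpow]
  field_simp
  ring

/-- Partial summation formula (2) for `S_α(y) = Σ_{h ≤ y} 𝔖(h) h^α - y^{α+1}/(α+1)`: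
`S_α(y) = -y^α/(2α) + ε(y) y^α - α ∫_1^y ε(u) u^{α-1} du + (1/(2α) + α/(α+1))`. -/
theorem S_alpha_partial_summation (α : ℝ) (hα : 0 < α) (y : ℝ) (hy : 1 ≤ y) :
    (∑ h ∈ Finset.Icc 1 ⌊y⌋₊, singularSeries h * (h : ℝ) ^ α) - y ^ (α + 1) / (α + 1) =
      -y ^ α / (2 * α) + epsErr y * y ^ α -
        α * (∫ u in (1 : ℝ)..y, epsErr u * u ^ (α - 1)) +
        (1 / (2 * α) + α / (α + 1)) := by
  have hy₀ : 0 < y := zero_lt_one.trans_le hy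
  have hpos : ∀ t ∈ Set.Icc 1 y, t ≠ 0 := fun t ht => (zero_lt_one.trans_le ht.1).ne'
  have hrpow : ContinuousOn (fun u : ℝ => α * u ^ (α - 1)) (Set.Icc 1 y) :=
    continuousOn_const.mul (continuousOn_id.rpow_const fun t ht => Or.inl (hpos t ht))
  have hmain : IntervalIntegrable (fun u : ℝ => α * u ^ (α - 1) * (u - Real.log u / 2))
      volume 1 y := by
    refine ContinuousOn.intervalIntegrable ?_
    rw [Set.uIcc_of_le hy]
    exact hrpow.mul (continuousOn_id.sub
      ((continuousOn_id.log hpos).div_const 2))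
  have hsum : IntervalIntegrable
      (fun u : ℝ => α * u ^ (α - 1) * ∑ h ∈ Finset.Icc 1 ⌊u⌋₊, singularSeries h)
      volume 1 y := by
    rw [intervalIntegrable_iff_integrableOn_Icc_of_le hy]
    exact integrableOn_mul_sum_Icc _ zero_le_one hrpow.integrableOn_Icc
  have hε : α * (∫ u in (1 : ℝ)..y, epsErr u * u ^ (α - 1)) =
      (∫ u in (1 : ℝ)..y, α * u ^ (α - 1) * ∑ h ∈ Finset.Icc 1 ⌊u⌋₊, singularSeries h) -
        ∫ u in (1 : ℝ)..y, α * u ^ (α - 1) * (u - Real.log u / 2) := by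
    rw [← intervalIntegral.integral_sub hsum hmain, ← intervalIntegral.integral_const_mul]
    refine intervalIntegral.integral_congr fun u _ => ?_
    simp only [epsErr]
    ring
  have hG := intervalIntegral.integral_eq_sub_of_hasDerivAt
    (fun u hu => hasDerivAt_rpow_sub_rpow_mul_log hα
      (zero_lt_one.trans_le (Set.uIcc_of_le hy ▸ hu).1)) hmain
  rw [hε, hG, sum_mul_rpow_eq_sub_integral, intervalIntegral.integral_of_le hy, epsErr,
    Real.rpow_add_one hy₀.ne']
  simp only [Real.one_rpow, Real.log_one]
  field_simp
  ring
end

section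
/- For every real α > 1 and every real y ≥ 1, T_α(y) = 1/((α−1) y^{α−1}) − ε(y)/y^α − 1/(2α y^α) + α ∫_y^∞ ε(u)/u^{α+1} du, where T_α(y) = Σ_{h > y} 𝔖(h)/h^α (both the series and the integral converge). -/
open Real MeasureTheory

/-- The singular series grows more slowly than any positive power. -/
theorem exists_abs_singularSeries_le {δ : ℝ} (hδ : 0 < δ) :
    ∃ K : ℝ, 0 ≤ K ∧ ∀ n : ℕ, n ≠ 0 → |singularSeries n| ≤ K * (n : ℝ) ^ δ := by
  set C : ℝ := 2 * (∏' p : Nat.Primes,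
    if 2 < (p : ℕ) then (1 - 1 / ((p : ℝ) - 1) ^ 2) else 1)
  obtain ⟨P, hP⟩ : ∃ P : ℕ, ∀ p : ℕ, P ≤ p → (2 : ℝ) ≤ (p : ℝ) ^ δ :=
    Filter.eventually_atTop.1 (((tendsto_rpow_atTop hδ).comp
      tendsto_natCast_atTop_atTop).eventually_ge_atTop 2)
  refine ⟨|C| * 2 ^ P, by positivity, fun n hn => ?_⟩
  have hprod : |∏ p ∈ n.primeFactors.filter (fun p => 2 < p), ((p : ℝ) - 1) / ((p : ℝ) - 2)| ≤
      2 ^ P * (n : ℝ) ^ δ := by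
    set s := n.primeFactors.filter (fun p => 2 < p)
    have hs2 : ∀ p ∈ s, (3 : ℝ) ≤ p := fun p hp => by
      have : 3 ≤ p := (Finset.mem_filter.1 hp).2
      exact_mod_cast this
    rw [Finset.abs_prod]
    calc ∏ p ∈ s, |((p : ℝ) - 1) / ((p : ℝ) - 2)|
        ≤ ∏ p ∈ s, (if p < P then (2 : ℝ) else 1) * (p : ℝ) ^ δ := by
          refine Finset.prod_le_prod (fun _ _ => abs_nonneg _) fun p hp => ?_
          have h3 := hs2 p hp
          have h2 : |((p : ℝ) - 1) / ((p : ℝ) - 2)| ≤ 2 := by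
            rw [abs_of_nonneg (div_nonneg (by linarith) (by linarith)),
              div_le_iff₀ (by linarith)]
            linarith
          refine h2.trans ?_
          split_ifs with h
          · have := Real.one_le_rpow (show (1 : ℝ) ≤ p by linarith) hδ.le
            linarith
          · simpa using hP p (not_lt.1 h)
      _ = (∏ p ∈ s, if p < P then (2 : ℝ) else 1) * ((∏ p ∈ s, p : ℕ) : ℝ) ^ δ := by
          rw [Finset.prod_mul_distrib, Nat.cast_prod,
            Real.finsetProd_rpow _ _ fun _ _ => Nat.cast_nonneg _]
      _ ≤ 2 ^ P * (n : ℝ) ^ δ := by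
          gcongr
          · rw [← Finset.prod_filter, Finset.prod_const]
            refine pow_le_pow_right₀ one_le_two ?_
            calc (s.filter (· < P)).card ≤ (Finset.range P).card :=
                  Finset.card_le_card fun p hp =>
                    Finset.mem_range.2 (Finset.mem_filter.1 hp).2
              _ = P := Finset.card_range P
          · exact Nat.le_of_dvd (Nat.pos_of_ne_zero hn)
              ((Finset.prod_dvd_prod_of_subset _ _ _ (Finset.filter_subset _ _)).trans
                n.prod_primeFactors_dvd)
  unfold singularSeries
  split_ifs
  · rw [abs_mul, mul_assoc]
    gcongr
  · rw [abs_zero]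
    positivity

theorem abs_sum_Icc_floor_le {c : ℕ → ℝ} {K δ : ℝ} (hK : 0 ≤ K) (hδ : 0 ≤ δ)
    (hc : ∀ n : ℕ, n ≠ 0 → |c n| ≤ K * (n : ℝ) ^ δ) {u : ℝ} (hu : 0 < u) :
    |∑ k ∈ Finset.Icc 1 ⌊u⌋₊, c k| ≤ K * u ^ (δ + 1) := by
  have hfl := Nat.floor_le hu.le
  calc |∑ k ∈ Finset.Icc 1 ⌊u⌋₊, c k| ≤ ∑ k ∈ Finset.Icc 1 ⌊u⌋₊, |c k| :=
        Finset.abs_sum_le_sum_abs _ _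
    _ ≤ ∑ _k ∈ Finset.Icc 1 ⌊u⌋₊, K * u ^ δ := by
        refine Finset.sum_le_sum fun k hk => ?_
        obtain ⟨h1, h2⟩ := Finset.mem_Icc.1 hk
        refine (hc k (by omega)).trans ?_
        have : (k : ℝ) ≤ u := (Nat.cast_le.2 h2).trans hfl
        gcongr
    _ = ⌊u⌋₊ * (K * u ^ δ) := by simp
    _ ≤ u * (K * u ^ δ) := by gcongr
    _ = K * u ^ (δ + 1) := by rw [Real.rpow_add_one hu.ne']; ring

theorem integrableOn_sum_Icc_floor_div_rpow {c : ℕ → ℝ} {K δ α y : ℝ} (hK : 0 ≤ K) (hδ : 0 ≤ δ)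
    (hc : ∀ n : ℕ, n ≠ 0 → |c n| ≤ K * (n : ℝ) ^ δ) (hα : δ + 1 < α) (hy : 0 < y) :
    IntegrableOn (fun u : ℝ => (∑ k ∈ Finset.Icc 1 ⌊u⌋₊, c k) / u ^ (α + 1)) (Set.Ioi y) := by
  have hg : IntegrableOn (fun u : ℝ => K * u ^ (δ - α)) (Set.Ioi y) :=
    (integrableOn_Ioi_rpow_of_lt (by linarith) hy).const_mul K
  refine Integrable.mono' hg ?_ ?_
  · have h1 : Measurable fun u : ℝ => ∑ k ∈ Finset.Icc 1 ⌊u⌋₊, c k :=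
      (measurable_from_nat (f := fun n => ∑ k ∈ Finset.Icc 1 n, c k)).comp Nat.measurable_floor
    exact (h1.div (by fun_prop)).aestronglyMeasurable
  · filter_upwards [ae_restrict_mem measurableSet_Ioi] with u hu
    have hu0 : 0 < u := hy.trans hu
    rw [Real.norm_eq_abs, abs_div, abs_of_pos (Real.rpow_pos_of_pos hu0 _),
      div_le_iff₀ (Real.rpow_pos_of_pos hu0 _), mul_assoc, ← Real.rpow_add hu0]
    convert! abs_sum_Icc_floor_le hK hδ hc hu0 using 3
    ring

theorem summable_ite_lt_div_rpow {c : ℕ → ℝ} {K δ α y : ℝ}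
    (hc : ∀ n : ℕ, n ≠ 0 → |c n| ≤ K * (n : ℝ) ^ δ) (hα : δ + 1 < α) (hy : 0 < y) :
    Summable fun h : ℕ => if y < (h : ℝ) then c h / (h : ℝ) ^ α else 0 := by
  refine Summable.of_norm_bounded
    (g := fun h : ℕ => |K| * (h : ℝ) ^ (δ - α))
    ((Real.summable_nat_rpow.2 (by linarith)).mul_left _) fun h => ?_
  split_ifs with hh
  · have h0 : (0 : ℝ) < h := hy.trans hh
    rw [Real.norm_eq_abs, abs_div, abs_of_pos (Real.rpow_pos_of_pos h0 _),
      div_le_iff₀ (Real.rpow_pos_of_pos h0 _), mul_assoc, ← Real.rpow_add h0, sub_add_cancel]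
    refine (hc h (by exact_mod_cast h0.ne')).trans ?_
    gcongr
    exact le_abs_self K
  · rw [norm_zero]
    positivity

/-- Partial summation for the tail of a Dirichlet series. -/
theorem tsum_ite_lt_div_rpow {c : ℕ → ℝ} {K δ α y : ℝ} (hK : 0 ≤ K) (hδ : 0 ≤ δ)
    (hc : ∀ n : ℕ, n ≠ 0 → |c n| ≤ K * (n : ℝ) ^ δ) (hα : δ + 1 < α) (hy : 0 < y) :
    (∑' h : ℕ, if y < (h : ℝ) then c h / (h : ℝ) ^ α else 0) =
      -((∑ k ∈ Finset.Icc 1 ⌊y⌋₊, c k) / y ^ α) +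
        α * ∫ u in Set.Ioi y, (∑ k ∈ Finset.Icc 1 ⌊u⌋₊, c k) / u ^ (α + 1) := by
  have hS := (summable_ite_lt_div_rpow hc hα hy).hasSum.tendsto_sum_nat.comp
    (Filter.tendsto_add_atTop_nat 1)
  refine tendsto_nhds_unique hS ?_
  have hI := intervalIntegral_tendsto_integral_Ioi y
    (integrableOn_sum_Icc_floor_div_rpow hK hδ hc hα hy) (tendsto_natCast_atTop_atTop (R := ℝ))
  have hB : Filter.Tendsto (fun N : ℕ => (∑ k ∈ Finset.Icc 1 N, c k) / (N : ℝ) ^ α)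
      Filter.atTop (nhds 0) := by
    have h0 : Filter.Tendsto (fun N : ℕ => K * (N : ℝ) ^ (-(α - (δ + 1)))) Filter.atTop
        (nhds 0) := by
      simpa using ((tendsto_rpow_neg_atTop (sub_pos.2 hα)).comp
        (tendsto_natCast_atTop_atTop (R := ℝ))).const_mul K
    refine squeeze_zero_norm' ?_ h0
    filter_upwards [Filter.eventually_gt_atTop 0] with N hN
    have hN0 : (0 : ℝ) < N := by exact_mod_cast hN
    rw [Real.norm_eq_abs, abs_div, abs_of_pos (Real.rpow_pos_of_pos hN0 _),
      div_le_iff₀ (Real.rpow_pos_of_pos hN0 _), mul_assoc, ← Real.rpow_add hN0, neg_sub,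
      sub_add_cancel]
    simpa using abs_sum_Icc_floor_le hK hδ hc hN0
  have hlim := (hB.sub_const ((∑ k ∈ Finset.Icc 1 ⌊y⌋₊, c k) / y ^ α)).add (hI.const_mul α)
  rw [zero_sub] at hlim
  refine hlim.congr' ?_
  filter_upwards [Filter.eventually_ge_atTop ⌈y⌉₊] with N hN
  have hyN : y ≤ N := Nat.ceil_le.1 hN
  set c' : ℕ → ℝ := fun k => if k = 0 then 0 else c k
  have hsum : ∀ n : ℕ, ∑ k ∈ Finset.Icc 0 n, c' k = ∑ k ∈ Finset.Icc 1 n, c k := fun n => by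
    rw [← Finset.sum_subset (Finset.Icc_subset_Icc_left (zero_le_one' ℕ))]
    · exact Finset.sum_congr rfl fun k hk => if_neg (by have := (Finset.mem_Icc.1 hk).1; omega)
    · intro k hk hk'
      simp only [Finset.mem_Icc] at hk hk'
      exact if_pos (by omega)
  have hd : ∀ t : ℝ, 0 < t →
      HasDerivAt (fun t : ℝ => t ^ (-α)) (-α * t ^ (-α - 1)) t := fun t ht =>
    Real.hasDerivAt_rpow_const (Or.inl ht.ne')
  have hint : IntegrableOn (deriv fun t : ℝ => t ^ (-α)) (Set.Icc y N) := by
    have hcont : ContinuousOn (fun t : ℝ => -α * t ^ (-α - 1)) (Set.Icc y N) := fun t ht =>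
      (continuousAt_const.mul (Real.continuousAt_rpow_const _ _
        (Or.inl (hy.trans_le ht.1).ne'))).continuousWithinAt
    exact hcont.integrableOn_Icc.congr_fun
      (fun t ht => (hd t (hy.trans_le ht.1)).deriv.symm) measurableSet_Icc
  have habel := sum_mul_eq_sub_sub_integral_mul c' hy.le hyN
    (fun t ht => (hd t (hy.trans_le ht.1)).differentiableAt) hint
  simp only [hsum, Nat.floor_natCast] at habel
  have hints : ∫ t in Set.Ioc y N, deriv (fun t : ℝ => t ^ (-α)) t *
        ∑ k ∈ Finset.Icc 1 ⌊t⌋₊, c k =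
      -(α * ∫ t in y..N, (∑ k ∈ Finset.Icc 1 ⌊t⌋₊, c k) / t ^ (α + 1)) := by
    rw [intervalIntegral.integral_of_le hyN, ← integral_const_mul, ← integral_neg]
    refine setIntegral_congr_fun measurableSet_Ioc fun t ht => ?_
    have ht0 : 0 < t := hy.trans ht.1
    simp only [(hd t ht0).deriv]
    rw [show -α - 1 = -(α + 1) by ring, Real.rpow_neg ht0.le]
    ring
  have hleft : ∑ h ∈ Finset.range (N + 1), (if y < (h : ℝ) then c h / (h : ℝ) ^ α else 0) =
      ∑ k ∈ Finset.Ioc ⌊y⌋₊ N, (k : ℝ) ^ (-α) * c' k := by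
    rw [← Finset.sum_filter]
    refine Finset.sum_congr ?_ fun k hk => ?_
    · ext k
      simp only [Finset.mem_filter, Finset.mem_range, Finset.mem_Ioc, Nat.floor_lt hy.le, Nat.lt_succ_iff]
      exact and_comm
    · have hk0 : k ≠ 0 := by have := (Finset.mem_Ioc.1 hk).1; omega
      rw [Real.rpow_neg (Nat.cast_nonneg k), show c' k = c k from if_neg hk0]
      ring
  simp only [Function.comp_apply]
  rw [hleft, habel, hints, Real.rpow_neg (Nat.cast_nonneg N), Real.rpow_neg hy.le]
  ring

/-- The integral of `log u / u ^ (α + 1)` over `(y, ∞)`, together with its convergence. -/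
theorem integral_Ioi_log_div_rpow {α y : ℝ} (hα : 0 < α) (hy : 1 ≤ y) :
    IntegrableOn (fun u : ℝ => Real.log u / u ^ (α + 1)) (Set.Ioi y) ∧
      ∫ u in Set.Ioi y, Real.log u / u ^ (α + 1) =
        Real.log y / (α * y ^ α) + 1 / (α ^ 2 * y ^ α) := by
  have hd : ∀ u ∈ Set.Ici y, HasDerivAt
      (fun u : ℝ => -(Real.log u / u ^ α / α + u ^ (-α) / α ^ 2))
      (Real.log u / u ^ (α + 1)) u := fun u hu => by
    have hu0 : 0 < u := one_pos.trans_le (hy.trans hu)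
    have hpos := Real.rpow_pos_of_pos hu0 α
    have h1 := Real.hasDerivAt_rpow_const (p := α) (Or.inl hu0.ne')
    have h2 := Real.hasDerivAt_rpow_const (p := -α) (Or.inl hu0.ne')
    refine (((((Real.hasDerivAt_log hu0.ne').div h1 hpos.ne').div_const α).add
      (h2.div_const (α ^ 2))).neg).congr_deriv ?_
    rw [Real.rpow_sub_one hu0.ne', Real.rpow_sub_one hu0.ne', Real.rpow_add_one hu0.ne',
      Real.rpow_neg hu0.le]
    field_simp
    ring
  have hlim : Filter.Tendsto (fun u : ℝ => -(Real.log u / u ^ α / α + u ^ (-α) / α ^ 2))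
      Filter.atTop (nhds 0) := by
    simpa using (((isLittleO_log_rpow_atTop hα).tendsto_div_nhds_zero.div_const α).add
      ((tendsto_rpow_neg_atTop hα).div_const (α ^ 2))).neg
  have hnn : ∀ u ∈ Set.Ioi y, 0 ≤ Real.log u / u ^ (α + 1) := fun u hu => by
    have hu1 : 1 ≤ u := hy.trans (le_of_lt hu)
    exact div_nonneg (Real.log_nonneg hu1) (Real.rpow_nonneg (by linarith) _)
  refine ⟨integrableOn_Ioi_deriv_of_nonneg' hd hnn hlim, ?_⟩
  rw [integral_Ioi_of_hasDerivAt_of_nonneg' hd hnn hlim, Real.rpow_neg (by linarith)]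
  have := Real.rpow_pos_of_pos (one_pos.trans_le hy) α
  field_simp
  ring

/-- Partial summation formula (3) for `T_α(y) = Σ_{h > y} 𝔖(h)/h^α` (`α > 1`):
the series and the integral converge, and
`T_α(y) = 1/((α-1) y^{α-1}) - ε(y)/y^α - 1/(2α y^α) + α ∫_y^∞ ε(u)/u^{α+1} du`. -/
theorem T_alpha_partial_summation (α : ℝ) (hα : 1 < α) (y : ℝ) (hy : 1 ≤ y) :
    Summable (fun h : ℕ => if y < (h : ℝ) then singularSeries h / (h : ℝ) ^ α else 0) ∧
      IntegrableOn (fun u : ℝ => epsErr u / u ^ (α + 1)) (Set.Ioi y) ∧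
      (∑' h : ℕ, if y < (h : ℝ) then singularSeries h / (h : ℝ) ^ α else 0) =
        1 / ((α - 1) * y ^ (α - 1)) - epsErr y / y ^ α - 1 / (2 * α * y ^ α) +
          α * ∫ u in Set.Ioi y, epsErr u / u ^ (α + 1) := by
  have hy0 : 0 < y := one_pos.trans_le hy
  obtain ⟨K, hK, hc⟩ := exists_abs_singularSeries_le (δ := (α - 1) / 2) (by linarith)
  have hδ : 0 ≤ (α - 1) / 2 := by linarith
  have hδα : (α - 1) / 2 + 1 < α := by linarith
  have hS := integrableOn_sum_Icc_floor_div_rpow hK hδ hc hδα hy0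
  have hP : IntegrableOn (fun u : ℝ => u ^ (-α)) (Set.Ioi y) :=
    integrableOn_Ioi_rpow_of_lt (by linarith) hy0
  obtain ⟨hL, hLint⟩ := integral_Ioi_log_div_rpow (by linarith : 0 < α) hy
  have heq : Set.EqOn
      (fun u : ℝ => (∑ h ∈ Finset.Icc 1 ⌊u⌋₊, singularSeries h) / u ^ (α + 1) - u ^ (-α) +
        Real.log u / u ^ (α + 1) / 2)
      (fun u : ℝ => epsErr u / u ^ (α + 1)) (Set.Ioi y) := fun u hu => by
    have hu0 : 0 < u := hy0.trans hu
    have := Real.rpow_pos_of_pos hu0 α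
    simp only [epsErr, Real.rpow_add_one hu0.ne', Real.rpow_neg hu0.le]
    field_simp
  refine ⟨summable_ite_lt_div_rpow hc hδα hy0,
    ((hS.sub hP).add (hL.div_const 2)).congr_fun heq measurableSet_Ioi, ?_⟩
  have hadd := integral_add (hS.sub hP) (hL.div_const 2)
  have hsub := integral_sub hS hP
  simp only [Pi.sub_apply] at hadd
  rw [tsum_ite_lt_div_rpow hK hδ hc hδα hy0, ← setIntegral_congr_fun measurableSet_Ioi heq,
    hadd, hsub, integral_div, hLint,
    integral_Ioi_rpow_of_lt (by linarith) hy0, epsErr, show -α + 1 = -(α - 1) by ring,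
    Real.rpow_neg hy0.le, Real.rpow_sub_one hy0.ne']
  have := Real.rpow_pos_of_pos hy0 α
  have h1 : α - 1 ≠ 0 := by linarith
  have h0 : α ≠ 0 := by linarith
  field_simp
  ring
end
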